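/- arXiv:2605.08848 — 4 statements merged into one kernel-verified Lean document; each statement's English description precedes it below -/
import Mathlib

section
/- For every tree T and every integer s ≥ 1, there exists a real number C = C(T,s) ≥ 1 such that every graph G that is T-free and K_{s,s}-free satisfies χ(G) ≤ C · R(s, ω(G)+1). -/
open SimpleGraph

/-- The chromatic number of a graph as a natural number. -/
noncomputable def chromNum {V : Type*} (G : SimpleGraph V) : ℕ :=
  G.chromaticNumber.toNat

/-- The stability (independence) number of a graph. -/
noncomputable def indepNum {V : Type*} (G : SimpleGraph V) : ℕ := Gᶜ.cliqueNum

/-- A stable (independent) set in a graph. -/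
def IsStableSet {V : Type*} (G : SimpleGraph V) (S : Finset V) : Prop :=
  ∀ u ∈ S, ∀ v ∈ S, ¬ G.Adj u v

/-- The Ramsey number `R(s,w)`: the least `n ≥ 1` such that every graph on `n`
vertices contains a stable set of size `s` or a clique of size `w`. -/
noncomputable def ramsey (s w : ℕ) : ℕ :=
  sInf {n : ℕ | 1 ≤ n ∧ ∀ G : SimpleGraph (Fin n),
    (∃ S : Finset (Fin n), IsStableSet G S ∧ S.card = s) ∨
    (∃ S : Finset (Fin n), G.IsNClique w S)}

/-- `G` has no induced subgraph isomorphic to `H`. -/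
def IndFree {W V : Type*} (H : SimpleGraph W) (G : SimpleGraph V) : Prop :=
  ¬ Nonempty (H ↪g G)

open scoped Classical in
/-- average of `f` over the neighbours of `x` -/
noncomputable def nbAvg {V : Type} [Fintype V] (H : SimpleGraph V) (x : V) (f : V → ℝ) : ℝ :=
  (∑ z ∈ H.neighborFinset x, f z) / (H.degree x)

open scoped Classical in
theorem nbAvg_mono {V : Type} [Fintype V] (H : SimpleGraph V) (x : V) (f g : V → ℝ)
    (h : ∀ z, H.Adj x z → f z ≤ g z) : nbAvg H x f ≤ nbAvg H x g := by
  unfold nbAvg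
  apply div_le_div_of_nonneg_right _ (by positivity)
  exact Finset.sum_le_sum fun z hz => h z (by simpa using hz)

open scoped Classical in
theorem nbAvg_const {V : Type} [Fintype V] (H : SimpleGraph V) (x : V) (c : ℝ)
    (h : 0 < H.degree x) : nbAvg H x (fun _ => c) = c := by
  unfold nbAvg
  have : (0:ℝ) < H.degree x := by exact_mod_cast h
  simp only [Finset.sum_const, SimpleGraph.card_neighborFinset_eq_degree, nsmul_eq_mul]
  field_simp

theorem nbAvg_add {V : Type} [Fintype V] (H : SimpleGraph V) (x : V) (f g : V → ℝ) :
    nbAvg H x (fun z => f z + g z) = nbAvg H x f + nbAvg H x g := by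
  unfold nbAvg
  rw [Finset.sum_add_distrib, add_div]

theorem nbAvg_smul {V : Type} [Fintype V] (H : SimpleGraph V) (x : V) (c : ℝ) (f : V → ℝ) :
    nbAvg H x (fun z => c * f z) = c * nbAvg H x f := by
  unfold nbAvg
  rw [← Finset.mul_sum, mul_div_assoc]

theorem nbAvg_nonneg {V : Type} [Fintype V] (H : SimpleGraph V) (x : V) (f : V → ℝ)
    (h : ∀ z, 0 ≤ f z) : 0 ≤ nbAvg H x f := by
  unfold nbAvg
  exact div_nonneg (Finset.sum_nonneg fun z _ => h z) (by positivity)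

theorem nbAvg_sum {V : Type} [Fintype V] (H : SimpleGraph V) (x : V) {ι : Type} (s : Finset ι)
    (f : ι → V → ℝ) :
    nbAvg H x (fun z => ∑ i ∈ s, f i z) = ∑ i ∈ s, nbAvg H x (f i) := by
  unfold nbAvg
  rw [Finset.sum_comm, Finset.sum_div]

open scoped Classical in
theorem nbAvg_le_div {V : Type} [Fintype V] (H : SimpleGraph V) (x : V) (f : V → ℝ) (b d : ℝ)
    (hd : 0 < d) (hdx : d ≤ H.degree x)
    (h : ∀ z, 0 ≤ f z) (hf : ∑ z, f z ≤ b) : nbAvg H x f ≤ b / d := by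
  unfold nbAvg
  have h1 : ∑ z ∈ H.neighborFinset x, f z ≤ ∑ z, f z :=
    Finset.sum_le_sum_of_subset_of_nonneg (Finset.subset_univ _) (fun i _ _ => h i)
  have h0 : 0 ≤ ∑ z, f z := Finset.sum_nonneg fun i _ => h i
  exact div_le_div₀ (by linarith) (by linarith) hd (by convert hdx)

open scoped Classical in
/-- stationarity / reversibility -/
theorem sum_deg_nbAvg {V : Type} [Fintype V] (H : SimpleGraph V)
    (hpos : ∀ v, 0 < H.degree v) (β : V → V → ℝ) :
    ∑ x, (H.degree x : ℝ) * nbAvg H x (fun z => β x z)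
      = ∑ z, ∑ x ∈ H.neighborFinset z, β x z := by
  have h1 : ∀ x, (H.degree x : ℝ) * nbAvg H x (fun z => β x z)
      = ∑ z ∈ H.neighborFinset x, β x z := by
    intro x
    unfold nbAvg
    have : (0:ℝ) < H.degree x := by exact_mod_cast hpos x
    field_simp
  simp_rw [h1]
  apply Finset.sum_comm'
  intro x y
  simp [SimpleGraph.adj_comm]

/-- `φ` is an induced embedding on `S`. -/
def GoodOn {W V : Type} (T : SimpleGraph W) (H : SimpleGraph V) (S : Finset W) (φ : W → V) : Prop :=
  ∀ u ∈ S, ∀ v ∈ S, u ≠ v → φ u ≠ φ v ∧ (T.Adj u v ↔ H.Adj (φ u) (φ v))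

open scoped Classical in
/-- indicator of failing to be an induced embedding on `S` -/
noncomputable def badInd {W V : Type} (T : SimpleGraph W) (H : SimpleGraph V) (S : Finset W)
    (φ : W → V) : ℝ := if GoodOn T H S φ then 0 else 1

open scoped Classical in
/-- The expectation functional of a random tree homomorphism on the subtree `S`. -/
structure TreeExp {W V : Type} [Fintype V] (T : SimpleGraph W) (H : SimpleGraph V)
    (d b ε : ℝ) (S : Finset W) (E : ((W → V) → ℝ) →ₗ[ℝ] ℝ) : Prop where
  pos : ∀ f : (W → V) → ℝ, (∀ φ, 0 ≤ f φ) → 0 ≤ E f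
  one : E (fun _ => 1) = 1
  stat : ∀ u ∈ S, ∀ f : V → ℝ, E (fun φ => f (φ u)) * (∑ x, (H.degree x : ℝ))
    = ∑ x, (H.degree x : ℝ) * f x
  two : ∀ u ∈ S, ∀ p ∈ S, u ≠ p → ∀ β : V → V → ℝ, (∀ x y, 0 ≤ β x y) →
    (∀ y, ∑ x, β x y ≤ b) → E (fun φ => β (φ u) (φ p)) ≤ b / d
  three : E (badInd T H S) ≤ (S.card : ℝ) ^ 2 * ε

theorem TreeExp.mono {W V : Type} [Fintype V] {T : SimpleGraph W} {H : SimpleGraph V}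
    {d b ε : ℝ} {S : Finset W} {E : ((W → V) → ℝ) →ₗ[ℝ] ℝ} (h : TreeExp T H d b ε S E)
    {f g : (W → V) → ℝ} (hfg : ∀ φ, f φ ≤ g φ) : E f ≤ E g := by
  have := h.pos (g - f) (fun φ => by simpa using hfg φ)
  rw [map_sub] at this
  linarith

theorem TreeExp.const {W V : Type} [Fintype V] {T : SimpleGraph W} {H : SimpleGraph V}
    {d b ε : ℝ} {S : Finset W} {E : ((W → V) → ℝ) →ₗ[ℝ] ℝ} (h : TreeExp T H d b ε S E)
    (c : ℝ) : E (fun _ => c) = c := by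
  have : (fun _ : W → V => c) = c • (fun _ => (1:ℝ)) := by ext; simp
  rw [this, map_smul, h.one]; simp

open scoped Classical in
theorem treeExp_base {W V : Type} [Fintype V] [Nonempty V] (T : SimpleGraph W) (H : SimpleGraph V)
    (d b ε : ℝ) (hε : 0 ≤ ε) (hd0 : 0 < d) (hd : ∀ v, d ≤ H.degree v) (r : W) :
    ∃ E, TreeExp T H d b ε {r} E := by
  have hpos : 0 < ∑ x, (H.degree x : ℝ) :=
    Finset.sum_pos (fun x _ => by linarith [hd x]) Finset.univ_nonempty
  refine ⟨{ toFun := fun f => (∑ x, (H.degree x : ℝ) * f (fun _ => x)) / ∑ x, (H.degree x : ℝ)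
            map_add' := ?_, map_smul' := ?_ }, ?_⟩
  · intro f g
    simp [mul_add, Finset.sum_add_distrib, add_div]
  · intro c f
    simp only [Pi.smul_apply, smul_eq_mul, RingHom.id_apply, ← mul_div_assoc, Finset.mul_sum]
    congr 1
    exact Finset.sum_congr rfl fun x _ => by ring
  · constructor
    · intro f hf
      exact div_nonneg (Finset.sum_nonneg fun x _ => mul_nonneg (by positivity) (hf _)) hpos.le
    · simp [hpos.ne']
    · intro u _ f
      simp only [LinearMap.coe_mk, AddHom.coe_mk]
      field_simp
    · intro u hu p hp hup
      simp only [Finset.mem_singleton] at hu hp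
      exact absurd (hu.trans hp.symm) hup
    · have : badInd T H {r} = 0 := by
        ext φ
        have : GoodOn T H {r} φ := by
          intro u hu p hp hup
          simp only [Finset.mem_singleton] at hu hp
          exact absurd (hu.trans hp.symm) hup
        simp [badInd, this]
      rw [this, map_zero]
      positivity

/-- extension functional -/
noncomputable def extE {W V : Type} [Fintype V] [DecidableEq W] (H : SimpleGraph V)
    (E : ((W → V) → ℝ) →ₗ[ℝ] ℝ) (p w : W) : ((W → V) → ℝ) →ₗ[ℝ] ℝ where
  toFun f := E (fun φ => nbAvg H (φ p) (fun z => f (Function.update φ w z)))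
  map_add' f g := by
    rw [← map_add]; congr 1; ext φ; simp [nbAvg_add]
  map_smul' c f := by
    rw [← map_smul]; congr 1; ext φ; simp [nbAvg_smul]

theorem extE_apply {W V : Type} [Fintype V] [DecidableEq W] (H : SimpleGraph V)
    (E : ((W → V) → ℝ) →ₗ[ℝ] ℝ) (p w : W) (f) : extE H E p w f =
    E (fun φ => nbAvg H (φ p) (fun z => f (Function.update φ w z))) := rfl

open scoped Classical in
theorem treeExp_step {W V : Type} [Fintype V] [Nonempty V] [DecidableEq W]
    (T : SimpleGraph W) (H : SimpleGraph V)
    (d b δ : ℝ) (hb : 0 ≤ b) (hδ : 0 ≤ δ) (hd0 : 0 < d) (hd : ∀ v, d ≤ H.degree v)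
    (hB : ∀ y, ((Finset.univ.filter fun x =>
      δ * H.degree y ≤ ((H.neighborFinset x ∩ H.neighborFinset y).card : ℝ)).card : ℝ) ≤ b)
    (S : Finset W) (E) (hE : TreeExp T H d b (1 / d + δ + b / d) S E) (p w : W) (hp : p ∈ S)
    (hw : w ∉ S) (hpw : T.Adj p w) (huniq : ∀ u ∈ S, T.Adj u w → u = p) :
    TreeExp T H d b (1 / d + δ + b / d) (insert w S) (extE H E p w) := by
  have hposd : ∀ v, 0 < H.degree v := fun v => by
    have := hd v
    have h2 : (0:ℝ) < H.degree v := by linarith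
    exact_mod_cast h2
  have hne : ∀ u ∈ S, u ≠ w := fun u hu h => hw (h ▸ hu)
  have hpos : 0 < ∑ x, (H.degree x : ℝ) :=
    Finset.sum_pos (fun x _ => by linarith [hd x]) Finset.univ_nonempty
  constructor
  · intro f hf
    rw [extE_apply]
    exact hE.pos _ fun φ => nbAvg_nonneg _ _ _ fun z => hf _
  · rw [extE_apply]
    simp only [nbAvg_const H _ _ (hposd _)]
    exact hE.one
  · intro u hu f
    rw [extE_apply]
    rcases Finset.mem_insert.1 hu with rfl | hu1
    · simp only [Function.update_self]
      rw [hE.stat p hp (fun x => nbAvg H x f), sum_deg_nbAvg H hposd (fun _ z => f z)]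
      simp
    · simp only [Function.update_of_ne (hne u hu1), nbAvg_const H _ _ (hposd _)]
      exact hE.stat u hu1 f
  · intro u hu q hq huq β hβ hsum
    rw [extE_apply]
    rcases Finset.mem_insert.1 hu with rfl | hu1
    · have hq : q ∈ S := (Finset.mem_insert.1 hq).resolve_left (fun h => huq h.symm)
      simp only [Function.update_self, Function.update_of_ne (hne q hq)]
      rw [← hE.const (b / d)]
      apply hE.mono
      intro φ
      exact nbAvg_le_div H _ (fun z => β z (φ q)) b d hd0 (hd _) (fun z => hβ _ _) (hsum _)
    · rcases Finset.mem_insert.1 hq with rfl | hq1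
      · simp only [Function.update_self, Function.update_of_ne (hne u hu1)]
        by_cases hup : u = p
        · subst hup
          have h1 := hE.stat u hu1 (fun x => nbAvg H x (fun z => β x z))
          rw [sum_deg_nbAvg H hposd β] at h1
          have h2 : ∑ z, ∑ x ∈ H.neighborFinset z, β x z ≤ ∑ z : V, b :=
            Finset.sum_le_sum fun z _ => (Finset.sum_le_sum_of_subset_of_nonneg
              (Finset.subset_univ _) (fun i _ _ => hβ _ _)).trans (hsum z)
          have h3 : ∑ z : V, d ≤ ∑ x, (H.degree x : ℝ) := Finset.sum_le_sum fun z _ => hd z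
          rw [Finset.sum_const, nsmul_eq_mul] at h2 h3
          rw [le_div_iff₀ hd0]
          refine le_of_mul_le_mul_right ?_ hpos
          calc _ = (E (fun φ => nbAvg H (φ u) (fun z => β (φ u) z)) * ∑ x, (H.degree x : ℝ)) * d := by ring
            _ ≤ ((Finset.univ : Finset V).card * b) * d := by
                rw [h1]; exact mul_le_mul_of_nonneg_right h2 hd0.le
            _ = b * ((Finset.univ : Finset V).card * d) := by ring
            _ ≤ _ := mul_le_mul_of_nonneg_left h3 hb
        · refine hE.two u hu1 p hp hup (fun x y => nbAvg H y (fun z => β x z)) ?_ ?_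
          · intro x y
            exact nbAvg_nonneg _ _ _ fun z => hβ _ _
          · intro y
            rw [← nbAvg_sum H y Finset.univ (fun x z => β x z), ← nbAvg_const H y b (hposd y)]
            exact nbAvg_mono _ _ _ _ fun z _ => hsum z
      · simp only [Function.update_of_ne (hne u hu1), Function.update_of_ne (hne q hq1),
          nbAvg_const H _ _ (hposd _)]
        exact hE.two u hu1 q hq1 huq β hβ hsum
  · rw [extE_apply]
    have key : ∀ φ : W → V, nbAvg H (φ p) (fun z => badInd T H (insert w S) (Function.update φ w z))
        ≤ badInd T H S φ + ∑ u ∈ S.erase p, ((1 / d + δ) +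
          (if δ * H.degree (φ p) ≤
            ((H.neighborFinset (φ u) ∩ H.neighborFinset (φ p)).card : ℝ) then (1:ℝ) else 0)) := by
      intro φ
      have h1 : ∀ z, H.Adj (φ p) z → badInd T H (insert w S) (Function.update φ w z) ≤
          badInd T H S φ + ∑ u ∈ S.erase p, ((if z = φ u then (1:ℝ) else 0) +
            (if H.Adj (φ u) z then (1:ℝ) else 0)) := by
        intro z hz
        have hnn : ∀ u ∈ S.erase p, 0 ≤ ((if z = φ u then (1:ℝ) else 0) +
            (if H.Adj (φ u) z then (1:ℝ) else 0)) := fun u _ => by positivity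
        by_cases hg : GoodOn T H S φ
        · by_cases hex : ∃ u ∈ S.erase p, z = φ u ∨ H.Adj (φ u) z
          · obtain ⟨u, hu, h⟩ := hex
            have h2 := Finset.single_le_sum hnn hu
            have h3 : (1:ℝ) ≤ ((if z = φ u then (1:ℝ) else 0) +
              (if H.Adj (φ u) z then (1:ℝ) else 0)) := by
              rcases h with h | h
              · rw [if_pos h]; split_ifs <;> norm_num
              · rw [if_pos h]; split_ifs <;> norm_num
            have h4 : badInd T H (insert w S) (Function.update φ w z) ≤ 1 := by
              unfold badInd; split_ifs <;> norm_num
            have h5 : badInd T H S φ = 0 := by simp [badInd, hg]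
            linarith
          · push Not at hex
            have : GoodOn T H (insert w S) (Function.update φ w z) := by
              have hwu : ∀ u ∈ S, z ≠ φ u ∧ (T.Adj u w ↔ H.Adj (φ u) z) := by
                intro u hu
                by_cases hup : u = p
                · subst hup
                  exact ⟨hz.ne', by simp [hpw, hz]⟩
                · have := hex u (Finset.mem_erase.2 ⟨hup, hu⟩)
                  exact ⟨this.1, iff_of_false (fun h => hup (huniq u hu h)) this.2⟩
              intro u hu v hv huv
              rcases Finset.mem_insert.1 hu with rfl | hu1
              · have hv : v ∈ S := (Finset.mem_insert.1 hv).resolve_left (fun h => huv h.symm)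
                simp only [Function.update_self, Function.update_of_ne (hne v hv)]
                exact ⟨(hwu v hv).1, by rw [T.adj_comm, H.adj_comm]; exact (hwu v hv).2⟩
              · rcases Finset.mem_insert.1 hv with rfl | hv1
                · simp only [Function.update_self, Function.update_of_ne (hne u hu1)]
                  exact ⟨(hwu u hu1).1.symm, (hwu u hu1).2⟩
                · simp only [Function.update_of_ne (hne u hu1), Function.update_of_ne (hne v hv1)]
                  exact hg u hu1 v hv1 huv
            have h5 : badInd T H S φ = 0 := by simp [badInd, hg]
            have h6 : badInd T H (insert w S) (Function.update φ w z) = 0 := by simp [badInd, this]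
            rw [h5, h6]
            have := Finset.sum_nonneg hnn
            linarith
        · have h5 : badInd T H S φ = 1 := by simp [badInd, hg]
          have h4 : badInd T H (insert w S) (Function.update φ w z) ≤ 1 := by
            unfold badInd; split_ifs <;> norm_num
          have := Finset.sum_nonneg hnn
          linarith
      refine (nbAvg_mono _ _ _ _ h1).trans ?_
      rw [nbAvg_add, nbAvg_const H _ _ (hposd _), nbAvg_sum]
      gcongr with u hu
      rw [nbAvg_add]
      have e1 : nbAvg H (φ p) (fun z => if z = φ u then (1:ℝ) else 0) ≤ 1 / d :=
        nbAvg_le_div H _ _ 1 d hd0 (hd _) (fun z => by positivity) (by simp)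
      have hdp : (0:ℝ) < H.degree (φ p) := by exact_mod_cast hposd _
      have e2 : nbAvg H (φ p) (fun z => if H.Adj (φ u) z then (1:ℝ) else 0) =
          ((H.neighborFinset (φ u) ∩ H.neighborFinset (φ p)).card : ℝ) / H.degree (φ p) := by
        unfold nbAvg
        congr 1
        rw [Finset.sum_boole]
        congr 2
        ext z
        simp [and_comm]
      have e3 : ((H.neighborFinset (φ u) ∩ H.neighborFinset (φ p)).card : ℝ) ≤ H.degree (φ p) := by
        rw [← SimpleGraph.card_neighborFinset_eq_degree]
        exact_mod_cast Finset.card_le_card Finset.inter_subset_right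
      have e4 : ((H.neighborFinset (φ u) ∩ H.neighborFinset (φ p)).card : ℝ) / H.degree (φ p) ≤
          δ + (if δ * H.degree (φ p) ≤
            ((H.neighborFinset (φ u) ∩ H.neighborFinset (φ p)).card : ℝ) then (1:ℝ) else 0) := by
        rw [div_le_iff₀ hdp]
        split_ifs with h
        · nlinarith
        · nlinarith
      rw [e2]
      linarith
    refine (hE.mono key).trans ?_
    have split : E (fun φ => badInd T H S φ + ∑ u ∈ S.erase p, ((1 / d + δ) +
          (if δ * H.degree (φ p) ≤
            ((H.neighborFinset (φ u) ∩ H.neighborFinset (φ p)).card : ℝ) then (1:ℝ) else 0)))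
        = E (badInd T H S) + ∑ u ∈ S.erase p, (E (fun _ => 1 / d + δ) +
          E (fun φ => if δ * H.degree (φ p) ≤
            ((H.neighborFinset (φ u) ∩ H.neighborFinset (φ p)).card : ℝ) then (1:ℝ) else 0)) := by
      simp only [← map_add, ← map_sum]
      congr 1
      ext φ
      simp
    rw [split, hE.const]
    have hterm : ∑ u ∈ S.erase p, ((1 / d + δ) +
          E (fun φ => if δ * H.degree (φ p) ≤
            ((H.neighborFinset (φ u) ∩ H.neighborFinset (φ p)).card : ℝ) then (1:ℝ) else 0))
        ≤ ∑ u ∈ S.erase p, (1 / d + δ + b / d) := by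
      apply Finset.sum_le_sum
      intro u hu
      have hu' := Finset.mem_erase.1 hu
      have := hE.two u hu'.2 p hp hu'.1 (fun x y => if δ * H.degree y ≤
            ((H.neighborFinset x ∩ H.neighborFinset y).card : ℝ) then (1:ℝ) else 0)
            (fun x y => by positivity) (fun y => by
              rw [Finset.sum_boole]; exact hB y)
      linarith
    rw [Finset.sum_const, nsmul_eq_mul] at hterm
    have hc : ((S.erase p).card : ℝ) ≤ S.card := by exact_mod_cast Finset.card_erase_le
    have h3 := hE.three
    rw [Finset.card_insert_of_notMem hw]
    push_cast
    have hε : 0 ≤ 1 / d + δ + b / d := by positivity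
    have h0 : (0:ℝ) ≤ S.card := by positivity
    nlinarith [mul_le_mul_of_nonneg_right hc hε, mul_nonneg h0 hε]

/-! ### Combinatorial lemmas -/

open scoped Classical in
theorem common_nb_lt {V : Type} (H : SimpleGraph V) (s N : ℕ)
    (hN : ∀ A : Finset V, N ≤ A.card → ∃ I ⊆ A, IsStableSet H I ∧ I.card = s)
    (hK : ∀ I J : Finset V, IsStableSet H I → IsStableSet H J → I.card = s → J.card = s →
      ¬ ∀ x ∈ I, ∀ y ∈ J, H.Adj x y)
    (S Q : Finset V) (hS : IsStableSet H S) (hQ : Q ⊆ S) (hs : s ≤ Q.card)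
    (P : Finset V) (hP : ∀ v ∈ P, ∀ x ∈ Q, H.Adj v x) : P.card < N := by
  by_contra hcon
  push Not at hcon
  obtain ⟨I, hIP, hI, hIs⟩ := hN P hcon
  obtain ⟨J, hJQ, hJs⟩ := Finset.exists_subset_card_eq hs
  exact hK I J hI (fun u hu v hv => hS u (hQ (hJQ hu)) v (hQ (hJQ hv))) hIs hJs
    fun x hx y hy => hP x (hIP hx) y (hJQ hy)

open scoped Classical in
theorem exists_stable {V : Type} (H : SimpleGraph V) (s N : ℕ)
    (hN : ∀ A : Finset V, N ≤ A.card → ∃ I ⊆ A, IsStableSet H I ∧ I.card = s)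
    (hK : ∀ I J : Finset V, IsStableSet H I → IsStableSet H J → I.card = s → J.card = s →
      ¬ ∀ x ∈ I, ∀ y ∈ J, H.Adj x y) (t : ℕ) (A : Finset V) (hA : t + 2 ^ t * N ≤ A.card) :
    ∃ I ⊆ A, IsStableSet H I ∧ I.card = t := by
  obtain ⟨S, hS, hmax⟩ := Finset.exists_max_image (A.powerset.filter (IsStableSet H)) Finset.card
    ⟨∅, by simp [IsStableSet]⟩
  rw [Finset.mem_filter, Finset.mem_powerset] at hS
  by_cases ht : t ≤ S.card
  · obtain ⟨J, hJS, hJs⟩ := Finset.exists_subset_card_eq ht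
    exact ⟨J, hJS.trans hS.1, fun u hu v hv => hS.2 u (hJS hu) v (hJS hv), hJs⟩
  exfalso
  push Not at ht
  have h1 : (A \ S).card ≤ N * ((A \ S).image fun v => S.filter (H.Adj v)).card := by
    apply Finset.card_le_mul_card_image
    intro Q hQ
    have hQS : Q ⊆ S := by
      obtain ⟨v, _, rfl⟩ := Finset.mem_image.1 hQ
      exact Finset.filter_subset _ _
    have hP : ∀ v ∈ (A \ S).filter (fun v => S.filter (H.Adj v) = Q), ∀ x ∈ Q, H.Adj v x := by
      intro v hv x hx
      rw [← (Finset.mem_filter.1 hv).2] at hx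
      exact (Finset.mem_filter.1 hx).2
    by_cases hs : s ≤ Q.card
    · exact (common_nb_lt H s N hN hK S Q hS.2 hQS hs _ hP).le
    · push Not at hs
      by_contra hcon
      push Not at hcon
      obtain ⟨I, hIP, hI, hIs⟩ := hN _ hcon.le
      have hI2 : ∀ v ∈ I, v ∈ A ∧ v ∉ S ∧ ∀ x ∈ S, x ∉ Q → ¬ H.Adj v x := by
        intro v hv
        have := Finset.mem_filter.1 (hIP hv)
        refine ⟨(Finset.mem_sdiff.1 this.1).1, (Finset.mem_sdiff.1 this.1).2, fun x hx hxQ hadj => hxQ ?_⟩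
        rw [← this.2]
        exact Finset.mem_filter.2 ⟨hx, hadj⟩
      have hdisj : Disjoint (S \ Q) I := by
        rw [Finset.disjoint_left]
        intro x hx hxI
        exact (hI2 x hxI).2.1 (Finset.mem_sdiff.1 hx).1
      have := hmax ((S \ Q) ∪ I) (by
        rw [Finset.mem_filter, Finset.mem_powerset]
        constructor
        · apply Finset.union_subset (Finset.sdiff_subset.trans hS.1)
          exact fun v hv => (hI2 v hv).1
        · intro u hu v hv
          rcases Finset.mem_union.1 hu with hu | hu <;> rcases Finset.mem_union.1 hv with hv | hv
          · exact hS.2 u (Finset.mem_sdiff.1 hu).1 v (Finset.mem_sdiff.1 hv).1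
          · rw [H.adj_comm]
            exact (hI2 v hv).2.2 u (Finset.mem_sdiff.1 hu).1 (Finset.mem_sdiff.1 hu).2
          · exact (hI2 u hu).2.2 v (Finset.mem_sdiff.1 hv).1 (Finset.mem_sdiff.1 hv).2
          · exact hI u hu v hv)
      rw [Finset.card_union_of_disjoint hdisj, Finset.card_sdiff_of_subset hQS] at this
      have := Finset.card_le_card hQS
      omega
  have h2 : ((A \ S).image fun v => S.filter (H.Adj v)).card ≤ 2 ^ S.card := by
    rw [← Finset.card_powerset]
    apply Finset.card_le_card
    intro Q hQ
    obtain ⟨v, _, rfl⟩ := Finset.mem_image.1 hQ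
    exact Finset.mem_powerset.2 (Finset.filter_subset _ _)
  have h3 : 2 ^ S.card ≤ 2 ^ t := Nat.pow_le_pow_right (by norm_num) ht.le
  rw [Finset.card_sdiff_of_subset hS.1] at h1
  have h4 := Nat.mul_le_mul_left N (h2.trans h3)
  have h5 := Finset.card_le_card hS.1
  rw [mul_comm (2 ^ t) N] at hA
  omega

open scoped Classical in
theorem sum_nb_le {V : Type} (H : SimpleGraph V) (s N : ℕ)
    (hN : ∀ A : Finset V, N ≤ A.card → ∃ I ⊆ A, IsStableSet H I ∧ I.card = s)
    (hK : ∀ I J : Finset V, IsStableSet H I → IsStableSet H J → I.card = s → J.card = s →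
      ¬ ∀ x ∈ I, ∀ y ∈ J, H.Adj x y) (t : ℕ) (ht : 0 < t) (B : Finset V) :
    ∀ (n : ℕ) (A : Finset V), A.card = n →
    ∑ v ∈ B, ((A.filter (H.Adj v)).card : ℝ) ≤ B.card * ((t + 2 ^ t * N : ℕ) : ℝ)
      + (B.card * s / t + 2 ^ t * N) * A.card := by
  intro n
  induction n using Nat.strong_induction_on with
  | _ n ih =>
  intro A hAn
  by_cases hA : t + 2 ^ t * N ≤ A.card
  · obtain ⟨S, hSA, hS, hSt⟩ := exists_stable H s N hN hK t A hA
    have hcard : (A \ S).card = A.card - t := by rw [Finset.card_sdiff_of_subset hSA, hSt]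
    have hle : t ≤ A.card := by omega
    have h1 := ih (A \ S).card (by omega) (A \ S) rfl
    have h2 : ∀ v, ((A.filter (H.Adj v)).card : ℝ) = ((A \ S).filter (H.Adj v)).card
        + (S.filter (H.Adj v)).card := by
      intro v
      have : A.filter (H.Adj v) = (A \ S).filter (H.Adj v) ∪ S.filter (H.Adj v) := by
        rw [← Finset.filter_union, Finset.sdiff_union_of_subset hSA]
      rw [this, Finset.card_union_of_disjoint]
      · push_cast; ring
      · exact Finset.disjoint_filter_filter Finset.sdiff_disjoint
    have hmany : (B.filter (fun v => s ≤ (S.filter (H.Adj v)).card)).card ≤ 2 ^ t * N := by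
      have h1 : (B.filter (fun v => s ≤ (S.filter (H.Adj v)).card)).card ≤
          N * ((B.filter (fun v => s ≤ (S.filter (H.Adj v)).card)).image
            fun v => S.filter (H.Adj v)).card := by
        apply Finset.card_le_mul_card_image
        intro Q hQ
        obtain ⟨v, hv, rfl⟩ := Finset.mem_image.1 hQ
        refine (common_nb_lt H s N hN hK S _ hS (Finset.filter_subset _ _)
          (Finset.mem_filter.1 hv).2 _ ?_).le
        intro u hu x hx
        rw [← (Finset.mem_filter.1 hu).2] at hx
        exact (Finset.mem_filter.1 hx).2
      have h2 : ((B.filter (fun v => s ≤ (S.filter (H.Adj v)).card)).image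
            fun v => S.filter (H.Adj v)).card ≤ 2 ^ t := by
        rw [← hSt, ← Finset.card_powerset]
        apply Finset.card_le_card
        intro Q hQ
        obtain ⟨v, _, rfl⟩ := Finset.mem_image.1 hQ
        exact Finset.mem_powerset.2 (Finset.filter_subset _ _)
      calc _ ≤ _ := h1
        _ ≤ N * 2 ^ t := Nat.mul_le_mul_left _ h2
        _ = _ := mul_comm _ _
    have h3 : ∑ v ∈ B, ((S.filter (H.Adj v)).card : ℝ) ≤ B.card * s + t * (2 ^ t * N) := by
      calc ∑ v ∈ B, ((S.filter (H.Adj v)).card : ℝ)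
          ≤ ∑ v ∈ B, ((s:ℝ) + t * (if s ≤ (S.filter (H.Adj v)).card then 1 else 0)) := by
            apply Finset.sum_le_sum
            intro v _
            split_ifs with h
            · have : (S.filter (H.Adj v)).card ≤ t := hSt ▸ Finset.card_filter_le _ _
              have : ((S.filter (H.Adj v)).card : ℝ) ≤ t := by exact_mod_cast this
              have : (0:ℝ) ≤ s := by positivity
              linarith
            · push Not at h
              have : ((S.filter (H.Adj v)).card : ℝ) ≤ s := by exact_mod_cast h.le
              linarith
        _ = B.card * s + t * (B.filter (fun v => s ≤ (S.filter (H.Adj v)).card)).card := by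
            rw [Finset.sum_add_distrib, Finset.sum_const, nsmul_eq_mul, ← Finset.mul_sum,
              Finset.sum_boole]
        _ ≤ _ := by
            have : ((B.filter (fun v => s ≤ (S.filter (H.Adj v)).card)).card : ℝ) ≤ 2 ^ t * N := by
              exact_mod_cast hmany
            gcongr
    simp_rw [h2]
    rw [Finset.sum_add_distrib]
    have h4 : ((A \ S).card : ℝ) = A.card - t := by rw [hcard]; push_cast [hle]; ring
    rw [h4] at h1
    have ht' : (t:ℝ) ≠ 0 := by positivity
    have h5 : (B.card * s / t + 2 ^ t * N : ℝ) * t = B.card * s + t * (2 ^ t * N) := by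
      field_simp
    linarith
  · push Not at hA
    have h1 : ∑ v ∈ B, ((A.filter (H.Adj v)).card : ℝ) ≤ ∑ v ∈ B, ((t + 2 ^ t * N : ℕ) : ℝ) := by
      apply Finset.sum_le_sum
      intro v _
      exact_mod_cast (Finset.card_filter_le _ _).trans hA.le
    rw [Finset.sum_const, nsmul_eq_mul] at h1
    have : (0:ℝ) ≤ (B.card * s / t + 2 ^ t * N) * A.card := by positivity
    linarith

open scoped Classical in
theorem heavy_le {V : Type} (H : SimpleGraph V) (s N : ℕ)
    (hN : ∀ A : Finset V, N ≤ A.card → ∃ I ⊆ A, IsStableSet H I ∧ I.card = s)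
    (hK : ∀ I J : Finset V, IsStableSet H I → IsStableSet H J → I.card = s → J.card = s →
      ¬ ∀ x ∈ I, ∀ y ∈ J, H.Adj x y) (t : ℕ) (ht : 0 < t) (δ : ℝ) (hδ : 0 < δ)
    (hst : (s:ℝ) / t ≤ δ / 4) (A B : Finset V) (hA0 : 0 < A.card)
    (hA : ((t + 2 ^ t * N : ℕ) : ℝ) ≤ δ / 4 * A.card)
    (hB : ∀ v ∈ B, δ * A.card ≤ ((A.filter (H.Adj v)).card : ℝ)) :
    (B.card : ℝ) ≤ 2 ^ (t + 1) * N / δ := by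
  have h1 := sum_nb_le H s N hN hK t ht B _ A rfl
  have h2 : ∑ v ∈ B, (δ * A.card) ≤ ∑ v ∈ B, ((A.filter (H.Adj v)).card : ℝ) :=
    Finset.sum_le_sum hB
  rw [Finset.sum_const, nsmul_eq_mul] at h2
  have hA' : (0:ℝ) < A.card := by exact_mod_cast hA0
  have hb : (0:ℝ) ≤ B.card := by positivity
  have h3 := mul_le_mul_of_nonneg_left hA hb
  have h4 : (B.card * s / t + 2 ^ t * N : ℝ) * A.card ≤ (B.card * (δ / 4) + 2 ^ t * N) * A.card := by
    rw [mul_div_assoc]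
    gcongr
  rw [le_div_iff₀ hδ, pow_succ]
  have h5 : (B.card * δ / 2) * A.card ≤ (2 ^ t * N : ℝ) * A.card := by nlinarith
  have := le_of_mul_le_mul_right h5 hA'
  linarith

open scoped Classical in
theorem degen_color {V : Type} (G : SimpleGraph V) (D : ℕ)
    (h : ∀ U : Finset V, U.Nonempty → ∃ v ∈ U, (U.filter (G.Adj v)).card < D) :
    ∀ (n : ℕ) (S : Finset V), S.card = n →
      ∃ c : V → ℕ, (∀ v ∈ S, c v < D) ∧ ∀ u ∈ S, ∀ v ∈ S, G.Adj u v → c u ≠ c v := by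
  intro n
  induction n with
  | zero =>
    intro S hS
    rw [Finset.card_eq_zero] at hS
    subst hS
    exact ⟨fun _ => 0, by simp, by simp⟩
  | succ n ih =>
    intro S hS
    obtain ⟨v, hv, hd⟩ := h S (Finset.card_pos.1 (by omega))
    obtain ⟨c, hc1, hc2⟩ := ih (S.erase v) (by rw [Finset.card_erase_of_mem hv]; omega)
    obtain ⟨k, hk, hk'⟩ : ∃ k ∈ Finset.range D, k ∉ (S.filter (G.Adj v)).image c := by
      apply Finset.exists_mem_notMem_of_card_lt_card
      rw [Finset.card_range]
      exact Finset.card_image_le.trans_lt hd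
    have hk2 : ∀ u ∈ S, G.Adj v u → c u ≠ k := fun u hu ha he =>
      hk' (Finset.mem_image.2 ⟨u, Finset.mem_filter.2 ⟨hu, ha⟩, he⟩)
    refine ⟨Function.update c v k, ?_, ?_⟩
    · intro u hu
      by_cases huv : u = v
      · subst huv; simpa using hk
      · rw [Function.update_of_ne huv]
        exact hc1 u (Finset.mem_erase.2 ⟨huv, hu⟩)
    · intro u hu w hw ha
      by_cases huv : u = v
      · subst huv
        rw [Function.update_self, Function.update_of_ne ha.ne']
        exact (hk2 w hw ha).symm
      · by_cases hwv : w = v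
        · subst hwv
          rw [Function.update_self, Function.update_of_ne ha.ne]
          exact hk2 u hu ha.symm
        · rw [Function.update_of_ne huv, Function.update_of_ne hwv]
          exact hc2 u (Finset.mem_erase.2 ⟨huv, hu⟩) w (Finset.mem_erase.2 ⟨hwv, hw⟩) ha

theorem chromNum_le_of_degen {V : Type} [Fintype V] (G : SimpleGraph V) (D : ℕ)
    (h : ∀ S : Finset V, ∃ c : V → ℕ, (∀ v ∈ S, c v < D) ∧
      ∀ u ∈ S, ∀ v ∈ S, G.Adj u v → c u ≠ c v) : chromNum G ≤ D := by
  obtain ⟨c, h1, h2⟩ := h Finset.univ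
  have : G.Colorable D := ⟨SimpleGraph.Coloring.mk (fun v => (⟨c v, h1 v (Finset.mem_univ _)⟩ : Fin D))
    (fun {u v} ha he => h2 u (Finset.mem_univ _) v (Finset.mem_univ _) ha (by simpa using he))⟩
  have h3 := this.chromaticNumber_le
  unfold chromNum
  exact ENat.toNat_le_of_le_natCast h3

/-! ### Ramsey -/

open scoped Classical in
theorem ramsey_exists : ∀ (k s w : ℕ), s + w = k → ∃ n : ℕ, ∀ (V : Type) (G : SimpleGraph V)
    (A : Finset V), n ≤ A.card → (∃ I ⊆ A, IsStableSet G I ∧ I.card = s) ∨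
      ∃ Q ⊆ A, G.IsNClique w Q := by
  intro k
  induction k with
  | zero =>
    intro s w h
    obtain rfl : s = 0 := by omega
    exact ⟨0, fun V G A _ => Or.inl ⟨∅, by simp, by simp [IsStableSet], rfl⟩⟩
  | succ k ih =>
    intro s w h
    rcases s with _ | s
    · exact ⟨0, fun V G A _ => Or.inl ⟨∅, by simp, by simp [IsStableSet], rfl⟩⟩
    rcases w with _ | w
    · exact ⟨0, fun V G A _ => Or.inr ⟨∅, by simp, by simp [SimpleGraph.isNClique_iff]⟩⟩
    obtain ⟨n1, h1⟩ := ih s (w + 1) (by omega)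
    obtain ⟨n2, h2⟩ := ih (s + 1) w (by omega)
    refine ⟨n1 + n2 + 1, fun V G A hA => ?_⟩
    obtain ⟨v, hv⟩ : A.Nonempty := Finset.card_pos.1 (by omega)
    have hc := Finset.card_filter_add_card_filter_not (s := A.erase v) (G.Adj v)
    rw [Finset.card_erase_of_mem hv] at hc
    by_cases hn : n2 ≤ ((A.erase v).filter (G.Adj v)).card
    · rcases h2 V G _ hn with ⟨I, hI, h⟩ | ⟨Q, hQ, h⟩
      · exact Or.inl ⟨I, hI.trans ((Finset.filter_subset _ _).trans (Finset.erase_subset _ _)), h⟩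
      · refine Or.inr ⟨insert v Q, ?_, h.insert fun b hb => (Finset.mem_filter.1 (hQ hb)).2⟩
        exact Finset.insert_subset hv
          (hQ.trans ((Finset.filter_subset _ _).trans (Finset.erase_subset _ _)))
    · rcases h1 V G ((A.erase v).filter (fun x => ¬ G.Adj v x)) (by omega) with
        ⟨I, hI, h, hs⟩ | ⟨Q, hQ, h⟩
      · have hvI : ∀ x ∈ I, x ≠ v ∧ ¬ G.Adj v x := fun x hx =>
          ⟨(Finset.mem_erase.1 (Finset.mem_filter.1 (hI hx)).1).1, (Finset.mem_filter.1 (hI hx)).2⟩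
        refine Or.inl ⟨insert v I, Finset.insert_subset hv
          (hI.trans ((Finset.filter_subset _ _).trans (Finset.erase_subset _ _))), ?_, ?_⟩
        · intro x hx y hy
          rcases Finset.mem_insert.1 hx with rfl | hx1
          · rcases Finset.mem_insert.1 hy with rfl | hy1
            · exact G.irrefl
            · exact (hvI y hy1).2
          · rcases Finset.mem_insert.1 hy with rfl | hy1
            · rw [G.adj_comm]; exact (hvI x hx1).2
            · exact h x hx1 y hy1
        · rw [Finset.card_insert_of_notMem (fun hh => (hvI v hh).1 rfl), hs]
      · exact Or.inr ⟨Q, hQ.trans ((Finset.filter_subset _ _).trans (Finset.erase_subset _ _)), h⟩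

theorem ramsey_mem (s w : ℕ) : 1 ≤ ramsey s w ∧ ∀ G : SimpleGraph (Fin (ramsey s w)),
    (∃ S : Finset (Fin (ramsey s w)), IsStableSet G S ∧ S.card = s) ∨
    (∃ S : Finset (Fin (ramsey s w)), G.IsNClique w S) := by
  have : {n : ℕ | 1 ≤ n ∧ ∀ G : SimpleGraph (Fin n),
    (∃ S : Finset (Fin n), IsStableSet G S ∧ S.card = s) ∨
    (∃ S : Finset (Fin n), G.IsNClique w S)}.Nonempty := by
    obtain ⟨n, hn⟩ := ramsey_exists (s + w) s w rfl
    refine ⟨n + 1, by omega, fun G => ?_⟩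
    rcases hn _ G Finset.univ (by simp) with ⟨I, _, h⟩ | ⟨Q, _, h⟩
    · exact Or.inl ⟨I, h⟩
    · exact Or.inr ⟨Q, h⟩
  exact Nat.sInf_mem this

theorem ramsey_spec (s w : ℕ) {V : Type} (G : SimpleGraph V) (A : Finset V)
    (hA : ramsey s w ≤ A.card) : (∃ I ⊆ A, IsStableSet G I ∧ I.card = s) ∨
      ∃ Q : Finset V, G.IsNClique w Q := by
  obtain ⟨A', hA', hc⟩ := Finset.exists_subset_card_eq hA
  let e : Fin (ramsey s w) ↪ V :=
    ((finCongr hc.symm).trans A'.equivFin.symm).toEmbedding.trans (Function.Embedding.subtype _)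
  have he : ∀ i, e i ∈ A := fun i => hA' ((A'.equivFin.symm (finCongr hc.symm i)).2)
  rcases (ramsey_mem s w).2 (G.comap e) with ⟨I, hI, hs⟩ | ⟨Q, hQ⟩
  · refine Or.inl ⟨I.map e, ?_, ?_, by simpa using hs⟩
    · intro x hx
      obtain ⟨i, _, rfl⟩ := Finset.mem_map.1 hx
      exact he i
    · intro x hx y hy
      obtain ⟨i, hi, rfl⟩ := Finset.mem_map.1 hx
      obtain ⟨j, hj, rfl⟩ := Finset.mem_map.1 hy
      exact hI i hi j hj
  · refine Or.inr ⟨Q.map e, ?_⟩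
    rw [SimpleGraph.isNClique_iff] at hQ ⊢
    refine ⟨?_, by simpa using hQ.2⟩
    intro x hx y hy hxy
    obtain ⟨i, hi, rfl⟩ := Finset.mem_map.1 hx
    obtain ⟨j, hj, rfl⟩ := Finset.mem_map.1 hy
    exact hQ.1 hi hj (fun h => hxy (by rw [h]))

theorem biclique_of_indFree (s : ℕ) {V : Type} (G : SimpleGraph V)
    (h : IndFree (completeBipartiteGraph (Fin s) (Fin s)) G)
    (I J : Finset V) (hI : IsStableSet G I) (hJ : IsStableSet G J) (hIs : I.card = s)
    (hJs : J.card = s) : ¬ ∀ x ∈ I, ∀ y ∈ J, G.Adj x y := by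
  intro hall
  apply h
  let a : Fin s → V := fun i => I.equivFin.symm (finCongr hIs.symm i)
  let b : Fin s → V := fun i => J.equivFin.symm (finCongr hJs.symm i)
  have ha : ∀ i, a i ∈ I := fun i => (I.equivFin.symm (finCongr hIs.symm i)).2
  have hb : ∀ i, b i ∈ J := fun i => (J.equivFin.symm (finCongr hJs.symm i)).2
  have hai : Function.Injective a := fun i j hij => by simpa [a, Subtype.ext_iff] using hij
  have hbi : Function.Injective b := fun i j hij => by simpa [b, Subtype.ext_iff] using hij
  refine ⟨⟨⟨Sum.elim a b, ?_⟩, ?_⟩⟩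
  · exact hai.sumElim hbi fun i j => (hall _ (ha i) _ (hb j)).ne
  · rintro (i | i) (j | j)
    · simpa using hI _ (ha i) _ (ha j)
    · simpa using hall _ (ha i) _ (hb j)
    · simpa using (hall _ (ha j) _ (hb i)).symm
    · simpa using hJ _ (hb i) _ (hb j)

/-! ### Assembling -/

theorem tree_unique_nb {W : Type} (T : SimpleGraph W) (hT : T.IsAcyclic) (S : Finset W) (w : W)
    (hw : w ∉ S) (p q : W) (P : T.Walk p q) (hP : ∀ x ∈ P.support, x ∈ S) (hp : T.Adj p w)
    (hq : T.Adj q w) : q = p := by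
  classical
  by_contra hne
  have h1 : (P.bypass).IsPath := P.bypass_isPath
  have h2 : (SimpleGraph.Walk.cons hp (SimpleGraph.Walk.cons hq.symm SimpleGraph.Walk.nil)).IsPath := by
    simp [SimpleGraph.Walk.cons_isPath_iff, hp.ne, hq.ne', Ne.symm hne]
  have h3 := (hT.subsingleton_path p q).elim ⟨_, h1⟩ ⟨_, h2⟩
  have h4 := congrArg Subtype.val h3
  simp only at h4
  apply hw
  apply hP
  apply P.support_bypass_subset_support
  rw [h4]
  simp

open scoped Classical in
theorem tree_grow {W V : Type} [Fintype W] [Fintype V] [Nonempty V]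
    (T : SimpleGraph W) (hT : T.IsTree) (H : SimpleGraph V)
    (d b δ : ℝ) (hb : 0 ≤ b) (hδ : 0 ≤ δ) (hd0 : 0 < d) (hd : ∀ v, d ≤ H.degree v)
    (hB : ∀ y, ((Finset.univ.filter fun x =>
      δ * H.degree y ≤ ((H.neighborFinset x ∩ H.neighborFinset y).card : ℝ)).card : ℝ) ≤ b) :
    ∀ k, k + 1 ≤ Fintype.card W → ∃ S : Finset W, S.card = k + 1 ∧
      (∀ u ∈ S, ∀ v ∈ S, ∃ P : T.Walk u v, ∀ x ∈ P.support, x ∈ S) ∧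
      ∃ E, TreeExp T H d b (1 / d + δ + b / d) S E := by
  intro k
  induction k with
  | zero =>
    intro _
    obtain ⟨r⟩ := hT.connected.nonempty
    refine ⟨{r}, by simp, ?_, treeExp_base T H d b _ (by positivity) hd0 hd r⟩
    intro u hu v hv
    rw [Finset.mem_singleton] at hu hv
    subst hu; subst hv
    exact ⟨SimpleGraph.Walk.nil, by simp⟩
  | succ k ih =>
    intro hk
    obtain ⟨S, hS, hconn, E, hE⟩ := ih (by omega)
    obtain ⟨r, hr⟩ : S.Nonempty := Finset.card_pos.1 (by omega)
    obtain ⟨x, hx⟩ : ∃ x, x ∉ S := by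
      by_contra hcon
      push Not at hcon
      have : S = Finset.univ := Finset.eq_univ_iff_forall.2 hcon
      rw [this, Finset.card_univ] at hS
      omega
    obtain ⟨Q⟩ := hT.connected.preconnected r x
    obtain ⟨e, _, he1, he2⟩ := Q.exists_boundary_dart (S : Set W) hr hx
    have hw : e.snd ∉ S := by simpa using he2
    have hp : e.fst ∈ S := by simpa using he1
    refine ⟨insert e.snd S, by rw [Finset.card_insert_of_notMem hw, hS], ?_, extE H E e.fst e.snd, ?_⟩
    · have hto : ∀ u ∈ insert e.snd S, ∃ P : T.Walk u e.fst, ∀ x ∈ P.support, x ∈ insert e.snd S := by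
        intro u hu
        rcases Finset.mem_insert.1 hu with rfl | hu1
        · refine ⟨SimpleGraph.Walk.cons e.adj.symm SimpleGraph.Walk.nil, ?_⟩
          simp [hp]
        · obtain ⟨P, hP⟩ := hconn u hu1 _ hp
          exact ⟨P, fun x hx => Finset.mem_insert_of_mem (hP x hx)⟩
      intro u hu v hv
      obtain ⟨P, hP⟩ := hto u hu
      obtain ⟨P', hP'⟩ := hto v hv
      refine ⟨P.append P'.reverse, fun x hx => ?_⟩
      rw [SimpleGraph.Walk.mem_support_append_iff, SimpleGraph.Walk.support_reverse, List.mem_reverse] at hx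
      exact hx.elim (hP x) (hP' x)
    · refine treeExp_step T H d b δ hb hδ hd0 hd hB S E hE e.fst e.snd hp hw e.adj ?_
      intro u hu hadj
      obtain ⟨P, hP⟩ := hconn _ hp u hu
      exact tree_unique_nb T hT.isAcyclic S e.snd hw e.fst u P hP e.adj hadj

open scoped Classical in
theorem exists_tree {W V : Type} [Fintype W] [Fintype V] [Nonempty V]
    (T : SimpleGraph W) (hT : T.IsTree) (H : SimpleGraph V)
    (d b δ : ℝ) (hb : 0 ≤ b) (hδ : 0 ≤ δ) (hd0 : 0 < d) (hd : ∀ v, d ≤ H.degree v)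
    (hB : ∀ y, ((Finset.univ.filter fun x =>
      δ * H.degree y ≤ ((H.neighborFinset x ∩ H.neighborFinset y).card : ℝ)).card : ℝ) ≤ b)
    (hsmall : (Fintype.card W : ℝ) ^ 2 * (1 / d + δ + b / d) < 1) : Nonempty (T ↪g H) := by
  have hW : 0 < Fintype.card W := Fintype.card_pos_iff.2 hT.connected.nonempty
  obtain ⟨S, hS, -, E, hE⟩ := tree_grow T hT H d b δ hb hδ hd0 hd hB (Fintype.card W - 1) (by omega)
  have hSu : S = Finset.univ := by
    rw [← Finset.card_eq_iff_eq_univ]; omega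
  subst hSu
  have h3 := hE.three
  rw [Finset.card_univ] at h3
  by_cases hex : ∃ φ, GoodOn T H Finset.univ φ
  · obtain ⟨φ, hφ⟩ := hex
    have hφ' : ∀ u v, u ≠ v → φ u ≠ φ v ∧ (T.Adj u v ↔ H.Adj (φ u) (φ v)) :=
      fun u v h => hφ u (Finset.mem_univ _) v (Finset.mem_univ _) h
    refine ⟨⟨⟨φ, fun u v huv => ?_⟩, ?_⟩⟩
    · by_contra h
      exact (hφ' u v h).1 huv
    · intro u v
      by_cases h : u = v
      · subst h; simp
      · exact (hφ' u v h).2.symm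
  · push Not at hex
    have : badInd T H Finset.univ = fun _ => 1 := by
      ext φ; simp [badInd, hex φ]
    rw [this, hE.one] at h3
    linarith

open scoped Classical in
theorem tree_of_minDegree {W V : Type} [Fintype W] [Fintype V] [Nonempty V]
    (T : SimpleGraph W) (hT : T.IsTree) (H : SimpleGraph V) (s N n t : ℕ) (hs : 1 ≤ s)
    (hN1 : 1 ≤ N) (hn : n = Fintype.card W) (ht : t = 16 * n ^ 2 * s)
    (hN : ∀ A : Finset V, N ≤ A.card → ∃ I ⊆ A, IsStableSet H I ∧ I.card = s)
    (hK : ∀ I J : Finset V, IsStableSet H I → IsStableSet H J → I.card = s → J.card = s →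
      ¬ ∀ x ∈ I, ∀ y ∈ J, H.Adj x y)
    (hd : ∀ v, (16 * n ^ 2 * (t + 2 ^ t) + 16 * n ^ 4 * 2 ^ (t + 1)) * N ≤ H.degree v) :
    Nonempty (T ↪g H) := by
  have hn0 : 1 ≤ n := by rw [hn]; exact Fintype.card_pos_iff.2 hT.connected.nonempty
  have ht0 : 1 ≤ t := by rw [ht]; exact Nat.mul_pos (by positivity) hs
  have hnR : (1:ℝ) ≤ n := by exact_mod_cast hn0
  have hsR : (1:ℝ) ≤ s := by exact_mod_cast hs
  have hNR : (1:ℝ) ≤ N := by exact_mod_cast hN1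
  have htR : (t:ℝ) = 16 * n ^ 2 * s := by rw [ht]; push_cast; ring
  have htR1 : (1:ℝ) ≤ t := by exact_mod_cast ht0
  have hn2 : (1:ℝ) ≤ (n:ℝ) ^ 2 := one_le_pow₀ hnR
  set X : ℝ := 2 ^ t with hX
  have hX1 : 1 ≤ X := one_le_pow₀ (by norm_num)
  set d : ℝ := (16 * n ^ 2 * (t + X) + 16 * n ^ 4 * (2 * X)) * N with hddef
  have hd' : ∀ v, d ≤ H.degree v := by
    intro v
    have h : (((16 * n ^ 2 * (t + 2 ^ t) + 16 * n ^ 4 * 2 ^ (t + 1)) * N : ℕ) : ℝ) ≤ H.degree v := by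
      exact_mod_cast hd v
    refine le_trans (le_of_eq ?_) h
    rw [hddef, hX]; push_cast; ring
  have hp1 : 16 * (n:ℝ) ^ 2 * (t + X) * N ≤ d := by
    rw [hddef]
    have : (0:ℝ) ≤ 16 * (n:ℝ) ^ 4 * (2 * X) * N := by positivity
    linarith
  have hp2 : 16 * (n:ℝ) ^ 4 * (2 * X) * N ≤ d := by
    rw [hddef]
    have : (0:ℝ) ≤ 16 * (n:ℝ) ^ 2 * (t + X) * N := by positivity
    linarith
  have hd0 : 0 < d := lt_of_lt_of_le (by positivity) hp1
  have hn4 : 4 * (n:ℝ) ^ 2 ≤ d := by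
    refine le_trans ?_ hp1
    have h1 : (1:ℝ) ≤ (t + X) * N := by nlinarith
    nlinarith
  refine exists_tree T hT H d (2 ^ (t + 1) * N / (1 / (4 * n ^ 2))) (1 / (4 * n ^ 2)) (by positivity)
    (by positivity) hd0 hd' ?_ ?_
  · intro y
    have hdy := hd' y
    refine heavy_le H s N hN hK t ht0 (1 / (4 * n ^ 2)) (by positivity) ?_ (H.neighborFinset y) _ ?_ ?_ ?_
    · rw [htR]
      apply le_of_eq
      field_simp
      norm_num
    · rw [SimpleGraph.card_neighborFinset_eq_degree]
      have : (0:ℝ) < H.degree y := by linarith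
      exact_mod_cast this
    · rw [SimpleGraph.card_neighborFinset_eq_degree]
      have h1 : 1 / (4 * (n:ℝ) ^ 2) / 4 * (16 * (n:ℝ) ^ 2 * (t + X) * N) = (t + X) * N := by
        field_simp
        try norm_num
      have h2 : 1 / (4 * (n:ℝ) ^ 2) / 4 * (16 * (n:ℝ) ^ 2 * (t + X) * N) ≤
          1 / (4 * (n:ℝ) ^ 2) / 4 * H.degree y :=
        mul_le_mul_of_nonneg_left (hp1.trans hdy) (by positivity)
      push_cast
      rw [← hX]
      nlinarith
    · intro v hv
      have := (Finset.mem_filter.1 hv).2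
      rw [SimpleGraph.card_neighborFinset_eq_degree]
      refine this.trans (le_of_eq ?_)
      congr 2
      ext z
      simp [and_comm]
  · rw [← hn, mul_add, mul_add]
    have e1 : (n:ℝ) ^ 2 * (1 / d) ≤ 1 / 4 := by
      rw [mul_one_div, div_le_iff₀ hd0]; linarith
    have e2 : (n:ℝ) ^ 2 * (1 / (4 * n ^ 2)) = 1 / 4 := by
      field_simp
    have e3 : (n:ℝ) ^ 2 * (2 ^ (t + 1) * N / (1 / (4 * n ^ 2)) / d) ≤ 1 / 4 := by
      rw [← mul_div_assoc, div_le_iff₀ hd0]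
      refine le_trans (le_of_eq ?_) (mul_le_mul_of_nonneg_left hp2 (by norm_num))
      rw [pow_succ (2:ℝ) t, ← hX]
      field_simp
      try norm_num
    linarith

open scoped Classical in
theorem main_bound {W : Type} [Fintype W] (T : SimpleGraph W) (hT : T.IsTree) (s n t : ℕ)
    (hs : 1 ≤ s) (hn : n = Fintype.card W) (ht : t = 16 * n ^ 2 * s)
    (V : Type) [Fintype V] (G : SimpleGraph V) (hTG : IndFree T G)
    (hKG : IndFree (completeBipartiteGraph (Fin s) (Fin s)) G) :
    chromNum G ≤ (16 * n ^ 2 * (t + 2 ^ t) + 16 * n ^ 4 * 2 ^ (t + 1)) *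
      ramsey s (G.cliqueNum + 1) := by
  apply chromNum_le_of_degen
  intro S
  refine degen_color G _ ?_ _ S rfl
  intro U hU
  by_contra hcon
  push Not at hcon
  apply hTG
  have : Nonempty (U : Set V) := hU.to_subtype
  suffices hf : Nonempty (T ↪g G.induce (U : Set V)) from
    hf.elim fun f => ⟨f.trans (SimpleGraph.Embedding.induce _)⟩
  refine tree_of_minDegree T hT (G.induce (U : Set V)) s (ramsey s (G.cliqueNum + 1)) n t hs
    (ramsey_mem _ _).1 hn ht ?_ ?_ ?_
  · intro A hA
    rcases ramsey_spec s _ (G.induce (U : Set V)) A hA with h | ⟨Q, hQ⟩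
    · exact h
    · exfalso
      have h1 := hQ.isClique.card_le_cliqueNum
      have h2 := G.cliqueNum_induce_le (U : Set V)
      have h3 := hQ.card_eq
      omega
  · apply biclique_of_indFree
    rintro ⟨f⟩
    exact hKG ⟨f.trans (SimpleGraph.Embedding.induce _)⟩
  · rintro ⟨v, hv⟩
    refine (hcon v hv).trans (le_of_eq ?_)
    rw [← SimpleGraph.card_neighborFinset_eq_degree,
      ← Finset.card_map (Function.Embedding.subtype (fun x => x ∈ (U : Set V)))]
    congr 1
    ext z
    simp [and_comm]

/-- for every tree `T` and every integer `s ≥ 1`, there is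
`C ≥ 1` such that every `T`-free and `K_{s,s}`-free graph `G` satisfies
`χ(G) ≤ C·R(s, ω(G)+1)`. -/
theorem stmt3 (W : Type) [Fintype W] (T : SimpleGraph W) (hT : T.IsTree)
    (s : ℕ) (hs : 1 ≤ s) :
    ∃ C : ℝ, 1 ≤ C ∧ ∀ (V : Type) [Fintype V] (G : SimpleGraph V),
      IndFree T G → IndFree (completeBipartiteGraph (Fin s) (Fin s)) G →
      (chromNum G : ℝ) ≤ C * ramsey s (G.cliqueNum + 1) := by

  classical
  refine ⟨((16 * (Fintype.card W) ^ 2 * (16 * (Fintype.card W) ^ 2 * s +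
    2 ^ (16 * (Fintype.card W) ^ 2 * s)) + 16 * (Fintype.card W) ^ 4 *
      2 ^ (16 * (Fintype.card W) ^ 2 * s + 1) : ℕ) : ℝ), ?_, ?_⟩
  · have hW : 0 < Fintype.card W := Fintype.card_pos_iff.2 hT.connected.nonempty
    have : 0 < 16 * (Fintype.card W) ^ 4 * 2 ^ (16 * (Fintype.card W) ^ 2 * s + 1) := by positivity
    exact_mod_cast (by omega : 1 ≤ 16 * (Fintype.card W) ^ 2 * (16 * (Fintype.card W) ^ 2 * s +
      2 ^ (16 * (Fintype.card W) ^ 2 * s)) + 16 * (Fintype.card W) ^ 4 *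
      2 ^ (16 * (Fintype.card W) ^ 2 * s + 1))
  · intro V _ G h1 h2
    exact_mod_cast main_bound T hT s _ _ hs rfl rfl V G h1 h2
end

section
/- Let T be a tree of radius h ≥ 0, let c ∈ (0, 1/2) be real, let t ≥ 1 be an integer, and let Γ and G be graphs such that G is a subgraph of Γ (on the same vertex set) and Γ is (c,t)-sparse. Then either G has average degree less than (4/c)^(4h·|V(T)|) · t, or G has a subgraph whose vertex set induces in Γ a graph isomorphic to T and whose edges are exactly the Γ-edges on that vertex set (i.e. G contains a copy of T that is an induced subgraph of Γ). -/
open SimpleGraph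

/-- The number of ordered pairs `(a,b) ∈ A × B` forming an edge of `G`. -/
noncomputable def eCount {V : Type*} (G : SimpleGraph V) (A B : Finset V) : ℕ :=
  Set.ncard {p : V × V | p.1 ∈ A ∧ p.2 ∈ B ∧ G.Adj p.1 p.2}

/-- A graph is `(c,t)`-sparse if every two vertex subsets of size at least `t`
span at most a `(1-c)` fraction of the possible ordered adjacent pairs. -/
def CTSparse {V : Type*} [Fintype V] (G : SimpleGraph V) (c : ℝ) (t : ℕ) : Prop :=
  ∀ A B : Finset V, t ≤ A.card → t ≤ B.card →
    (eCount G A B : ℝ) ≤ (1 - c) * A.card * B.card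

/-- The average degree `2|E(G)|/|V(G)|` of a graph. -/
noncomputable def avgDeg {V : Type*} (G : SimpleGraph V) : ℝ :=
  2 * (G.edgeSet.ncard : ℝ) / (Nat.card V : ℝ)

/-- The radius of a graph: the least `h` such that some vertex has distance
at most `h` to every vertex. -/
noncomputable def graphRadius {V : Type*} (T : SimpleGraph V) : ℕ :=
  sInf {h : ℕ | ∃ v : V, ∀ u : V, T.dist v u ≤ h}

/-- Closed neighbourhood of `p`. -/
def cN {V : Type} (Γ : SimpleGraph V) (p : V) : Set V := {w | w = p ∨ Γ.Adj p w}

/-- `v` is the root of a `D`-ary depth `i` structure inside `W`. -/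
def Good {V : Type} (G Γ : SimpleGraph V) (D : ℝ) : ℕ → V → Set V → Prop
  | 0, _, _ => True
  | i + 1, v, W => ∃ S : Finset V, D ≤ (S.card : ℝ) ∧
      ∀ u ∈ S, G.Adj v u ∧ u ∈ W ∧ Good G Γ D i u (W \ cN Γ v)

lemma Good.mono {V : Type} {G Γ : SimpleGraph V} {D D' : ℝ} (hD : D' ≤ D) :
    ∀ (i : ℕ) (v : V) (W W' : Set V), W ⊆ W' → Good G Γ D i v W → Good G Γ D' i v W' := by
  intro i
  induction i with
  | zero => intros; trivial
  | succ i ih =>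
    rintro v W W' hW ⟨S, hS, h⟩
    refine ⟨S, hD.trans hS, fun u hu => ⟨(h u hu).1, hW (h u hu).2.1, ?_⟩⟩
    exact ih _ _ _ (Set.sdiff_subset_sdiff_left hW) (h u hu).2.2

open Classical in
lemma eCount_eq_sum {V : Type} [Fintype V] (Γ : SimpleGraph V) (A B : Finset V) :
    eCount Γ A B = ∑ a ∈ A, (B.filter (fun x => Γ.Adj a x)).card := by
  rw [eCount, ← Finset.card_sigma, ← Set.ncard_coe_finset]
  refine Set.ncard_congr (fun p _ => ⟨p.1, p.2⟩) ?_ ?_ ?_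
  · rintro ⟨a, b⟩ h; simpa using h
  · rintro ⟨a, b⟩ ⟨a', b'⟩ _ _ h; simpa using h
  · rintro ⟨a, b⟩ h; exact ⟨(a, b), by simpa using h, rfl⟩

open Classical in
lemma bad_card {V : Type} [Fintype V] {Γ : SimpleGraph V} {c : ℝ} (hc0 : 0 < c) {t : ℕ}
    (ht : 1 ≤ t) (hΓ : CTSparse Γ c t) (S : Finset V)
    (hSt : t ≤ S.card) (hSc : 2 ≤ c * (S.card : ℝ)) :
    ((Finset.univ.filter (fun p : V =>
      ((S.filter (fun x => x ∉ cN Γ p)).card : ℝ) < c / 2 * S.card)).card) < t := by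
  by_contra hcon
  push Not at hcon
  set B := Finset.univ.filter (fun p : V =>
      ((S.filter (fun x => x ∉ cN Γ p)).card : ℝ) < c / 2 * S.card) with hB
  have h1 := hΓ B S hcon hSt
  rw [eCount_eq_sum] at h1
  have h2 : ∀ p ∈ B, (1 - c) * (S.card : ℝ) < ((S.filter (fun x => Γ.Adj p x)).card : ℝ) := by
    intro p hp
    have hp' : ((S.filter (fun x => x ∉ cN Γ p)).card : ℝ) < c / 2 * S.card := by
      simpa [hB] using hp
    have h3 : S ⊆ S.filter (fun x => x ∉ cN Γ p) ∪ (S.filter (fun x => Γ.Adj p x) ∪ {p}) := by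
      intro x hx
      have hx' : x ∈ cN Γ p ↔ x = p ∨ Γ.Adj p x := Iff.rfl
      simp only [Finset.mem_union, Finset.mem_filter, hx', Finset.mem_singleton]
      tauto
    have h4 : S.card ≤ (S.filter (fun x => x ∉ cN Γ p)).card
        + ((S.filter (fun x => Γ.Adj p x)).card + 1) := by
      refine (Finset.card_le_card h3).trans ((Finset.card_union_le _ _).trans ?_)
      gcongr
      exact (Finset.card_union_le _ _).trans (by simp)
    have h5 : (S.card : ℝ) ≤ (S.filter (fun x => x ∉ cN Γ p)).card
        + ((S.filter (fun x => Γ.Adj p x)).card + 1) := by exact_mod_cast h4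
    linarith
  have hne : B.Nonempty := Finset.card_pos.mp (by omega)
  have h6 := Finset.sum_lt_sum_of_nonempty hne h2
  rw [Finset.sum_const, nsmul_eq_mul] at h6
  push_cast at h1
  nlinarith

open Classical in
lemma bad_good {V : Type} [Fintype V] {G Γ : SimpleGraph V} {c : ℝ} (hc0 : 0 < c)
    (hc2 : c < 1 / 2) {t : ℕ} (ht : 1 ≤ t) (hΓ : CTSparse Γ c t) {D : ℝ}
    (hD : 4 / c * t ≤ D) :
    ∀ (i : ℕ) (v : V) (W : Set V), Good G Γ D i v W →
      ((Finset.univ.filter (fun p : V => ¬ Good G Γ (c / 4 * D) i v (W \ cN Γ p))).card : ℝ)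
        ≤ t * ((4 / c) ^ i - 1) := by
  intro i
  have ht' : (1 : ℝ) ≤ t := by exact_mod_cast ht
  have hq : 8 ≤ 4 / c := by rw [le_div_iff₀ hc0]; linarith
  induction i with
  | zero => intro v W _; simp [Good]
  | succ i ih =>
    rintro v W ⟨S, hS, h⟩
    have hDS : 4 / c * t ≤ S.card := hD.trans hS
    have hSt : t ≤ S.card := by
      have : (t : ℝ) ≤ S.card := by nlinarith
      exact_mod_cast this
    have hSc : 2 ≤ c * (S.card : ℝ) := by
      have : c * (4 / c * t) ≤ c * S.card := by gcongr
      have h' : c * (4 / c * t) = 4 * t := by field_simp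
      linarith
    have hSpos : (0 : ℝ) < S.card := by nlinarith
    have hb := bad_card hc0 ht hΓ S hSt hSc
    set B1 := Finset.univ.filter (fun p : V =>
      ((S.filter (fun x => x ∉ cN Γ p)).card : ℝ) < c / 2 * S.card) with hB1
    set bad : V → V → Prop := fun u p => ¬ Good G Γ (c / 4 * D) i u ((W \ cN Γ v) \ cN Γ p)
      with hbad
    set B2 := Finset.univ.filter (fun p : V =>
      c / 4 * (S.card : ℝ) ≤ ((S.filter (fun u => bad u p)).card : ℝ)) with hB2
    have hsub : (Finset.univ.filter (fun p : V =>
        ¬ Good G Γ (c / 4 * D) (i + 1) v (W \ cN Γ p))) ⊆ B1 ∪ B2 := by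
      intro p hp
      by_contra hcon
      simp only [Finset.mem_union, not_or, hB1, hB2, Finset.mem_filter, Finset.mem_univ,
        true_and, not_lt, not_le] at hcon hp
      apply hp
      refine ⟨(S.filter (fun x => x ∉ cN Γ p)) \ (S.filter (fun u => bad u p)), ?_, ?_⟩
      · have h1 := Finset.le_card_sdiff (S.filter (fun u => bad u p)) (S.filter (fun x => x ∉ cN Γ p))
        have h2 : ((S.filter (fun x => x ∉ cN Γ p)).card : ℝ) ≤
            ((S.filter (fun x => x ∉ cN Γ p)) \ (S.filter (fun u => bad u p))).card
            + (S.filter (fun u => bad u p)).card := by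
          have : (S.filter (fun x => x ∉ cN Γ p)).card ≤
            ((S.filter (fun x => x ∉ cN Γ p)) \ (S.filter (fun u => bad u p))).card
            + (S.filter (fun u => bad u p)).card := by omega
          exact_mod_cast this
        have h3 : c / 4 * D ≤ c / 4 * S.card := by gcongr
        linarith [hcon.1, hcon.2]
      · intro u hu
        simp only [Finset.mem_sdiff, Finset.mem_filter, hbad, not_and, not_not] at hu
        obtain ⟨⟨huS, hup⟩, hg⟩ := hu
        refine ⟨(h u huS).1, ⟨(h u huS).2.1, hup⟩, ?_⟩
        rw [Set.sdiff_sdiff_comm]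
        exact hg huS
    have hB2c : (B2.card : ℝ) * (c / 4 * S.card) ≤ S.card * (t * ((4 / c) ^ i - 1)) := by
      have hdc := Finset.sum_card_bipartiteAbove_eq_sum_card_bipartiteBelow (s := S) (t := B2) bad
      have hl : (∑ u ∈ S, ((B2.bipartiteAbove bad u).card : ℝ)) ≤
          S.card * (t * ((4 / c) ^ i - 1)) := by
        rw [← nsmul_eq_mul]
        apply Finset.sum_le_card_nsmul
        intro u hu
        refine le_trans ?_ (ih u (W \ cN Γ v) (h u hu).2.2)
        norm_cast
        apply Finset.card_le_card
        intro p hp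
        simp only [Finset.mem_bipartiteAbove] at hp
        simpa [hbad] using hp.2
      have hr : (B2.card : ℝ) * (c / 4 * S.card) ≤
          ∑ p ∈ B2, ((S.bipartiteBelow bad p).card : ℝ) := by
        rw [← nsmul_eq_mul]
        apply Finset.card_nsmul_le_sum
        intro p hp
        simpa [hB2, Finset.bipartiteBelow] using hp
      have hdc' : (∑ u ∈ S, ((B2.bipartiteAbove bad u).card : ℝ)) =
          ∑ p ∈ B2, ((S.bipartiteBelow bad p).card : ℝ) := by exact_mod_cast hdc
      linarith
    have hB2' : (B2.card : ℝ) ≤ 4 / c * (t * ((4 / c) ^ i - 1)) := by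
      have h1 : (B2.card : ℝ) * (c / 4) ≤ t * ((4 / c) ^ i - 1) := by
        refine le_of_mul_le_mul_right ?_ hSpos
        linarith
      have h2 : (B2.card : ℝ) = 4 / c * (B2.card * (c / 4)) := by field_simp
      rw [h2]; gcongr
    have hb' : (B1.card : ℝ) ≤ t := by exact_mod_cast hb.le
    have hfin : ((Finset.univ.filter (fun p : V =>
        ¬ Good G Γ (c / 4 * D) (i + 1) v (W \ cN Γ p))).card : ℝ) ≤ B1.card + B2.card := by
      exact_mod_cast (Finset.card_le_card hsub).trans (Finset.card_union_le _ _)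
    refine hfin.trans ?_
    rw [pow_succ]
    nlinarith

open Classical in
lemma card_pairs_le {V : Type} [Fintype V] (P : V → V → Prop) (M : ℝ)
    (hP : ∀ a, ((Finset.univ.filter (fun b => P a b)).card : ℝ) ≤ M) :
    ((Finset.univ.filter (fun p : V × V => P p.1 p.2)).card : ℝ) ≤ Fintype.card V * M := by
  have h1 : (Finset.univ.filter (fun p : V × V => P p.1 p.2)).card =
      ∑ a : V, (Finset.univ.filter (fun b => P a b)).card := by
    simp only [Finset.card_filter, Fintype.sum_prod_type]
  rw [h1]
  push_cast
  rw [← nsmul_eq_mul]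
  exact Finset.sum_le_card_nsmul _ _ _ (fun a _ => hP a)

open Classical in
lemma card_pairs_le' {V : Type} [Fintype V] (P : V → V → Prop) (M : ℝ)
    (hP : ∀ b, ((Finset.univ.filter (fun a => P a b)).card : ℝ) ≤ M) :
    ((Finset.univ.filter (fun p : V × V => P p.1 p.2)).card : ℝ) ≤ Fintype.card V * M := by
  have h1 : (Finset.univ.filter (fun p : V × V => P p.1 p.2)).card =
      ∑ b : V, (Finset.univ.filter (fun a => P a b)).card := by
    simp only [Finset.card_filter, Fintype.sum_prod_type_right]
  rw [h1]
  push_cast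
  rw [← nsmul_eq_mul]
  exact Finset.sum_le_card_nsmul _ _ _ (fun a _ => hP a)

open Classical in
lemma exists_good_aux {V : Type} [Fintype V] {G Γ : SimpleGraph V} {c : ℝ} (hc0 : 0 < c)
    (hc2 : c < 1 / 2) {t : ℕ} (ht : 1 ≤ t) (hΓ : CTSparse Γ c t) :
    ∀ (i : ℕ) (D : ℝ), 4 / c * t ≤ D →
      ((Finset.univ.filter (fun p : V × V => G.Adj p.1 p.2 ∧
        ¬ Good G Γ D i p.1 Set.univ ∧ ¬ Good G Γ D i p.2 Set.univ)).card : ℝ) ≤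
      Fintype.card V * (2 * i * (4 / c) ^ i * (t + D)) := by
  have ht' : (1 : ℝ) ≤ t := by exact_mod_cast ht
  have hq : 8 ≤ 4 / c := by rw [le_div_iff₀ hc0]; linarith
  intro i
  induction i with
  | zero => intro D _; simp [Good]
  | succ i ih =>
    intro D hD
    have hD0 : 0 ≤ D := le_trans (by positivity) hD
    have hqD : 4 / c * t ≤ 4 / c * D := by
      have : D ≤ 4 / c * D := by nlinarith
      linarith
    have hcq : c / 4 * (4 / c * D) = D := by field_simp
    have hi := ih (4 / c * D) hqD
    set E := Finset.univ.filter (fun p : V × V => G.Adj p.1 p.2 ∧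
        ¬ Good G Γ (4 / c * D) i p.1 Set.univ ∧ ¬ Good G Γ (4 / c * D) i p.2 Set.univ) with hE
    obtain ⟨P1, hP1⟩ : ∃ P : V → V → Prop, P = fun v u => Good G Γ (4 / c * D) i u Set.univ ∧
      ¬ Good G Γ D i u (Set.univ \ cN Γ v) := ⟨_, rfl⟩
    obtain ⟨P2, hP2⟩ : ∃ P : V → V → Prop, P = fun v u => ¬ Good G Γ D (i + 1) v Set.univ ∧
      G.Adj v u ∧ Good G Γ D i u (Set.univ \ cN Γ v) := ⟨_, rfl⟩
    have h1 : ((Finset.univ.filter (fun p : V × V => P1 p.1 p.2)).card : ℝ) ≤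
        Fintype.card V * (t * ((4 / c) ^ i - 1)) := by
      refine card_pairs_le' P1 _ (fun u => ?_)
      by_cases hu : Good G Γ (4 / c * D) i u Set.univ
      · have := bad_good hc0 hc2 ht hΓ hqD i u Set.univ hu
        rw [hcq] at this
        simpa [hP1, hu] using this
      · have : (0 : ℝ) ≤ t * ((4 / c) ^ i - 1) := by
          apply mul_nonneg (by positivity)
          have := one_le_pow₀ (M₀ := ℝ) (a := 4 / c) (by linarith) (n := i)
          linarith
        simpa [hP1, hu] using this
    have h2 : ((Finset.univ.filter (fun p : V × V => P2 p.1 p.2)).card : ℝ) ≤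
        Fintype.card V * D := by
      refine card_pairs_le P2 _ (fun v => ?_)
      by_cases hv : Good G Γ D (i + 1) v Set.univ
      · simpa [hP2, hv] using hD0
      · by_contra hcon
        push Not at hcon
        refine hv ⟨_, hcon.le, fun u hu => ?_⟩
        simp only [hP2, Finset.mem_filter] at hu
        exact ⟨hu.2.2.1, trivial, hu.2.2.2⟩
    set F1 := Finset.univ.filter (fun p : V × V => P1 p.1 p.2) with hF1
    set F2 := Finset.univ.filter (fun p : V × V => P2 p.1 p.2) with hF2
    set Q := Finset.univ.filter (fun p : V × V => G.Adj p.1 p.2 ∧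
        ¬ Good G Γ D (i + 1) p.1 Set.univ ∧ ¬ Good G Γ D (i + 1) p.2 Set.univ) with hQ
    have hsub : Q ⊆
        E ∪ ((F1 ∪ F2) ∪ (F1 ∪ F2).image Prod.swap) := by
      rintro ⟨v, u⟩ hp
      simp only [hQ, Finset.mem_filter, Finset.mem_univ, true_and] at hp
      obtain ⟨ha, hv, hu⟩ := hp
      have key : ∀ a b : V, G.Adj a b → ¬ Good G Γ D (i + 1) a Set.univ →
          Good G Γ (4 / c * D) i b Set.univ → (a, b) ∈ F1 ∪ F2 := by
        intro a b hab h1 h2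
        simp only [Finset.mem_union, hF1, hF2, Finset.mem_filter, Finset.mem_univ, true_and, hP1, hP2]
        tauto
      by_cases hu' : Good G Γ (4 / c * D) i u Set.univ
      · exact Finset.mem_union_right _ (Finset.mem_union_left _ (key v u ha hv hu'))
      by_cases hv' : Good G Γ (4 / c * D) i v Set.univ
      · refine Finset.mem_union_right _ (Finset.mem_union_right _ ?_)
        exact Finset.mem_image.mpr ⟨(u, v), key u v ha.symm hu hv', rfl⟩
      · refine Finset.mem_union_left _ ?_
        simp [hE, ha, hu', hv']
    have hcard : (Q.card : ℝ) ≤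
        E.card + ((F1.card + F2.card) + (F1.card + F2.card)) := by
      have hu1 := Finset.card_union_le F1 F2
      have hu2 := Finset.card_image_le (s := F1 ∪ F2) (f := Prod.swap)
      have hu3 := Finset.card_union_le (F1 ∪ F2) ((F1 ∪ F2).image Prod.swap)
      have hu4 := Finset.card_union_le E ((F1 ∪ F2) ∪ (F1 ∪ F2).image Prod.swap)
      have hu5 := Finset.card_le_card hsub
      have hu6 : Q.card ≤ E.card + ((F1.card + F2.card) + (F1.card + F2.card)) := by omega
      exact_mod_cast hu6
    refine hcard.trans ?_
    have hn : (0 : ℝ) ≤ Fintype.card V := by positivity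
    have hqi : (0 : ℝ) < (4 / c) ^ i := by positivity
    have hqi1 : (1 : ℝ) ≤ (4 / c) ^ i := one_le_pow₀ (by linarith)
    have hqs : (4 / c) ^ i ≤ (4 / c) ^ (i + 1) := pow_le_pow_right₀ (by linarith) (by omega)
    have e1 : 2 * (i : ℝ) * (4 / c) ^ i * (t + 4 / c * D) ≤ 2 * i * (4 / c) ^ (i + 1) * (t + D) := by
      have : (4 / c) ^ i * (t + 4 / c * D) ≤ (4 / c) ^ (i + 1) * (t + D) := by
        have h3 : (4 / c) ^ i * t ≤ (4 / c) ^ (i + 1) * t := by gcongr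
        have h4 : (4 / c) ^ i * (4 / c * D) = (4 / c) ^ (i + 1) * D := by ring
        linarith
      have h5 : (0 : ℝ) ≤ 2 * i := by positivity
      nlinarith
    have e2 : t * ((4 / c) ^ i - 1) + D ≤ (4 / c) ^ (i + 1) * (t + D) := by
      have h3 : (4 / c) ^ i * t ≤ (4 / c) ^ (i + 1) * t := by gcongr
      have h4 : 1 * D ≤ (4 / c) ^ (i + 1) * D := by gcongr; linarith
      linarith
    calc _ ≤ Fintype.card V * (2 * (i : ℝ) * (4 / c) ^ i * (t + 4 / c * D))
          + 2 * (Fintype.card V * (t * ((4 / c) ^ i - 1) + D)) := by linarith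
      _ ≤ Fintype.card V * (2 * i * (4 / c) ^ (i + 1) * (t + D))
          + 2 * (Fintype.card V * ((4 / c) ^ (i + 1) * (t + D))) := by gcongr
      _ = _ := by push_cast; ring

lemma rooted {U : Type} [Fintype U] {T : SimpleGraph U} (hT : T.IsTree)
    {h : ℕ} (hrad : graphRadius T = h) :
    ∃ (r : U) (par : U → U) (dep : U → ℕ), (∀ u, dep u ≤ h) ∧ dep r = 0 ∧
      (∀ u, u ≠ r → dep u = dep (par u) + 1) ∧
      (∀ a b, T.Adj a b ↔ (a ≠ r ∧ par a = b) ∨ (b ≠ r ∧ par b = a)) := by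
  classical
  have hconn := hT.connected
  have := hconn.nonempty
  have hne : {h : ℕ | ∃ v : U, ∀ u : U, T.dist v u ≤ h}.Nonempty := by
    obtain ⟨v⟩ := ‹Nonempty U›
    exact ⟨Finset.univ.sup (fun u => T.dist v u), v, fun u =>
      Finset.le_sup (f := fun u => T.dist v u) (Finset.mem_univ u)⟩
  have hmem := Nat.sInf_mem hne
  change ∃ v : U, ∀ u : U, T.dist v u ≤ graphRadius T at hmem
  rw [hrad] at hmem
  obtain ⟨r, hr⟩ := hmem
  have hpar : ∀ u : U, ∃ w : U, u ≠ r → T.Adj w u ∧ T.dist r u = T.dist r w + 1 ∧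
      ∀ x, T.Adj x u → T.dist r u = T.dist r x + 1 → x = w := by
    intro u
    by_cases hu : u = r
    · exact ⟨r, fun h => absurd hu h⟩
    obtain ⟨p, hp, hlen⟩ := hconn.exists_path_of_dist r u
    have hnil : ¬ p.Nil := fun hn => hu hn.eq.symm
    have hadj := p.adj_penultimate hnil
    have huniq : ∀ x, T.Adj x u → T.dist r u = T.dist r x + 1 → x = p.penultimate := by
      intro x hx hd
      obtain ⟨q, hq, hqlen⟩ := hconn.exists_path_of_dist r x
      have hc : (q.concat hx).IsPath := by
        apply Walk.isPath_of_length_eq_dist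
        rw [Walk.length_concat]; omega
      have := (hT.isAcyclic.subsingleton_path r u).elim ⟨p, hp⟩ ⟨_, hc⟩
      have h2 : p = q.concat hx := congrArg Subtype.val this
      rw [h2]; simp
    refine ⟨p.penultimate, fun _ => ⟨hadj, ?_, huniq⟩⟩
    have h1 : T.dist r p.penultimate ≤ p.length - 1 := by
      have := dist_le p.dropLast
      rwa [Walk.length_dropLast] at this
    have h2 := hT.dist_eq_dist_add_one_of_adj r hadj
    have h3 : 0 < p.length := Walk.not_nil_iff_lt_length.mp hnil
    omega
  choose par hpar using hpar
  refine ⟨r, par, T.dist r, hr, by simp, fun u hu => (hpar u hu).2.1, fun a b => ?_⟩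
  constructor
  · intro hab
    rcases hT.dist_eq_dist_add_one_of_adj r hab with hd | hd
    · left
      have : a ≠ r := by rintro rfl; simp at hd
      exact ⟨this, ((hpar a this).2.2 b hab.symm hd).symm⟩
    · right
      have : b ≠ r := by rintro rfl; simp at hd
      exact ⟨this, ((hpar b this).2.2 a hab hd).symm⟩
  · rintro (⟨ha, rfl⟩ | ⟨hb, rfl⟩)
    · exact (hpar a ha).1.symm
    · exact (hpar b hb).1

open Classical in
lemma embed {U : Type} [Fintype U] {T : SimpleGraph U} {V : Type} [Fintype V]
    {G Γ : SimpleGraph V} (hsub : G ≤ Γ) {c : ℝ} (hc0 : 0 < c)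
    (hc2 : c < 1 / 2) {t : ℕ} (ht : 1 ≤ t) (hΓ : CTSparse Γ c t)
    {h : ℕ} {r : U} {par : U → U} {dep : U → ℕ} (hdep : ∀ u, dep u ≤ h) (hr : dep r = 0)
    (hpar : ∀ u, u ≠ r → dep u = dep (par u) + 1)
    (hadj : ∀ a b, T.Adj a b ↔ (a ≠ r ∧ par a = b) ∨ (b ≠ r ∧ par b = a))
    {D : ℝ} (hD1 : ∀ n < Fintype.card U, 4 / c * t ≤ (c / 4) ^ n * D)
    (hD2 : ∀ n < Fintype.card U, Fintype.card U * (t * (4 / c) ^ h) < (c / 4) ^ n * D)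
    {v0 : V} (hv0 : Good G Γ D h v0 Set.univ) :
    ∀ n, n + 1 ≤ Fintype.card U → ∃ A : Finset U, A.card = n + 1 ∧ r ∈ A ∧
      (∀ a ∈ A, a ≠ r → par a ∈ A) ∧ ∃ f : U → V,
      (∀ a ∈ A, ∀ b ∈ A, a ≠ b → f a ≠ f b) ∧
      (∀ a ∈ A, ∀ b ∈ A, (Γ.Adj (f a) (f b) ↔ T.Adj a b)) ∧
      (∀ a ∈ A, ∀ b ∈ A, T.Adj a b → G.Adj (f a) (f b)) ∧
      ∀ a ∈ A, Good G Γ ((c / 4) ^ n * D) (h - dep a) (f a)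
        {w | ∀ a' ∈ A, a' ≠ a → w ∉ cN Γ (f a')} := by
  intro n
  have ht' : (1 : ℝ) ≤ t := by exact_mod_cast ht
  have hq : 8 ≤ 4 / c := by rw [le_div_iff₀ hc0]; linarith
  induction n with
  | zero =>
    intro _
    refine ⟨{r}, by simp, by simp, by simp, fun _ => v0, by simp, by simp, by simp, ?_⟩
    intro a ha
    rw [Finset.mem_singleton] at ha
    subst ha
    rw [hr]
    refine Good.mono (by simp) _ _ _ _ ?_ hv0
    intro w _ a' ha' hne
    exact absurd (Finset.mem_singleton.mp ha') hne
  | succ n ih =>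
    intro hn
    obtain ⟨A, hAc, hrA, hAp, f, hinj, hiff, hG, hgood⟩ := ih (by omega)
    -- choose the new vertex
    have hex : (Finset.univ \ A).Nonempty := by
      rw [← Finset.card_pos, Finset.card_sdiff_of_subset (Finset.subset_univ _), Finset.card_univ]
      omega
    obtain ⟨b, hb, hbmin⟩ := Finset.exists_min_image _ dep hex
    have hbA : b ∉ A := by simpa using hb
    have hbr : b ≠ r := by rintro rfl; exact hbA hrA
    have hbp := hpar b hbr
    have hxA : par b ∈ A := by
      by_contra hx
      have := hbmin (par b) (by simpa using hx)
      omega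
    set x := par b with hx
    have hdx : h - dep x = (h - dep b) + 1 := by
      have := hdep b
      omega
    have hgx := hgood x hxA
    rw [hdx] at hgx
    obtain ⟨S, hS, hSu⟩ := hgx
    set Dn := (c / 4) ^ n * D with hDn
    have hDn1 : 4 / c * t ≤ Dn := hD1 n (by omega)
    let bad : U → Finset V := fun a => Finset.univ.filter (fun p : V =>
      ¬ Good G Γ (c / 4 * Dn) (h - dep a) (f a)
        ({w | ∀ a' ∈ A, a' ≠ a → w ∉ cN Γ (f a')} \ cN Γ p))
    have hbad : ∀ a ∈ A, ((bad a).card : ℝ) ≤ t * (4 / c) ^ h := by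
      intro a ha
      refine (bad_good hc0 hc2 ht hΓ hDn1 _ _ _ (hgood a ha)).trans ?_
      have : (4 / c) ^ (h - dep a) ≤ (4 / c) ^ h := pow_le_pow_right₀ (by linarith) (by omega)
      have h2 : (4 / c) ^ (h - dep a) - 1 ≤ (4 / c) ^ h := by linarith
      gcongr
    have hun : ((A.biUnion bad).card : ℝ) < S.card := by
      have h1 : ((A.biUnion bad).card : ℝ) ≤ ∑ a ∈ A, ((bad a).card : ℝ) := by
        exact_mod_cast Finset.card_biUnion_le
      have h2 : (∑ a ∈ A, ((bad a).card : ℝ)) ≤ A.card * (t * (4 / c) ^ h) := by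
        rw [← nsmul_eq_mul]
        exact Finset.sum_le_card_nsmul _ _ _ hbad
      have h3 : (A.card : ℝ) * (t * (4 / c) ^ h) ≤ Fintype.card U * (t * (4 / c) ^ h) := by
        gcongr
        exact Finset.card_le_univ A
      have h4 := hD2 n (by omega)
      linarith
    obtain ⟨y, hyS, hyb⟩ : ∃ y ∈ S, y ∉ A.biUnion bad :=
      Finset.exists_mem_notMem_of_card_lt_card (by exact_mod_cast hun)
    obtain ⟨hxy, hyW, hyg⟩ := hSu y hyS
    have hyW' : ∀ a ∈ A, a ≠ x → y ≠ f a ∧ ¬ Γ.Adj (f a) y := by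
      intro a ha hne
      have := hyW a ha hne
      exact ⟨fun h => this (Or.inl h), fun h => this (Or.inr h)⟩
    have hygood : ∀ a ∈ A, Good G Γ (c / 4 * Dn) (h - dep a) (f a)
        ({w | ∀ a' ∈ A, a' ≠ a → w ∉ cN Γ (f a')} \ cN Γ y) := by
      intro a ha
      by_contra hcon
      apply hyb
      rw [Finset.mem_biUnion]
      exact ⟨a, ha, by simpa [bad] using hcon⟩
    have hyne : ∀ a ∈ A, y ≠ f a := by
      intro a ha
      by_cases hax : a = x
      · rw [hax]; exact hxy.ne'
      · exact (hyW' a ha hax).1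
    have hTb : ∀ a ∈ A, T.Adj a b ↔ a = x := by
      intro a ha
      rw [hadj]
      constructor
      · rintro (⟨h1, h2⟩ | ⟨h1, h2⟩)
        · exact absurd (h2 ▸ hAp a ha h1) hbA
        · exact h2.symm
      · intro h1
        exact Or.inr ⟨hbr, h1.symm⟩
    have hΓb : ∀ a ∈ A, Γ.Adj (f a) y ↔ a = x := by
      intro a ha
      constructor
      · intro h1
        by_contra hne
        exact (hyW' a ha hne).2 h1
      · rintro rfl
        exact hsub hxy
    have hDs : (c / 4) ^ (n + 1) * D = c / 4 * Dn := by rw [hDn]; ring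
    have hfb : Function.update f b y b = y := by simp
    have hfa : ∀ a ∈ A, Function.update f b y a = f a := by
      intro a ha
      exact Function.update_of_ne (by rintro rfl; exact hbA ha) _ _
    refine ⟨insert b A, by rw [Finset.card_insert_of_notMem hbA, hAc],
      Finset.mem_insert_of_mem hrA, ?_, Function.update f b y, ?_, ?_, ?_, ?_⟩
    · intro a ha har
      rcases Finset.mem_insert.mp ha with rfl | ha
      · exact Finset.mem_insert_of_mem hxA
      · exact Finset.mem_insert_of_mem (hAp a ha har)
    · intro a ha a' ha' hne
      rcases Finset.mem_insert.mp ha with rfl | ha2 <;>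
      rcases Finset.mem_insert.mp ha' with rfl | ha3
      · exact absurd rfl hne
      · rw [hfb, hfa _ ha3]; exact hyne _ ha3
      · rw [hfb, hfa _ ha2]; exact (hyne _ ha2).symm
      · rw [hfa _ ha2, hfa _ ha3]; exact hinj _ ha2 _ ha3 hne
    · intro a ha a' ha'
      rcases Finset.mem_insert.mp ha with rfl | ha2 <;>
      rcases Finset.mem_insert.mp ha' with rfl | ha3
      · simp
      · rw [hfb, hfa _ ha3, Γ.adj_comm, T.adj_comm, hΓb _ ha3, hTb _ ha3]
      · rw [hfb, hfa _ ha2, hΓb _ ha2, hTb _ ha2]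
      · rw [hfa _ ha2, hfa _ ha3]; exact hiff _ ha2 _ ha3
    · intro a ha a' ha' hT
      rcases Finset.mem_insert.mp ha with rfl | ha2 <;>
      rcases Finset.mem_insert.mp ha' with rfl | ha3
      · exact absurd hT (T.loopless.irrefl _)
      · rw [hfb, hfa _ ha3, (hTb _ ha3).mp hT.symm]; exact hxy.symm
      · rw [hfb, hfa _ ha2, (hTb _ ha2).mp hT]; exact hxy
      · rw [hfa _ ha2, hfa _ ha3]; exact hG _ ha2 _ ha3 hT
    · intro a ha
      rw [hDs]
      have hDle : c / 4 * Dn ≤ Dn := by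
        have : 0 ≤ Dn := le_trans (by positivity) hDn1
        nlinarith
      rcases Finset.mem_insert.mp ha with rfl | ha
      · rw [hfb]
        refine Good.mono hDle _ _ _ _ ?_ hyg
        rintro w ⟨hw1, hw2⟩ a' ha' hne
        rcases Finset.mem_insert.mp ha' with rfl | ha'
        · exact absurd rfl hne
        · rw [hfa _ ha']
          by_cases hax : a' = x
          · rw [hax]; exact hw2
          · exact hw1 a' ha' hax
      · rw [hfa _ ha]
        refine Good.mono le_rfl _ _ _ _ ?_ (hygood a ha)
        rintro w ⟨hw1, hw2⟩ a' ha' hne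
        rcases Finset.mem_insert.mp ha' with rfl | ha'
        · rw [hfb]; exact hw2
        · rw [hfa _ ha']; exact hw1 a' ha' hne

/-- if `T` is a tree of radius `h`, `c ∈ (0,1/2)`, `t ≥ 1`, `G` is
a subgraph of `Γ` (same vertex set), and `Γ` is `(c,t)`-sparse, then either `G`
has average degree less than `(4/c)^(4h|V(T)|)·t`, or `G` has a subgraph that
is induced in `Γ` and isomorphic to `T`. -/
theorem stmt4 (U : Type) [Fintype U] (T : SimpleGraph U) (hT : T.IsTree)
    (h : ℕ) (hrad : graphRadius T = h)
    (c : ℝ) (hc0 : 0 < c) (hc2 : c < 1 / 2) (t : ℕ) (ht : 1 ≤ t)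
    (V : Type) [Fintype V] (Γ G : SimpleGraph V)
    (hsub : G ≤ Γ) (hΓ : CTSparse Γ c t) :
    avgDeg G < (4 / c) ^ (4 * h * Fintype.card U) * t ∨
    ∃ f : T ↪g Γ, ∀ a b : U, T.Adj a b → G.Adj (f a) (f b) := by
  classical
  by_cases hlt : avgDeg G < (4 / c) ^ (4 * h * Fintype.card U) * t
  · exact Or.inl hlt
  right
  push Not at hlt
  have ht' : (1 : ℝ) ≤ t := by exact_mod_cast ht
  have hq : 8 ≤ 4 / c := by rw [le_div_iff₀ hc0]; linarith
  obtain ⟨r, par, dep, hdep, hr, hpar, hadj⟩ := rooted hT hrad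
  set k := Fintype.card U with hk
  have hk1 : 1 ≤ k := Fintype.card_pos_iff.mpr ⟨r⟩
  have hk1' : (1 : ℝ) ≤ k := by exact_mod_cast hk1
  have hqk : ∀ n, (0 : ℝ) < (4 / c) ^ n := fun n => by positivity
  have hq1 : ∀ n, (1 : ℝ) ≤ (4 / c) ^ n := fun n => one_le_pow₀ (by linarith)
  have hcq : ∀ n, (c / 4) ^ n * (4 / c) ^ n = 1 := by
    intro n
    rw [← mul_pow]
    have : c / 4 * (4 / c) = 1 := by field_simp
    rw [this, one_pow]
  set D : ℝ := (4 / c) ^ k * (k * (t * (4 / c) ^ h)) with hD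
  have hM : (t : ℝ) ≤ k * (t * (4 / c) ^ h) := by
    have h1 : (t : ℝ) * 1 ≤ t * (4 / c) ^ h := by gcongr; exact hq1 h
    have h2 : 1 * (t * (4 / c) ^ h) ≤ k * (t * (4 / c) ^ h) := by gcongr
    linarith
  have hDn : ∀ n < k, 4 / c * (k * (t * (4 / c) ^ h)) ≤ (c / 4) ^ n * D := by
    intro n hn
    have e : (c / 4) ^ n * D = (4 / c) ^ (k - n) * (k * (t * (4 / c) ^ h)) := by
      have : (4 / c) ^ k = (4 / c) ^ n * (4 / c) ^ (k - n) := by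
        rw [← pow_add]; congr 1; omega
      rw [hD, this]
      linear_combination ((4 / c) ^ (k - n) * (k * (t * (4 / c) ^ h))) * hcq n
    rw [e]
    have : (4 / c) ^ 1 ≤ (4 / c) ^ (k - n) := pow_le_pow_right₀ (by linarith) (by omega)
    rw [pow_one] at this
    gcongr
  have hD1 : ∀ n < k, 4 / c * t ≤ (c / 4) ^ n * D := by
    intro n hn
    refine le_trans ?_ (hDn n hn)
    gcongr
  have hD2 : ∀ n < k, k * (t * (4 / c) ^ h) < (c / 4) ^ n * D := by
    intro n hn
    refine lt_of_lt_of_le ?_ (hDn n hn)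
    nlinarith
  obtain ⟨v0, hv0⟩ : ∃ v0, Good G Γ D h v0 Set.univ := by
    have hpos : 0 < avgDeg G := lt_of_lt_of_le (by positivity) hlt
    have hVpos : (0 : ℝ) < Fintype.card V := by
      rcases Nat.eq_zero_or_pos (Fintype.card V) with h0 | h0
      · rw [avgDeg, Nat.card_eq_fintype_card, h0] at hpos
        simp at hpos
      · exact_mod_cast h0
    rcases Nat.eq_zero_or_pos h with h0 | h0
    · rw [h0]
      obtain ⟨v⟩ : Nonempty V := Fintype.card_pos_iff.mp (by exact_mod_cast hVpos)
      exact ⟨v, trivial⟩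
    by_contra hcon
    push Not at hcon
    have h1 := exists_good_aux (G := G) hc0 hc2 ht hΓ h D (by simpa using hD1 0 (by omega))
    have h2 : (Finset.univ.filter (fun p : V × V => G.Adj p.1 p.2 ∧
        ¬ Good G Γ D h p.1 Set.univ ∧ ¬ Good G Γ D h p.2 Set.univ)).card
        = 2 * G.edgeSet.ncard := by
      have h3 : ∑ v, G.degree v = 2 * G.edgeFinset.card := G.sum_degrees_eq_twice_card_edges
      have h4 : G.edgeSet.ncard = G.edgeFinset.card := by
        rw [← coe_edgeFinset, Set.ncard_coe_finset]
      rw [h4, ← h3]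
      simp only [hcon, not_false_eq_true, and_true]
      rw [Finset.card_filter, Fintype.sum_prod_type]
      refine Finset.sum_congr rfl (fun v _ => ?_)
      rw [← Finset.card_filter, ← card_neighborFinset_eq_degree]
      congr 1
      ext w; simp
    rw [h2] at h1
    have h5 : avgDeg G ≤ 2 * h * (4 / c) ^ h * (t + D) := by
      rw [avgDeg, Nat.card_eq_fintype_card, div_le_iff₀ hVpos]
      push_cast at h1
      linarith
    have h6 := hlt.trans h5
    have htD : (t : ℝ) ≤ D := by
      have : 1 * (k * (t * (4 / c) ^ h)) ≤ D := by
        rw [hD]; gcongr; exact hq1 k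
      linarith
    have h7 : 2 * h * (4 / c) ^ h * (t + D) ≤ 4 * (h * k : ℕ) * (4 / c) ^ (h + k + h) * t := by
      have : 2 * h * (4 / c) ^ h * (t + D) ≤ 2 * h * (4 / c) ^ h * (D + D) := by gcongr
      refine this.trans (le_of_eq ?_)
      rw [hD, pow_add, pow_add]; push_cast; ring
    have h8 : (4 * (h * k : ℕ) : ℝ) < (4 / c) ^ (h * k) := by
      have ha : 4 * (h * k) < 8 ^ (h * k) := by
        have hm : 1 ≤ h * k := Nat.mul_pos h0 hk1
        generalize h * k = m at hm
        induction m, hm using Nat.le_induction with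
        | base => norm_num
        | succ m hm ih => rw [pow_succ]; omega
      have hb : ((8 : ℝ)) ^ (h * k) ≤ (4 / c) ^ (h * k) := by gcongr
      refine lt_of_lt_of_le ?_ hb
      exact_mod_cast ha
    have h9 : (4 / c) ^ (h + k + h) ≤ (4 / c) ^ (3 * (h * k)) := by
      apply pow_le_pow_right₀ (by linarith)
      nlinarith
    have h10 : 4 * (h * k : ℕ) * (4 / c) ^ (h + k + h) * t < (4 / c) ^ (4 * h * k) * t := by
      have e : (4 / c) ^ (4 * h * k) = (4 / c) ^ (h * k) * (4 / c) ^ (3 * (h * k)) := by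
        rw [← pow_add]; congr 1; ring
      rw [e]
      have h11 : (4 * (h * k : ℕ) : ℝ) * (4 / c) ^ (h + k + h) <
          (4 / c) ^ (h * k) * (4 / c) ^ (3 * (h * k)) :=
        mul_lt_mul h8 h9 (hqk _) (hqk _).le
      exact mul_lt_mul_of_pos_right h11 (by linarith)
    linarith
  obtain ⟨A, hAc, -, -, f, hinj, hiff, hG, -⟩ :=
    embed hsub hc0 hc2 ht hΓ hdep hr hpar hadj hD1 hD2 hv0 (k - 1) (by omega)
  have hA : ∀ a, a ∈ A := by
    have : A = Finset.univ := by
      rw [← Finset.card_eq_iff_eq_univ, hAc]; omega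
    intro a; rw [this]; exact Finset.mem_univ a
  refine ⟨⟨⟨f, ?_⟩, ?_⟩, ?_⟩
  · intro a b hab
    by_contra hne
    exact hinj a (hA a) b (hA b) hne hab
  · intro a b
    exact hiff a (hA a) b (hA b)
  · intro a b hab
    exact hG a (hA a) b (hA b) hab
end

section
/- Let k ≥ 5, s ≥ 2, and q ≥ 1 be integers, and let G be a P_k-free graph with χ(G) ≥ s^(k−3) · (2q + 7s·R(s, ω(G)+1) − 7s). Then G contains a stable set S of size s such that the subgraph of G induced on the common neighbourhood ∩_{v∈S} N_G(v) has chromatic number greater than q. -/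
open SimpleGraph

namespace PK

section Basics
open Classical
variable {V : Type} (G : SimpleGraph V)

/-- `W` can be properly coloured with `n` colours. -/
def Col (W : Finset V) (n : ℕ) : Prop :=
  ∃ g : V → ℕ, (∀ v ∈ W, g v < n) ∧ ∀ u ∈ W, ∀ v ∈ W, G.Adj u v → g u ≠ g v

/-- Reachability by a walk whose vertices after the first lie in `A`. -/
def Rch (A : Finset V) : V → V → Prop :=
  Relation.ReflTransGen (fun a b => G.Adj a b ∧ b ∈ A)

/-- Removing at most `r` vertices leaves `K` connected. -/
def KC (r : ℕ) (K : Finset V) : Prop :=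
  ∀ Q : Finset V, Q.card ≤ r → ∀ a ∈ K \ Q, ∀ b ∈ K \ Q, Rch G (K \ Q) a b

variable {G}

lemma Col.mono {W W' : Finset V} {n n' : ℕ} (h : Col G W n) (hW : W' ⊆ W) (hn : n ≤ n') :
    Col G W' n' := by
  obtain ⟨g, h1, h2⟩ := h
  exact ⟨g, fun v hv => lt_of_lt_of_le (h1 v (hW hv)) hn,
    fun u hu v hv => h2 u (hW hu) v (hW hv)⟩

lemma Col.union {A B : Finset V} {m n : ℕ} (hA : Col G A m) (hB : Col G B n) :
    Col G (A ∪ B) (m + n) := by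
  obtain ⟨g, h1, h2⟩ := hA
  obtain ⟨h, h3, h4⟩ := hB
  refine ⟨fun v => if v ∈ A then g v else m + h v, ?_, ?_⟩
  · intro v hv
    by_cases hvA : v ∈ A
    · simp only [hvA, if_true]; have := h1 v hvA; omega
    · simp only [hvA, if_false]
      have := h3 v (by simpa [hvA] using hv); omega
  · intro u hu v hv huv
    by_cases huA : u ∈ A <;> by_cases hvA : v ∈ A <;> simp only [huA, hvA, if_true, if_false]
    · exact h2 u huA v hvA huv
    · have := h1 u huA; omega
    · have := h1 v hvA; omega
    · have := h4 u (by simpa [huA] using hu) v (by simpa [hvA] using hv) huv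
      omega

lemma col_card (A : Finset V) : Col G A A.card := by
  induction A using Finset.induction_on with
  | empty => exact ⟨fun _ => 0, by simp, by simp⟩
  | insert a A ha ih =>
    rw [Finset.card_insert_of_notMem ha]
    have h1 : Col G {a} 1 := by
      refine ⟨fun _ => 0, by simp, ?_⟩
      intro u hu v hv huv
      simp only [Finset.mem_singleton] at hu hv
      subst hu; subst hv
      exact absurd huv (G.irrefl)
    have := ih.union h1
    exact this.mono (by intro x; simp) le_rfl

lemma Rch.mono {A B : Finset V} (h : A ⊆ B) {x y : V} (hr : Rch G A x y) : Rch G B x y :=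
  Relation.ReflTransGen.mono (fun _ _ hab => ⟨hab.1, h hab.2⟩) _ _ hr

lemma first_cross {A : Finset V} (Q : V → Prop) {a b : V} (h : Rch G A a b) (ha : ¬ Q a)
    (hb : Q b) : ∃ u v, Rch G (A.filter (fun x => ¬ Q x)) a u ∧ ¬ Q u ∧ G.Adj u v ∧ v ∈ A ∧ Q v := by
  have key : (Rch G (A.filter (fun x => ¬ Q x)) a b ∧ ¬ Q b) ∨
      ∃ u v, Rch G (A.filter (fun x => ¬ Q x)) a u ∧ ¬ Q u ∧ G.Adj u v ∧ v ∈ A ∧ Q v := by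
    clear hb
    induction h with
    | refl => exact Or.inl ⟨Relation.ReflTransGen.refl, ha⟩
    | @tail b c _ hbc ih =>
      rcases ih with ⟨h1, h2⟩ | h
      · by_cases hc : Q c
        · exact Or.inr ⟨b, c, h1, h2, hbc.1, hbc.2, hc⟩
        · exact Or.inl ⟨h1.tail ⟨hbc.1, by simp [hbc.2, hc]⟩, hc⟩
      · exact Or.inr h
  rcases key with h | h
  · exact absurd hb h.2
  · exact h

lemma last_cross {A : Finset V} {x u : V} (h : Rch G A x u) :
    u = x ∨ ∃ y ∈ A, G.Adj x y ∧ Rch G (A.filter (fun a => ¬ G.Adj x a ∧ a ≠ x)) y u := by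
  induction h with
  | refl => exact Or.inl rfl
  | @tail b c _ hbc ih =>
    by_cases hc : c = x
    · exact Or.inl hc
    right
    by_cases hxc : G.Adj x c
    · exact ⟨c, hbc.2, hxc, Relation.ReflTransGen.refl⟩
    rcases ih with rfl | ⟨y, hy, hxy, hr⟩
    · exact absurd hbc.1 hxc
    · exact ⟨y, hy, hxy, hr.tail ⟨hbc.1, by simp [hbc.2, hc, hxc]⟩⟩

variable (G) in
/-- `l` is the vertex list of an induced path. -/
def IP : List V → Prop
  | [] => True
  | x :: t => IP t ∧ x ∉ t ∧ ∀ y ∈ t, (G.Adj x y ↔ t.head? = some y)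

lemma IP_ext (n : ℕ) : ∀ (A : Finset V), A.card ≤ n → ∀ (x : V) (t : List V), IP G (x :: t) →
    (∀ y ∈ t, y ∉ A ∧ ∀ a ∈ A, ¬ G.Adj y a) → ∀ u, Rch G A x u → u ≠ x →
    ∃ p : List V, IP G (u :: p ++ x :: t) ∧ ∀ a ∈ u :: p, a ∈ A := by
  induction n with
  | zero =>
    intro A hA x t _ _ u hr hu
    rcases last_cross hr with h | ⟨y, hy, _⟩
    · exact absurd h hu
    · have : A = ∅ := by simpa using hA
      simp [this] at hy
  | succ n ih =>
    intro A hA x t hIP ht u hr hu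
    rcases last_cross hr with h | ⟨y, hy, hxy, hr'⟩
    · exact absurd h hu
    have hIPy : IP G (y :: x :: t) := by
      refine ⟨hIP, ?_, ?_⟩
      · simp only [List.mem_cons, not_or]
        exact ⟨fun h => G.irrefl (h ▸ hxy), fun h => (ht y h).1 hy⟩
      · intro w hw
        simp only [List.head?_cons, Option.some.injEq]
        rcases List.mem_cons.1 hw with rfl | hw'
        · simp [hxy.symm]
        · have h1 := (ht w hw').2 y hy
          constructor
          · intro h; exact absurd h.symm h1
          · intro h; exact absurd (h ▸ hw') hIP.2.1
    by_cases huy : u = y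
    · subst huy
      exact ⟨[], hIPy, by simpa using hy⟩
    obtain ⟨p, hp, hpA⟩ := ih (A.filter (fun a => ¬ G.Adj x a ∧ a ≠ x)) (by
        have : A.filter (fun a => ¬ G.Adj x a ∧ a ≠ x) ⊂ A := by
          refine Finset.filter_ssubset.2 ⟨y, hy, ?_⟩
          simp [hxy]
        have := Finset.card_lt_card this
        omega) y (x :: t) hIPy (by
        intro w hw
        rcases List.mem_cons.1 hw with rfl | hw'
        · refine ⟨by simp, ?_⟩
          intro a ha
          exact (Finset.mem_filter.1 ha).2.1
        · refine ⟨fun h => (ht w hw').1 (Finset.mem_filter.1 h).1, ?_⟩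
          intro a ha
          exact (ht w hw').2 a (Finset.mem_filter.1 ha).1) u hr' huy
    refine ⟨p ++ [y], by simpa using hp, ?_⟩
    intro a ha
    have : a ∈ u :: p ∨ a = y := by simpa [or_assoc] using ha
    rcases this with h | rfl
    · exact (Finset.mem_filter.1 (hpA a h)).1
    · exact hy

lemma IP_append {x : V} {t : List V} : ∀ {p : List V}, IP G (p ++ x :: t) →
    ∀ a ∈ p, ∀ y ∈ t, ¬ G.Adj a y ∧ a ≠ y := by
  intro p
  induction p with
  | nil => simp
  | cons b p ih =>
    intro h a ha y hy
    obtain ⟨h1, h2, h3⟩ := h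
    rcases List.mem_cons.1 ha with rfl | ha'
    · refine ⟨?_, ?_⟩
      · rw [h3 y (by simp [hy])]
        cases p with
        | nil =>
          intro h
          obtain rfl : x = y := Option.some.inj h
          exact h1.2.1 hy
        | cons c p =>
          intro h
          obtain rfl : c = y := Option.some.inj h
          exact (ih h1 c (by simp) c hy).2 rfl
      · rintro rfl
        exact h2 (by simp [hy])
    · exact ih h1 a ha' y hy

lemma IP_suffix {l : List V} : ∀ {p : List V}, IP G (p ++ l) → IP G l := by
  intro p
  induction p with
  | nil => simp
  | cons b p ih => intro h; exact ih h.1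

lemma IP_rch {x : V} {t : List V} : ∀ {p : List V}, IP G (p ++ x :: t) →
    ∀ z, (p ++ x :: t).head? = some z → Rch G p.toFinset x z := by
  intro p
  induction p with
  | nil =>
    intro _ z hz
    simp only [List.nil_append, List.head?_cons, Option.some.injEq] at hz
    subst hz
    exact Relation.ReflTransGen.refl
  | cons b p ih =>
    intro h z hz
    simp only [List.cons_append, List.head?_cons, Option.some.injEq] at hz
    subst hz
    obtain ⟨h1, h2, h3⟩ := h
    obtain ⟨w, hw⟩ : ∃ w, (p ++ x :: t).head? = some w := by
      cases p <;> simp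
    have hr := ih h1 w hw
    have hwm : w ∈ p ++ x :: t := List.mem_of_mem_head? hw
    refine (hr.mono (by intro a; simp; tauto)).tail ⟨((h3 w hwm).2 hw).symm, by simp⟩

lemma IP_embed {l : List V} (h : IP G l) {k : ℕ} (hk : k ≤ l.length) :
    Nonempty (SimpleGraph.pathGraph k ↪g G) := by
  have key : ∀ l : List V, IP G l → ∀ i j (hi : i < l.length) (hj : j < l.length), i < j →
      l[i] ≠ l[j] ∧ (G.Adj l[i] l[j] ↔ i + 1 = j) := by
    intro l
    induction l with
    | nil => intro _ i j hi; simp at hi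
    | cons a l ih =>
      intro h i j hi hj hij
      obtain ⟨h1, h2, h3⟩ := h
      obtain ⟨j, rfl⟩ : ∃ j', j = j' + 1 := ⟨j - 1, by omega⟩
      have hj' : j < l.length := by simpa using hj
      cases i with
      | zero =>
        simp only [List.getElem_cons_zero, List.getElem_cons_succ]
        refine ⟨fun h => h2 (h ▸ List.getElem_mem hj'), ?_⟩
        rw [h3 _ (List.getElem_mem hj')]
        have hl : 0 < l.length := by omega
        rw [List.head?_eq_getElem?, List.getElem?_eq_getElem hl]
        constructor
        · intro h
          by_contra hne
          have hj0 : 0 < j := by omega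
          exact (ih h1 0 j hl hj' hj0).1 (by simpa using h)
        · intro h
          have : j = 0 := by omega
          subst this; rfl
      | succ i =>
        simp only [List.getElem_cons_succ]
        have hi' : i < l.length := by simpa using hi
        have := ih h1 i j hi' hj' (by omega)
        refine ⟨this.1, this.2.trans (by omega)⟩
  have hkey := key l h
  have hinj : Function.Injective (fun i : Fin k => l[i.1]'(by have := i.2; omega)) := by
    intro i j hij
    by_contra hne
    have hne' : i.1 ≠ j.1 := fun h => hne (Fin.ext h)
    rcases lt_or_gt_of_ne hne' with h | h
    · exact (hkey i j (by have := i.2; omega) (by have := j.2; omega) h).1 hij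
    · exact (hkey j i (by have := j.2; omega) (by have := i.2; omega) h).1 hij.symm
  refine ⟨⟨⟨fun i : Fin k => l[i.1]'(by have := i.2; omega), hinj⟩, ?_⟩⟩
  intro i j
  change G.Adj (l[i.1]'(by have := i.2; omega)) (l[j.1]'(by have := j.2; omega)) ↔ _
  rw [SimpleGraph.pathGraph_adj]
  rcases lt_trichotomy i.1 j.1 with h | h | h
  · rw [(hkey i j (by have := i.2; omega) (by have := j.2; omega) h).2]; omega
  · have : i = j := Fin.ext h
    subst this
    simp
  · rw [G.adj_comm, (hkey j i (by have := j.2; omega) (by have := i.2; omega) h).2]; omega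

end Basics

section Ext
open Classical
variable {V : Type} {G : SimpleGraph V}

lemma greedy (κ : ℕ) (Fr : Finset ℕ) (F : V → Finset ℕ) (T : Finset V)
    (hF : ∀ v ∈ T, (F v).card ≤ κ) (hT : T.card + κ ≤ Fr.card) :
    ∃ t : V → ℕ, (∀ v ∈ T, t v ∈ Fr ∧ t v ∉ F v) ∧ Set.InjOn t T := by
  induction T using Finset.induction_on with
  | empty => exact ⟨fun _ => 0, by simp, by simp⟩
  | insert a T ha ih =>
    rw [Finset.card_insert_of_notMem ha] at hT
    obtain ⟨t, ht, hinj⟩ := ih (fun v hv => hF v (Finset.mem_insert_of_mem hv)) (by omega)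
    have : ((F a) ∪ T.image t).card < Fr.card := by
      have h1 := Finset.card_union_le (F a) (T.image t)
      have h2 : (T.image t).card ≤ T.card := Finset.card_image_le
      have h3 := hF a (Finset.mem_insert_self _ _)
      omega
    obtain ⟨x, hx, hx'⟩ := Finset.exists_mem_notMem_of_card_lt_card this
    simp only [Finset.mem_union, Finset.mem_image, not_or, not_exists, not_and] at hx'
    have hne : ∀ v ∈ T, v ≠ a := fun v hv h => ha (h ▸ hv)
    refine ⟨Function.update t a x, ?_, ?_⟩
    · intro v hv
      rcases Finset.mem_insert.1 hv with rfl | hv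
      · simpa using ⟨hx, hx'.1⟩
      · rw [Function.update_of_ne (hne v hv)]; exact ht v hv
    · intro u hu v hv huv
      rcases Finset.mem_insert.1 (Finset.mem_coe.1 hu) with rfl | hu' <;>
        rcases Finset.mem_insert.1 (Finset.mem_coe.1 hv) with rfl | hv'
      · rfl
      · rw [Function.update_self, Function.update_of_ne (hne v hv')] at huv
        exact absurd huv.symm (hx'.2 v hv')
      · rw [Function.update_self, Function.update_of_ne (hne u hu')] at huv
        exact absurd huv (hx'.2 u hu')
      · rw [Function.update_of_ne (hne v hv'), Function.update_of_ne (hne u hu')] at huv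
        exact hinj hu' hv' huv

/-- Shifted assignments of colour classes to colours: some shift has few conflicts. -/
lemma shift (X : Finset V) (m : ℕ) (hm : 1 ≤ m) (e : ℕ → ℕ)
    (he : ∀ i < m, ∀ j < m, e i = e j → i = j) (h : V → ℕ) (F : V → Finset ℕ) :
    ∃ a, m * (X.filter (fun v => e ((h v + a) % m) ∈ F v)).card ≤ ∑ v ∈ X, (F v).card := by
  by_contra hcon
  push Not at hcon
  have h1 : ∑ a ∈ Finset.range m, (X.filter (fun v => e ((h v + a) % m) ∈ F v)).card
      ≤ ∑ v ∈ X, (F v).card := by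
    simp_rw [Finset.card_filter]
    rw [Finset.sum_comm]
    refine Finset.sum_le_sum fun v _ => ?_
    rw [← Finset.card_filter]
    refine Finset.card_le_card_of_injOn (fun a => e ((h v + a) % m)) ?_ ?_
    · intro a ha
      simpa using (Finset.mem_filter.1 (Finset.mem_coe.1 ha)).2
    · intro a ha b hb hab
      have ha' : a < m := by
        simpa using (Finset.mem_filter.1 (Finset.mem_coe.1 ha)).1
      have hb' : b < m := by
        simpa using (Finset.mem_filter.1 (Finset.mem_coe.1 hb)).1
      have := he _ (Nat.mod_lt _ hm) _ (Nat.mod_lt _ hm) hab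
      have h2 : a ≡ b [MOD m] := Nat.ModEq.add_left_cancel' (h v) this
      exact Nat.ModEq.eq_of_lt_of_lt h2 ha' hb'
  have h2 : ∑ a ∈ Finset.range m, (∑ v ∈ X, (F v).card) <
      ∑ a ∈ Finset.range m, m * (X.filter (fun v => e ((h v + a) % m) ∈ F v)).card :=
    Finset.sum_lt_sum_of_nonempty (Finset.nonempty_range_iff.2 (by omega)) fun a _ => hcon a
  rw [← Finset.mul_sum, Finset.sum_const, Finset.card_range, smul_eq_mul] at h2
  have := Nat.lt_of_mul_lt_mul_left h2
  omega

lemma list_col (κ c : ℕ) (hκ : 1 ≤ κ) (W S : Finset V) (f : V → ℕ) (F : V → Finset ℕ)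
    (hf : ∀ u ∈ S, f u < c + 3 * κ)
    (hfp : ∀ u ∈ S, ∀ v ∈ S, G.Adj u v → f u ≠ f v)
    (hF : ∀ v ∈ W \ S, (F v).card ≤ κ)
    (hw : κ * S.card + ∑ v ∈ W \ S, (F v).card ≤ κ * (2 * κ)) (hcol : Col G W c) :
    ∃ g : V → ℕ, (∀ v ∈ W, g v < c + 3 * κ) ∧
      (∀ u ∈ W, ∀ v ∈ W, G.Adj u v → g u ≠ g v) ∧ (∀ u ∈ S, g u = f u) ∧
      ∀ v ∈ W \ S, g v ∉ F v := by
  obtain ⟨h, hc, hp⟩ := hcol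
  set Γ := Finset.range (c + 3 * κ) \ S.image f with hΓ
  have hS : S.card ≤ 2 * κ := by
    have : κ * S.card ≤ κ * (2 * κ) := by omega
    exact Nat.le_of_mul_le_mul_left this hκ
  set m := Γ.card with hmdef
  have hm : c + 3 * κ ≤ m + S.card := by
    have h1 : (Finset.range (c + 3 * κ)).card - (S.image f).card ≤ Γ.card :=
      Finset.le_card_sdiff _ _
    have h2 : (S.image f).card ≤ S.card := Finset.card_image_le
    rw [Finset.card_range] at h1
    omega
  let e : ℕ → ℕ := fun i => if hi : i < m then Γ.orderEmbOfFin rfl ⟨i, hi⟩ else 0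
  have heΓ : ∀ i < m, e i ∈ Γ := by
    intro i hi
    simp only [e, hi, dif_pos]
    exact Finset.orderEmbOfFin_mem _ _ _
  have he : ∀ i < m, ∀ j < m, e i = e j → i = j := by
    intro i hi j hj hij
    simp only [e, hi, hj, dif_pos] at hij
    have := (Γ.orderEmbOfFin rfl).injective hij
    simpa using this
  have hm1 : 1 ≤ m := by omega
  obtain ⟨a, ha⟩ := shift (W \ S) m hm1 e he h F
  set T := (W \ S).filter (fun v => e ((h v + a) % m) ∈ F v) with hT
  have hTc : T.card + S.card ≤ 2 * κ := by
    have h1 : κ * T.card ≤ m * T.card := Nat.mul_le_mul_right _ (by omega)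
    have h2 : κ * (T.card + S.card) ≤ κ * (2 * κ) := by rw [mul_add]; omega
    exact Nat.le_of_mul_le_mul_left h2 hκ
  let π : ℕ → ℕ := fun j => e ((j + a) % m)
  have hπΓ : ∀ j, π j ∈ Γ := fun j => heΓ _ (Nat.mod_lt _ hm1)
  set Fr := Γ \ (Finset.range c).image π with hFr
  have hFrc : T.card + κ ≤ Fr.card := by
    have h1 : Γ.card - ((Finset.range c).image π).card ≤ Fr.card := Finset.le_card_sdiff _ _
    have h2 : ((Finset.range c).image π).card ≤ (Finset.range c).card := Finset.card_image_le
    rw [Finset.card_range] at h2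
    omega
  obtain ⟨t, ht, htinj⟩ := greedy κ Fr F T
    (fun v hv => hF v (Finset.mem_filter.1 hv).1) hFrc
  have hπinj : ∀ i < c, ∀ j < c, π i = π j → i = j := by
    intro i hi j hj hij
    have := he _ (Nat.mod_lt _ hm1) _ (Nat.mod_lt _ hm1) hij
    have h2 : i ≡ j [MOD m] := Nat.ModEq.add_right_cancel' a this
    exact Nat.ModEq.eq_of_lt_of_lt h2 (by omega) (by omega)
  have hΓlt : ∀ x ∈ Γ, x < c + 3 * κ := fun x hx => by
    simpa using (Finset.mem_sdiff.1 hx).1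
  have hΓS : ∀ x ∈ Γ, ∀ u ∈ S, f u ≠ x := fun x hx u hu h =>
    (Finset.mem_sdiff.1 hx).2 (Finset.mem_image.2 ⟨u, hu, h⟩)
  let g : V → ℕ := fun v => if v ∈ S then f v else if v ∈ T then t v else π (h v)
  have gS : ∀ v ∈ S, g v = f v := fun v hv => by simp [g, hv]
  have gT : ∀ v, v ∉ S → v ∈ T → g v = t v := fun v hv hv' => by simp [g, hv, hv']
  have gN : ∀ v, v ∉ S → v ∉ T → g v = π (h v) := fun v hv hv' => by simp [g, hv, hv']
  have gΓ : ∀ v, v ∉ S → g v ∈ Γ := by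
    intro v hv
    by_cases hvT : v ∈ T
    · rw [gT v hv hvT]; exact (Finset.mem_sdiff.1 (ht v hvT).1).1
    · rw [gN v hv hvT]; exact hπΓ _
  have hFrπ : ∀ x ∈ Fr, ∀ j < c, π j ≠ x := fun x hx j hj h =>
    (Finset.mem_sdiff.1 hx).2 (Finset.mem_image.2 ⟨j, by simpa using hj, h⟩)
  refine ⟨g, ?_, ?_, gS, ?_⟩
  · intro v hv
    by_cases hvS : v ∈ S
    · rw [gS v hvS]; exact hf v hvS
    · exact hΓlt _ (gΓ v hvS)
  · intro u hu v hv huv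
    by_cases huS : u ∈ S <;> by_cases hvS : v ∈ S
    · rw [gS u huS, gS v hvS]; exact hfp u huS v hvS huv
    · rw [gS u huS]; exact hΓS _ (gΓ v hvS) u huS
    · rw [gS v hvS]; exact (hΓS _ (gΓ u huS) v hvS).symm
    · by_cases huT : u ∈ T <;> by_cases hvT : v ∈ T
      · rw [gT u huS huT, gT v hvS hvT]
        intro h
        exact G.ne_of_adj huv (htinj huT hvT h)
      · rw [gT u huS huT, gN v hvS hvT]
        exact (hFrπ _ (ht u huT).1 _ (hc v hv)).symm
      · rw [gN u huS huT, gT v hvS hvT]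
        exact hFrπ _ (ht v hvT).1 _ (hc u hu)
      · rw [gN u huS huT, gN v hvS hvT]
        intro h
        exact hp u hu v hv huv (hπinj _ (hc u hu) _ (hc v hv) h)
  · intro v hv
    have hvS := (Finset.mem_sdiff.1 hv).2
    by_cases hvT : v ∈ T
    · rw [gT v hvS hvT]; exact (ht v hvT).2
    · rw [gN v hvS hvT]
      intro h
      exact hvT (Finset.mem_filter.2 ⟨hv, h⟩)

/-- A separation of `W`: light side `D2`, other side `D1`, separator `Q`. -/
lemma split_of_not_KC {κ : ℕ} {W : Finset V} (h : ¬ KC G κ W) (w : V → ℕ) (M : ℕ)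
    (hw : ∑ v ∈ W, w v ≤ 2 * M) :
    ∃ Q D1 D2 : Finset V, Q ⊆ W ∧ Q.card ≤ κ ∧ D1.Nonempty ∧ D2.Nonempty ∧ W = Q ∪ D1 ∪ D2 ∧
      Disjoint Q D1 ∧ Disjoint Q D2 ∧ Disjoint D1 D2 ∧ (∀ a ∈ D1, ∀ b ∈ D2, ¬ G.Adj a b) ∧
      ∑ v ∈ D2, w v ≤ M := by
  unfold KC at h
  push Not at h
  obtain ⟨Q, hQ, a, ha, b, hb, hab⟩ := h
  set D := (W \ Q).filter (fun v => Rch G (W \ Q) a v) with hD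
  set E := (W \ Q).filter (fun v => ¬ Rch G (W \ Q) a v) with hE
  have hDE : ∀ x ∈ D, ∀ y ∈ E, ¬ G.Adj x y := by
    intro x hx y hy hxy
    rw [hD, Finset.mem_filter] at hx
    rw [hE, Finset.mem_filter] at hy
    exact hy.2 (hx.2.tail ⟨hxy, hy.1⟩)
  have haD : a ∈ D := Finset.mem_filter.2 ⟨ha, Relation.ReflTransGen.refl⟩
  have hbE : b ∈ E := Finset.mem_filter.2 ⟨hb, hab⟩
  have hdisj : Disjoint D E := Finset.disjoint_filter_filter_not _ _ _
  have hun : D ∪ E = W \ Q := Finset.filter_union_filter_not_eq _ _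
  have hsum : ∑ v ∈ D, w v + ∑ v ∈ E, w v ≤ 2 * M := by
    rw [← Finset.sum_union hdisj, hun]
    exact le_trans (Finset.sum_le_sum_of_subset Finset.sdiff_subset) hw
  have hWun : W = (W ∩ Q) ∪ D ∪ E := by
    rw [Finset.union_assoc, hun]
    ext x; simp; tauto
  have hQD : Disjoint (W ∩ Q) D := by
    rw [Finset.disjoint_left]; intro x hx hx'
    simp [hD] at hx hx'; tauto
  have hQE : Disjoint (W ∩ Q) E := by
    rw [Finset.disjoint_left]; intro x hx hx'
    simp [hE] at hx hx'; tauto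
  have hQc : (W ∩ Q).card ≤ κ := le_trans (Finset.card_le_card Finset.inter_subset_right) hQ
  by_cases hlt : ∑ v ∈ E, w v ≤ M
  · exact ⟨W ∩ Q, D, E, Finset.inter_subset_left, hQc, ⟨a, haD⟩, ⟨b, hbE⟩, hWun, hQD, hQE, hdisj,
      hDE, hlt⟩
  · refine ⟨W ∩ Q, E, D, Finset.inter_subset_left, hQc, ⟨b, hbE⟩, ⟨a, haD⟩, ?_, hQE, hQD,
      hdisj.symm, fun x hx y hy h => hDE y hy x hx h.symm, by omega⟩
    rw [Finset.union_assoc, Finset.union_comm E D, ← Finset.union_assoc]; exact hWun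

end Ext

section Ext2
open Classical
variable {V : Type} {G : SimpleGraph V}

/-- Weight of a vertex in a partial precolouring. -/
noncomputable def wt (κ : ℕ) (S : Finset V) (F : V → Finset ℕ) (v : V) : ℕ :=
  if v ∈ S then κ else (F v).card

lemma wsum (κ : ℕ) {W S : Finset V} (F : V → Finset ℕ) (h : S ⊆ W) :
    ∑ v ∈ W, wt κ S F v = κ * S.card + ∑ v ∈ W \ S, (F v).card := by
  rw [← Finset.sum_sdiff h, add_comm]
  congr 1
  · rw [Finset.sum_congr rfl (g := fun _ => κ) (fun v hv => by simp [wt, hv])]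
    simp [mul_comm]
  · exact Finset.sum_congr rfl (fun v hv => by simp [wt, (Finset.mem_sdiff.1 hv).2])

variable (G) in
/-- The precolouring `f` on `S` with forbidden sets `F` extends to `W`. -/
def Extends (C : ℕ) (W S : Finset V) (f : V → ℕ) (F : V → Finset ℕ) : Prop :=
  ∃ g : V → ℕ, (∀ v ∈ W, g v < C) ∧
      (∀ u ∈ W, ∀ v ∈ W, G.Adj u v → g u ≠ g v) ∧ (∀ u ∈ S, g u = f u) ∧
      ∀ v ∈ W \ S, g v ∉ F v

variable (G) in
/-- Valid configurations. -/
structure Valid (κ c : ℕ) (W S : Finset V) (f : V → ℕ) (F : V → Finset ℕ) : Prop where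
  sub : S ⊆ W
  lt : ∀ u ∈ S, f u < c + 3 * κ
  proper : ∀ u ∈ S, ∀ v ∈ S, G.Adj u v → f u ≠ f v
  card : ∀ v ∈ W \ S, (F v).card ≤ κ
  weight : ∑ v ∈ W, wt κ S F v ≤ κ * (2 * κ)

set_option maxHeartbeats 4000000 in
lemma ext_lemma (κ c : ℕ) (hκ : 1 ≤ κ) (W0 : Finset V)
    (H : ∀ W ⊆ W0, KC G κ W → Col G W c) :
    ∀ n, ∀ (W S : Finset V) (f : V → ℕ) (F : V → Finset ℕ), W ⊆ W0 →
      W.card + (W \ S).card = n → Valid G κ c W S f F → Extends G (c + 3 * κ) W S f F := by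
  intro n
  induction n using Nat.strong_induction_on with
  | _ n ih =>
  intro W S f F hW hn hv
  have hSW := hv.sub
  have hwt := hv.weight
  -- Step 1
  by_cases h1 : ∃ v ∈ W \ S, (F v).card = κ
  · obtain ⟨v, hvW, hvF⟩ := h1
    have hvS := (Finset.mem_sdiff.1 hvW).2
    have hvW' := (Finset.mem_sdiff.1 hvW).1
    have hScard : S.card + 1 ≤ 2 * κ := by
      rw [wsum κ F hSW] at hwt
      have : (F v).card ≤ ∑ v ∈ W \ S, (F v).card :=
        Finset.single_le_sum (f := fun v => (F v).card) (fun _ _ => Nat.zero_le _) hvW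
      have h3 : κ * (S.card + 1) ≤ κ * (2 * κ) := by rw [mul_add, mul_one]; omega
      exact Nat.le_of_mul_le_mul_left h3 hκ
    have hcard : (F v ∪ S.image f).card < (Finset.range (c + 3 * κ)).card := by
      have h1 := Finset.card_union_le (F v) (S.image f)
      have h2 : (S.image f).card ≤ S.card := Finset.card_image_le
      rw [Finset.card_range]
      omega
    obtain ⟨x, hx, hx'⟩ := Finset.exists_mem_notMem_of_card_lt_card hcard
    simp only [Finset.mem_union, Finset.mem_image, not_or, not_exists, not_and] at hx'
    have hne : ∀ u ∈ S, u ≠ v := fun u hu h => hvS (h ▸ hu)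
    have hfS : ∀ u ∈ S, Function.update f v x u = f u := fun u hu =>
      Function.update_of_ne (hne u hu) _ _
    have hlt : (W \ insert v S).card < (W \ S).card := by
      apply Finset.card_lt_card
      rw [Finset.ssubset_iff_of_subset (Finset.sdiff_subset_sdiff le_rfl (Finset.subset_insert _ _))]
      exact ⟨v, hvW, by simp⟩
    have hval : Valid G κ c W (insert v S) (Function.update f v x) F := by
      refine ⟨Finset.insert_subset hvW' hSW, ?_, ?_, ?_, ?_⟩
      · intro u hu
        rcases Finset.mem_insert.1 hu with rfl | hu
        · simpa using hx
        · rw [hfS u hu]; exact hv.lt u hu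
      · intro u hu w hw huw
        by_cases huv : u = v <;> by_cases hwv : w = v
        · rw [huv, hwv] at huw; exact absurd huw G.irrefl
        · have hw1 := Finset.mem_of_mem_insert_of_ne hw hwv
          rw [hfS w hw1, huv, Function.update_self]; exact fun h => hx'.2 w hw1 h.symm
        · have hu1 := Finset.mem_of_mem_insert_of_ne hu huv
          rw [hfS u hu1, hwv, Function.update_self]; exact fun h => hx'.2 u hu1 h
        · have hw1 := Finset.mem_of_mem_insert_of_ne hw hwv
          have hu1 := Finset.mem_of_mem_insert_of_ne hu huv
          rw [hfS u hu1, hfS w hw1]; exact hv.proper u hu1 w hw1 huw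
      · intro u hu
        exact hv.card u (Finset.sdiff_subset_sdiff le_rfl (Finset.subset_insert _ _) hu)
      · refine le_trans (Finset.sum_le_sum fun u _ => ?_) hwt
        unfold wt
        by_cases huv : u = v
        · subst huv; simp [hvS, hvF]
        · simp [huv]
    obtain ⟨g, g1, g2, g3, g4⟩ := ih _ (by omega) W (insert v S) _ F hW rfl hval
    refine ⟨g, g1, g2, ?_, ?_⟩
    · intro u hu
      rw [g3 u (Finset.mem_insert_of_mem hu), hfS u hu]
    · intro u hu
      by_cases huv : u = v
      · subst huv
        rw [g3 u (Finset.mem_insert_self _ _), Function.update_self]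
        exact hx'.1
      · exact g4 u (by simp at hu ⊢; tauto)
  push Not at h1
  have hFlt : ∀ v ∈ W \ S, (F v).card < κ := fun v hvv =>
    lt_of_le_of_ne (hv.card v hvv) (h1 v hvv)
  -- Step 2
  by_cases h2 : ∃ u ∈ S, ((W \ S).filter (fun v => G.Adj u v)).card ≤ κ
  · obtain ⟨u, huS, hdeg⟩ := h2
    have hsd : W.erase u \ S.erase u = W \ S := by
      ext x; simp only [Finset.mem_sdiff, Finset.mem_erase]
      constructor
      · rintro ⟨⟨h1, h2⟩, h3⟩; exact ⟨h2, fun h => h3 ⟨h1, h⟩⟩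
      · rintro ⟨h1, h2⟩; exact ⟨⟨fun h => h2 (h ▸ huS), h1⟩, fun h => h2 h.2⟩
    let F' : V → Finset ℕ := fun v => if G.Adj u v then insert (f u) (F v) else F v
    have hF' : ∀ v, (F' v).card ≤ (F v).card + if G.Adj u v then 1 else 0 := by
      intro v
      by_cases h : G.Adj u v
      · simp only [F', h, if_true]; exact Finset.card_insert_le _ _
      · simp [F', h]
    have hce := Finset.card_erase_of_mem huS
    have hpos : 0 < S.card := Finset.card_pos.2 ⟨u, huS⟩
    have hSW' : S.erase u ⊆ W.erase u := Finset.erase_subset_erase _ hSW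
    have hval : Valid G κ c (W.erase u) (S.erase u) f F' := by
      refine ⟨hSW', ?_, ?_, ?_, ?_⟩
      · intro w hw; exact hv.lt w (Finset.mem_of_mem_erase hw)
      · intro w hw w' hw'
        exact hv.proper w (Finset.mem_of_mem_erase hw) w' (Finset.mem_of_mem_erase hw')
      · intro w hw
        rw [hsd] at hw
        have := hFlt w hw
        have h3 := hF' w
        split_ifs at h3 <;> omega
      · rw [wsum κ F' hSW', hsd]
        rw [wsum κ F hSW] at hwt
        have h3 : ∑ v ∈ W \ S, (F' v).card ≤
            ∑ v ∈ W \ S, (F v).card + ((W \ S).filter (fun v => G.Adj u v)).card := by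
          rw [Finset.card_filter, ← Finset.sum_add_distrib]
          exact Finset.sum_le_sum fun v _ => hF' v
        have h4 : κ * S.card = κ * (S.erase u).card + κ := by
          rw [← Nat.mul_succ, hce]; congr 1; omega
        omega
    have huW := hSW huS
    have hcW := Finset.card_erase_of_mem huW
    have hposW : 0 < W.card := Finset.card_pos.2 ⟨u, huW⟩
    obtain ⟨g, g1, g2, g3, g4⟩ := ih _ (by rw [hsd]; omega) (W.erase u) (S.erase u) f F'
      (fun x hx => hW (Finset.mem_of_mem_erase hx)) rfl hval
    have hgu : ∀ v ∈ W, G.Adj u v → g v ≠ f u := by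
      intro v hvW huv
      have hvu : v ≠ u := (G.ne_of_adj huv).symm
      by_cases hvS : v ∈ S
      · rw [g3 v (Finset.mem_erase.2 ⟨hvu, hvS⟩)]
        exact (hv.proper u huS v hvS huv).symm
      · have := g4 v (by rw [hsd]; exact Finset.mem_sdiff.2 ⟨hvW, hvS⟩)
        simp only [F', huv, if_true, Finset.mem_insert, not_or] at this
        exact this.1
    have gu : ∀ v, v ≠ u → Function.update g u (f u) v = g v := fun v hvu =>
      Function.update_of_ne hvu _ _
    refine ⟨Function.update g u (f u), ?_, ?_, ?_, ?_⟩
    · intro v hvW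
      by_cases hvu : v = u
      · subst hvu; simpa using hv.lt v huS
      · rw [gu v hvu]; exact g1 v (Finset.mem_erase.2 ⟨hvu, hvW⟩)
    · intro a ha b hb hab
      by_cases hau : a = u <;> by_cases hbu : b = u
      · subst hau; subst hbu; exact absurd hab G.irrefl
      · rw [gu b hbu, hau, Function.update_self]
        exact (hgu b hb (hau ▸ hab)).symm
      · rw [gu a hau, hbu, Function.update_self]
        exact hgu a ha (hbu ▸ hab.symm)
      · rw [gu a hau, gu b hbu]
        exact g2 a (Finset.mem_erase.2 ⟨hau, ha⟩) b (Finset.mem_erase.2 ⟨hbu, hb⟩) hab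
    · intro a ha
      by_cases hau : a = u
      · subst hau; simp
      · rw [gu a hau]; exact g3 a (Finset.mem_erase.2 ⟨hau, ha⟩)
    · intro a ha
      have hau : a ≠ u := fun h => (Finset.mem_sdiff.1 ha).2 (h ▸ huS)
      rw [gu a hau]
      have := g4 a (by rw [hsd]; exact ha)
      simp only [F'] at this
      split_ifs at this with h
      · exact fun h' => this (Finset.mem_insert_of_mem h')
      · exact this
  push Not at h2
  -- Step 4
  by_cases h3 : KC G κ W
  · have := wsum κ F hSW
    exact list_col κ c hκ W S f F hv.lt hv.proper hv.card (by omega) (H W hW h3)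
  -- Step 3
  obtain ⟨Q, D1, D2, hQW, hQc, hD1, hD2, hWe, hQD1, hQD2, hDD, hno, hlight⟩ :=
    split_of_not_KC h3 (wt κ S F) (κ * κ) (le_trans hwt (by nlinarith))
  have mW : ∀ x, x ∈ W ↔ x ∈ Q ∨ x ∈ D1 ∨ x ∈ D2 := by
    intro x; rw [hWe]; simp [or_assoc]
  rw [Finset.disjoint_left] at hQD1 hQD2 hDD
  have hD2S : ∃ b ∈ D2, b ∉ S := by
    by_contra hcon
    push Not at hcon
    obtain ⟨b, hb⟩ := hD2
    have h4 := h2 b (hcon b hb)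
    have h5 : (W \ S).filter (fun v => G.Adj b v) ⊆ Q := by
      intro x hx
      simp only [Finset.mem_filter, Finset.mem_sdiff] at hx
      rcases (mW x).1 hx.1.1 with h | h | h
      · exact h
      · exact absurd hx.2.symm (hno x h b hb)
      · exact absurd (hcon x h) hx.1.2
    have := Finset.card_le_card h5
    omega
  obtain ⟨b, hbD, hbS⟩ := hD2S
  obtain ⟨a, haD⟩ := hD1
  -- colour the first part
  set W1 := W \ (D2 \ S) with hW1
  have hW1W : W1 ⊆ W := Finset.sdiff_subset
  have hSW1 : S ⊆ W1 := by
    intro x hx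
    simp [hW1, hSW hx, hx]
  have hc1 : W1.card < W.card := by
    apply Finset.card_lt_card
    rw [Finset.ssubset_iff_of_subset hW1W]
    exact ⟨b, (mW b).2 (Or.inr (Or.inr hbD)), by simp [hW1, hbD, hbS]⟩
  have hc1' : (W1 \ S).card ≤ (W \ S).card :=
    Finset.card_le_card (Finset.sdiff_subset_sdiff hW1W le_rfl)
  have hval1 : Valid G κ c W1 S f F := by
    refine ⟨hSW1, hv.lt, hv.proper, ?_, ?_⟩
    · intro x hx
      exact hv.card x (Finset.sdiff_subset_sdiff hW1W le_rfl hx)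
    · exact le_trans (Finset.sum_le_sum_of_subset hW1W) hwt
  obtain ⟨g, g1, g2, g3, g4⟩ := ih _ (by omega) W1 S f F (hW1W.trans hW) rfl hval1
  -- colour the second part
  set W2 := Q ∪ D2 with hW2
  set S2 := Q ∪ (S ∩ D2) with hS2
  have mW1 : ∀ x, x ∈ W1 ↔ x ∈ Q ∨ x ∈ D1 ∨ (x ∈ D2 ∧ x ∈ S) := by
    intro x
    rw [hW1, Finset.mem_sdiff, mW, Finset.mem_sdiff]
    constructor
    · rintro ⟨h | h | h, h'⟩
      · exact Or.inl h
      · exact Or.inr (Or.inl h)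
      · exact Or.inr (Or.inr ⟨h, by_contra fun hh => h' ⟨h, hh⟩⟩)
    · rintro (h | h | h)
      · exact ⟨Or.inl h, fun h' => hQD2 h h'.1⟩
      · exact ⟨Or.inr (Or.inl h), fun h' => hDD h h'.1⟩
      · exact ⟨Or.inr (Or.inr h.1), fun h' => h'.2 h.2⟩
  have hS2W1 : ∀ x ∈ S2, x ∈ W1 := by
    intro x hx
    rw [mW1]
    simp only [hS2, Finset.mem_union, Finset.mem_inter] at hx
    tauto
  have hW2W : W2 ⊆ W := by
    intro x hx
    rw [mW]
    simp only [hW2, Finset.mem_union] at hx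
    tauto
  have hc2 : W2.card < W.card := by
    apply Finset.card_lt_card
    rw [Finset.ssubset_iff_of_subset hW2W]
    refine ⟨a, (mW a).2 (Or.inr (Or.inl haD)), ?_⟩
    simp only [hW2, Finset.mem_union, not_or]
    exact ⟨fun h => hQD1 h haD, hDD haD⟩
  have hsd2 : ∀ x ∈ W2 \ S2, x ∈ D2 ∧ x ∉ S ∧ x ∈ W \ S := by
    intro x hx
    have hxW := hW2W (Finset.mem_sdiff.1 hx).1
    simp only [hW2, hS2, Finset.mem_sdiff, Finset.mem_union, Finset.mem_inter] at hx ⊢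
    tauto
  have hc2' : (W2 \ S2).card ≤ (W \ S).card :=
    Finset.card_le_card fun x hx => (hsd2 x hx).2.2
  have hval2 : Valid G κ c W2 S2 g F := by
    refine ⟨?_, fun u hu => g1 u (hS2W1 u hu),
      fun u hu v hv => g2 u (hS2W1 u hu) v (hS2W1 v hv), ?_, ?_⟩
    · intro x hx
      simp only [hW2, hS2, Finset.mem_union, Finset.mem_inter] at hx ⊢
      tauto
    · intro x hx; exact hv.card x (hsd2 x hx).2.2
    · rw [hW2, Finset.sum_union (Finset.disjoint_left.2 hQD2)]
      have e1 : ∑ x ∈ Q, wt κ S2 F x = κ * Q.card := by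
        rw [Finset.sum_congr rfl (g := fun _ => κ) (fun v hv => by simp [wt, hS2, hv])]
        simp [mul_comm]
      have e2 : ∑ x ∈ D2, wt κ S2 F x = ∑ x ∈ D2, wt κ S F x := by
        refine Finset.sum_congr rfl fun x hx => ?_
        have hxQ : x ∉ Q := fun h => hQD2 h hx
        simp [wt, hS2, hx, hxQ]
      rw [e1, e2]
      have : κ * Q.card ≤ κ * κ := Nat.mul_le_mul_left _ hQc
      have e3 : κ * (2 * κ) = κ * κ + κ * κ := by ring
      omega
  obtain ⟨k, k1, k2, k3, k4⟩ := ih _ (by omega) W2 S2 g F (hW2W.trans hW) rfl hval2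
  let φ : V → ℕ := fun v => if v ∈ D1 then g v else k v
  have φ1 : ∀ v ∈ D1, φ v = g v := fun v hv => by simp [φ, hv]
  have φ2 : ∀ v ∈ D2, φ v = k v := fun v hv => by
    have : v ∉ D1 := fun h => hDD h hv
    simp [φ, this]
  have φQ : ∀ v ∈ Q, φ v = k v := fun v hv => by simp [φ, hQD1 hv]
  have φQ' : ∀ v ∈ Q, φ v = g v := fun v hv => by
    rw [φQ v hv]; exact k3 v (by simp [hS2, hv])
  have m2 : ∀ x, x ∈ Q ∨ x ∈ D2 → x ∈ W2 := fun x hx => by simpa [hW2] using hx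
  have p2 : ∀ x, x ∈ Q ∨ x ∈ D2 → φ x = k x := fun x hx => hx.elim (φQ x) (φ2 x)
  have p1 : ∀ x, x ∈ Q ∨ x ∈ D1 → φ x = g x := fun x hx => hx.elim (φQ' x) (φ1 x)
  have m1 : ∀ x, x ∈ Q ∨ x ∈ D1 → x ∈ W1 := fun x hx => (mW1 x).2 (by tauto)
  refine ⟨φ, ?_, ?_, ?_, ?_⟩
  · intro v hvW
    rcases (mW v).1 hvW with h | h | h
    · rw [p1 v (Or.inl h)]; exact g1 v (m1 v (Or.inl h))
    · rw [p1 v (Or.inr h)]; exact g1 v (m1 v (Or.inr h))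
    · rw [p2 v (Or.inr h)]; exact k1 v (m2 v (Or.inr h))
  · intro u hu v hvW huv
    have hcase : ((u ∈ Q ∨ u ∈ D1) ∧ (v ∈ Q ∨ v ∈ D1)) ∨ ((u ∈ Q ∨ u ∈ D2) ∧ (v ∈ Q ∨ v ∈ D2)) := by
      have n1 : ¬ (u ∈ D1 ∧ v ∈ D2) := fun h => hno u h.1 v h.2 huv
      have n2 : ¬ (v ∈ D1 ∧ u ∈ D2) := fun h => hno v h.1 u h.2 huv.symm
      have := (mW u).1 hu
      have := (mW v).1 hvW
      tauto
    rcases hcase with ⟨h, h'⟩ | ⟨h, h'⟩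
    · rw [p1 u h, p1 v h']; exact g2 u (m1 u h) v (m1 v h') huv
    · rw [p2 u h, p2 v h']; exact k2 u (m2 u h) v (m2 v h') huv
  · intro u hu
    rcases (mW u).1 (hSW hu) with h | h | h
    · rw [p1 u (Or.inl h)]; exact g3 u hu
    · rw [p1 u (Or.inr h)]; exact g3 u hu
    · rw [p2 u (Or.inr h), k3 u (by simp [hS2, hu, h])]; exact g3 u hu
  · intro u hu
    have huS := (Finset.mem_sdiff.1 hu).2
    rcases (mW u).1 (Finset.mem_sdiff.1 hu).1 with h | h | h
    · rw [p1 u (Or.inl h)]; exact g4 u (Finset.mem_sdiff.2 ⟨m1 u (Or.inl h), huS⟩)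
    · rw [p1 u (Or.inr h)]; exact g4 u (Finset.mem_sdiff.2 ⟨m1 u (Or.inr h), huS⟩)
    · rw [p2 u (Or.inr h)]
      refine k4 u (Finset.mem_sdiff.2 ⟨m2 u (Or.inr h), ?_⟩)
      have hxQ : u ∉ Q := fun h' => hQD2 h' h
      simp [hS2, huS, hxQ]

/-- Highly connected subgraphs of large chromatic number. -/
lemma exists_KC (κ c : ℕ) (hκ : 1 ≤ κ) (W0 : Finset V) (h : ¬ Col G W0 (c + 3 * κ)) :
    ∃ W ⊆ W0, KC G κ W ∧ ¬ Col G W c := by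
  by_contra hcon
  push Not at hcon
  obtain ⟨g, g1, g2, _, _⟩ := ext_lemma κ c hκ W0 hcon _ W0 ∅ (fun _ => 0) (fun _ => ∅)
    le_rfl rfl ⟨by simp, by simp, by simp, by simp, by simp [wt]⟩
  exact h ⟨g, g1, g2⟩

end Ext2

section Main
open Classical
variable {V : Type} [Fintype V] {G : SimpleGraph V}

variable (G) in
/-- Vertices whose non-neighbourhood in `K` is `d`-colourable. -/
noncomputable def bad (d : ℕ) (K : Finset V) : Finset V :=
  Finset.univ.filter (fun v => Col G (K.filter (fun a => ¬ G.Adj v a)) d)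

lemma mem_bad {d : ℕ} {K : Finset V} {v : V} :
    v ∈ bad G d K ↔ Col G (K.filter (fun a => ¬ G.Adj v a)) d := by
  simp [bad]

lemma le_lin {q s d : ℕ} (hs : 1 ≤ s) : d ≤ q + s * d := by nlinarith

lemma not_bad_of_anti {q s d : ℕ} {K : Finset V} (hs : 1 ≤ s) (hK : ¬ Col G K (q + s * d)) {v : V}
    (hv : ∀ a ∈ K, ¬ G.Adj v a) : v ∉ bad G d K := by
  rw [mem_bad, Finset.filter_true_of_mem hv]
  exact fun h => hK (h.mono le_rfl (le_lin hs))

lemma exists_nonmem {q s d r : ℕ} {K B : Finset V} (hs : 1 ≤ s) (hrd : r ≤ d)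
    (hK : ¬ Col G K (q + s * d)) (hB : B.card ≤ r) : ∃ a ∈ K, a ∉ B := by
  by_contra hcon
  push Not at hcon
  exact hK ((col_card B).mono hcon ((hB.trans hrd).trans (le_lin hs)))

variable (G) in
/-- The state of the path-growing argument. -/
def St (q s r i d : ℕ) (K : Finset V) : Prop :=
  KC G r K ∧ ¬ Col G K (q + s * d) ∧ ∃ (pre : List V) (x : V) (t : List V) (z : V) (L : List V),
    pre ++ x :: t = z :: L ∧ IP G (z :: L) ∧ i ≤ t.length + 1 ∧ (∀ y ∈ z :: L, y ∉ K) ∧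
    (∀ y ∈ t, ∀ a ∈ K, ¬ G.Adj y a) ∧ (∀ y ∈ L, ∀ a ∈ K, G.Adj y a → a ∈ bad G d K) ∧
    z ∉ bad G d K ∧ ∃ a ∈ K, a ∉ bad G d K ∧ G.Adj z a

lemma core {q s r d i : ℕ} {x : V} {t : List V} (hIP : IP G (x :: t)) {K : Finset V}
    (hKC : KC G r K) (hcol : ¬ Col G K (q + s * d))
    (hxK : ∀ y ∈ x :: t, y ∉ K ∧ ∀ a ∈ K, ¬ G.Adj y a) (A : Finset V)
    (hAK : ∀ a ∈ A, a ∉ K) (htA : ∀ y ∈ t, y ∉ A ∧ ∀ a ∈ A, ¬ G.Adj y a)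
    (hAB : ∀ a ∈ A, (∃ b ∈ K, G.Adj a b) → a ∉ bad G d K)
    {u v : V} (hr : Rch G A x u) (hv : v ∈ K) (hvB : v ∉ bad G d K) (huv : G.Adj u v)
    (hi : i ≤ t.length + 2) : St G q s r i d K := by
  obtain ⟨Q, hQ⟩ : ∃ Q : V → Prop, ∀ w, Q w ↔ ∃ b ∈ K, b ∉ bad G d K ∧ G.Adj w b :=
    ⟨_, fun _ => Iff.rfl⟩
  have hxQ : ¬ Q x := by
    rw [hQ]
    rintro ⟨b, hb, _, hxb⟩
    exact (hxK x (by simp)).2 b hb hxb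
  obtain ⟨u1, z, hr1, _, hadj, hzA, hzQ⟩ := first_cross Q hr hxQ ((hQ u).2 ⟨v, hv, hvB, huv⟩)
  have hzx : z ≠ x := fun h => hxQ (h ▸ hzQ)
  have hsub : ∀ a ∈ insert z (A.filter (fun w => ¬ Q w)), a ∈ A := by
    intro a ha
    rcases Finset.mem_insert.1 ha with rfl | ha
    · exact hzA
    · exact (Finset.mem_filter.1 ha).1
  have hrz : Rch G (insert z (A.filter (fun w => ¬ Q w))) x z := by
    refine Relation.ReflTransGen.tail (b := u1) (hr1.mono ?_) ⟨hadj, by simp⟩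
    intro a ha
    rw [Finset.mem_filter] at ha
    rw [Finset.mem_insert, Finset.mem_filter]
    exact Or.inr ha
  obtain ⟨p, hp, hpA⟩ := IP_ext _ (insert z (A.filter (fun w => ¬ Q w))) le_rfl x t hIP
    (fun y hy => ⟨fun h => (htA y hy).1 (hsub y h), fun a ha => (htA y hy).2 a (hsub a ha)⟩) z
    hrz hzx
  refine ⟨hKC, hcol, (z :: p).dropLast, (z :: p).getLast (by simp), x :: t, z, p ++ x :: t,
    ?_, hp, by simpa using hi, ?_, ?_, ?_, ?_, ?_⟩
  · conv_rhs => rw [← List.cons_append, ← List.dropLast_append_getLast (l := z :: p) (by simp)]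
    simp
  · intro y hy
    rw [← List.cons_append, List.mem_append] at hy
    rcases hy with hy | hy
    · exact hAK y (hsub y (hpA y hy))
    · exact (hxK y hy).1
  · intro y hy; exact (hxK y hy).2
  · intro y hy a ha hya
    rcases List.mem_append.1 hy with hy | hy
    · have hne : y ≠ z := by
        rintro rfl
        exact hp.2.1 (List.mem_append_left _ hy)
      have h1 := hpA y (List.mem_cons_of_mem _ hy)
      rcases Finset.mem_insert.1 h1 with h | h
      · exact absurd h hne
      · by_contra hcon
        exact (Finset.mem_filter.1 h).2 ((hQ y).2 ⟨a, ha, hcon, hya⟩)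
    · exact absurd hya ((hxK y hy).2 a ha)
  · obtain ⟨b, hb, _, hzb⟩ := (hQ z).1 hzQ
    exact hAB z hzA ⟨b, hb, hzb⟩
  · exact (hQ z).1 hzQ

lemma step {q s r : ℕ} (hs : 1 ≤ s) (hr : 1 ≤ r)
    (Hbad : ∀ d K, ¬ Col G K (q + s * d) → (bad G d K).card ≤ r)
    {i d d' : ℕ} (hd : d = q + s * d' + 5 * r) (hrd : r ≤ d') {K : Finset V}
    (hSt : St G q s r i d K) : ∃ K', St G q s r (i + 1) d' K' := by
  obtain ⟨hKC, hcol, pre, x, t, z, L, heq, hIP, hi, hout, htK, hL, hz, y0, hy0K, hy0B, hzy0⟩ := hSt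
  have hB := Hbad d K hcol
  have main : ∃ K' ⊆ K, KC G r K' ∧ ¬ Col G K' (q + s * d') ∧
      (∀ a ∈ K', ¬ G.Adj z a ∧ a ∉ bad G d K) ∧
      ∃ y ∈ K, y ∉ bad G d' K' ∧ G.Adj z y := by
    by_cases hc : (K.filter (fun a => G.Adj z a)).card ≤ r
    · have hW : ¬ Col G (((K.filter (fun a => ¬ G.Adj y0 a)).filter (fun a => ¬ G.Adj z a)) \
          bad G d K) (q + s * d' + 3 * r) := by
        intro h
        apply hy0B
        rw [mem_bad]
        refine ((h.union (col_card (bad G d K))).union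
          (col_card (K.filter (fun a => G.Adj z a)))).mono ?_ (by omega)
        intro a ha
        simp only [Finset.mem_union, Finset.mem_sdiff, Finset.mem_filter] at ha ⊢
        tauto
      obtain ⟨K', hK', h1, h2⟩ := exists_KC r _ hr _ hW
      have hm : ∀ a ∈ K', (a ∈ K ∧ ¬ G.Adj y0 a) ∧ ¬ G.Adj z a ∧ a ∉ bad G d K := by
        intro a ha
        have := hK' ha
        simp only [Finset.mem_sdiff, Finset.mem_filter] at this
        tauto
      exact ⟨K', fun a ha => (hm a ha).1.1, h1, h2, fun a ha => (hm a ha).2, y0, hy0K,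
        not_bad_of_anti hs h2 (fun a ha => (hm a ha).1.2), hzy0⟩
    · have hW : ¬ Col G ((K.filter (fun a => ¬ G.Adj z a)) \ bad G d K) (q + s * d' + 3 * r) := by
        intro h
        apply hz
        rw [mem_bad]
        refine (h.union (col_card (bad G d K))).mono ?_ (by omega)
        intro a ha
        simp only [Finset.mem_union, Finset.mem_sdiff] at ha ⊢
        tauto
      obtain ⟨K', hK', h1, h2⟩ := exists_KC r _ hr _ hW
      have hm : ∀ a ∈ K', a ∈ K ∧ ¬ G.Adj z a ∧ a ∉ bad G d K := by
        intro a ha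
        have := hK' ha
        simp only [Finset.mem_sdiff, Finset.mem_filter] at this
        tauto
      have hB' := Hbad d' K' h2
      obtain ⟨y, hy, hy'⟩ := Finset.exists_mem_notMem_of_card_lt_card
        (lt_of_le_of_lt hB' (not_le.1 hc))
      rw [Finset.mem_filter] at hy
      exact ⟨K', fun a ha => (hm a ha).1, h1, h2, fun a ha => (hm a ha).2, y, hy.1, hy', hy.2⟩
  obtain ⟨K', hK'K, hKC', hcol', hm, y, hyK, hyB', hzy⟩ := main
  have hB' := Hbad d' K' hcol'
  obtain ⟨b, hbK', hbB'⟩ := exists_nonmem hs hrd hcol' hB'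
  have hyK' : y ∉ K' := fun h => (hm y h).1 hzy
  obtain ⟨u, v, hru, _, huv, hvm, hvK'⟩ := first_cross (fun w => w ∈ K')
    (hKC _ hB' y (Finset.mem_sdiff.2 ⟨hyK, hyB'⟩) b (Finset.mem_sdiff.2 ⟨hK'K hbK', hbB'⟩))
    hyK' hbK'
  have hanti : ∀ w ∈ z :: L, ∀ a ∈ K', ¬ G.Adj w a := by
    intro w hw a ha hwa
    rcases List.mem_cons.1 hw with rfl | hw
    · exact (hm a ha).1 hwa
    · exact (hm a ha).2 (hL w hw a (hK'K ha) hwa)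
  rw [← heq] at hIP hout hanti
  have hrz : Rch G pre.toFinset x z := IP_rch hIP z (by rw [heq]; rfl)
  have hap := IP_append hIP
  refine ⟨K', core (IP_suffix hIP) hKC' hcol' ?_
    (pre.toFinset ∪ ((K \ bad G d' K').filter (fun w => ¬ w ∈ K'))) ?_ ?_ ?_ (u := u) (v := v)
    ?_ hvK' (Finset.mem_sdiff.1 hvm).2 huv (by omega)⟩
  · intro w hw
    have := List.mem_append_right pre hw
    exact ⟨fun h => hout w this (hK'K h), hanti w this⟩
  · intro a ha
    rcases Finset.mem_union.1 ha with ha | ha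
    · exact fun h => hout a (List.mem_append_left _ (List.mem_toFinset.1 ha)) (hK'K h)
    · exact (Finset.mem_filter.1 ha).2
  · intro w hw
    have hwm : w ∈ pre ++ x :: t := List.mem_append_right _ (List.mem_cons_of_mem _ hw)
    constructor
    · intro ha
      rcases Finset.mem_union.1 ha with ha | ha
      · exact (hap w (List.mem_toFinset.1 ha) w hw).2 rfl
      · exact hout w hwm (Finset.mem_sdiff.1 (Finset.mem_filter.1 ha).1).1
    · intro a ha hwa
      rcases Finset.mem_union.1 ha with ha | ha
      · exact (hap a (List.mem_toFinset.1 ha) w hw).1 hwa.symm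
      · exact htK w hw a (Finset.mem_sdiff.1 (Finset.mem_filter.1 ha).1).1 hwa
  · rintro a ha ⟨b, hb, hab⟩
    rcases Finset.mem_union.1 ha with ha | ha
    · exact absurd hab (hanti a (List.mem_append_left _ (List.mem_toFinset.1 ha)) b hb)
    · exact (Finset.mem_sdiff.1 (Finset.mem_filter.1 ha).1).2
  · refine ((hrz.mono Finset.subset_union_left).tail ⟨hzy, ?_⟩).trans
      (hru.mono (fun a ha => Finset.mem_union_right _ (by simpa using ha)))
    simp [hyK, hyB', hyK']

lemma initial {q s r : ℕ} (hs : 1 ≤ s) (hr : 1 ≤ r)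
    (Hbad : ∀ d K, ¬ Col G K (q + s * d) → (bad G d K).card ≤ r)
    {d d' : ℕ} (hd : d = q + s * d' + 5 * r) (hrd : r ≤ d')
    (h0 : ¬ Col G Finset.univ (q + s * d + 3 * r)) : ∃ K', St G q s r 2 d' K' := by
  obtain ⟨K, _, hKC, hcol⟩ := exists_KC r _ hr _ h0
  obtain ⟨y, hyK, hyB⟩ := exists_nonmem hs (by omega) hcol (Hbad d K hcol)
  have hW : ¬ Col G ((K.filter (fun a => ¬ G.Adj y a)) \ {y}) (q + s * d' + 3 * r) := by
    intro h
    apply hyB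
    rw [mem_bad]
    refine (h.union (col_card {y})).mono ?_ (by simp; omega)
    intro a ha
    simp only [Finset.mem_union, Finset.mem_sdiff] at ha ⊢
    tauto
  obtain ⟨K', hK', hKC', hcol'⟩ := exists_KC r _ hr _ hW
  have hm : ∀ a ∈ K', a ∈ K ∧ ¬ G.Adj y a ∧ a ≠ y := by
    intro a ha
    have := hK' ha
    simp only [Finset.mem_sdiff, Finset.mem_filter, Finset.mem_singleton] at this
    tauto
  have hB' := Hbad d' K' hcol'
  have hyB' : y ∉ bad G d' K' := not_bad_of_anti hs hcol' (fun a ha => (hm a ha).2.1)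
  have hyK' : y ∉ K' := fun h => (hm y h).2.2 rfl
  obtain ⟨b, hbK', hbB'⟩ := exists_nonmem hs hrd hcol' hB'
  obtain ⟨u, v, hru, _, huv, hvm, hvK'⟩ := first_cross (fun w => w ∈ K')
    (hKC _ hB' y (Finset.mem_sdiff.2 ⟨hyK, hyB'⟩) b (Finset.mem_sdiff.2 ⟨(hm b hbK').1, hbB'⟩))
    hyK' hbK'
  refine ⟨K', core (x := y) (t := []) (by simp [IP]) hKC' hcol' ?_
    ((K \ bad G d' K').filter (fun w => ¬ w ∈ K')) ?_ (by simp) ?_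
    (hru.mono (fun a ha => by simpa using ha)) hvK'
    (Finset.mem_sdiff.1 hvm).2 huv (by simp)⟩
  · intro w hw
    rw [List.mem_singleton] at hw
    subst hw
    exact ⟨hyK', fun a ha => (hm a ha).2.1⟩
  · intro a ha; exact (Finset.mem_filter.1 ha).2
  · intro a ha _
    exact (Finset.mem_sdiff.1 (Finset.mem_filter.1 ha).1).2

lemma final {q s r i d k : ℕ} (hrd : r ≤ d)
    (Hbad : ∀ d K, ¬ Col G K (q + s * d) → (bad G d K).card ≤ r)
    {K : Finset V} (hSt : St G q s r i d K) (hk : k ≤ i + 2) :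
    Nonempty (SimpleGraph.pathGraph k ↪g G) := by
  obtain ⟨hKC, hcol, pre, x, t, z, L, heq, hIP, hi, hout, htK, hL, hz, a, haK, haB, hza⟩ := hSt
  have hB := Hbad d K hcol
  obtain ⟨b, hbK, hbB, hzb⟩ : ∃ b ∈ K, b ∉ bad G d K ∧ ¬ G.Adj z b := by
    by_contra hcon
    push Not at hcon
    apply hz
    rw [mem_bad]
    refine (col_card (bad G d K)).mono ?_ (hB.trans hrd)
    intro w hw
    rw [Finset.mem_filter] at hw
    by_contra hwB
    exact hw.2 (hcon w hw.1 hwB)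
  have key : ∃ w w', w ∈ K \ bad G d K ∧ w' ∈ K \ bad G d K ∧ G.Adj z w ∧ ¬ G.Adj z w' ∧
      G.Adj w' w := by
    obtain ⟨u, v, hru, hzu, huv, hvm, hzv⟩ := first_cross (fun w => G.Adj z w)
      (hKC _ hB b (Finset.mem_sdiff.2 ⟨hbK, hbB⟩) a (Finset.mem_sdiff.2 ⟨haK, haB⟩)) hzb hza
    refine ⟨v, u, hvm, ?_, hzv, hzu, huv⟩
    rcases Relation.ReflTransGen.cases_tail hru with h | ⟨c, _, hc⟩
    · rw [h]; exact Finset.mem_sdiff.2 ⟨hbK, hbB⟩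
    · exact (Finset.mem_filter.1 hc.2).1
  obtain ⟨w, w', hw, hw', hzw, hzw', hww⟩ := key
  rw [Finset.mem_sdiff] at hw hw'
  have hnL : ∀ v, v ∈ K → v ∉ bad G d K → ∀ y ∈ L, ¬ G.Adj v y := fun v h1 h2 y hy h =>
    h2 (hL y hy v h1 h.symm)
  have hlen : pre.length + (t.length + 1) = L.length + 1 := by
    have := congrArg List.length heq
    simpa using this
  refine IP_embed (l := w' :: w :: z :: L) ⟨⟨hIP, fun h => hout w h hw.1, ?_⟩, ?_, ?_⟩
    (by simp; omega)
  · intro y hy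
    rcases List.mem_cons.1 hy with rfl | hyL
    · simp [hzw.symm]
    · have : z ≠ y := fun h => hIP.2.1 (h ▸ hyL)
      simp [hnL w hw.1 hw.2 y hyL, this]
  · intro h
    rcases List.mem_cons.1 h with h | h
    · exact G.ne_of_adj hww h
    · exact hout w' h hw'.1
  · intro y hy
    rcases List.mem_cons.1 hy with rfl | hy'
    · simp [hww]
    · have hne : w ≠ y := fun h => hout y hy' (h ▸ hw.1)
      rcases List.mem_cons.1 hy' with rfl | hyL
      · simp [hne, G.adj_comm w', hzw']
      · simp [hne, hnL w' hw'.1 hw'.2 y hyL]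

/-- The thresholds. -/
def cc (q s r : ℕ) : ℕ → ℕ
  | 0 => r
  | m + 1 => q + s * cc q s r m + 5 * r

lemma cc_ge (q s r m : ℕ) (_ : 1 ≤ s) : r ≤ cc q s r m := by
  cases m <;> simp [cc]; omega

lemma cc_bound (q s r m : ℕ) (hs : 2 ≤ s) (hr : 1 ≤ r) :
    q + s * cc q s r m + q + 5 * s * r < s ^ m * (2 * q + 7 * s * r) := by
  induction m with
  | zero =>
    have : 1 ≤ s * r := Nat.mul_pos (by omega) hr
    simp only [cc, pow_zero, one_mul]
    nlinarith
  | succ m ih =>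
    simp only [cc]
    rw [pow_succ', mul_assoc s (s ^ m)]
    have h2 : s * (q + s * cc q s r m + q + 5 * s * r + 1) ≤ s * (s ^ m * (2 * q + 7 * s * r)) :=
      Nat.mul_le_mul_left _ ih
    have h3 : s * (q + s * cc q s r m + q + 5 * s * r + 1)
      = s * (q + s * cc q s r m) + s * q + 5 * (s * (s * r)) + s := by ring
    have h4 : s * (q + s * cc q s r m + 5 * r) = s * (q + s * cc q s r m) + 5 * (s * r) := by ring
    have h5 : 2 * q ≤ s * q := Nat.mul_le_mul_right _ hs
    have h6 : 2 * (s * r) ≤ s * (s * r) := Nat.mul_le_mul_right _ hs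
    rw [h4, mul_assoc 5 s r]
    omega

lemma run {q s r k : ℕ} (hs : 2 ≤ s) (hr : 1 ≤ r) (hk : 5 ≤ k)
    (Hbad : ∀ d K, ¬ Col G K (q + s * d) → (bad G d K).card ≤ r)
    (h0 : ∀ n, n < s ^ (k - 3) * (2 * q + 7 * s * r) → ¬ Col G Finset.univ n) :
    Nonempty (SimpleGraph.pathGraph k ↪g G) := by
  have hs1 : 1 ≤ s := by omega
  have key : ∀ j, j ≤ k - 4 → ∃ K, St G q s r (2 + j) (cc q s r (k - 4 - j)) K := by
    intro j
    induction j with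
    | zero =>
      intro _
      refine initial hs1 hr Hbad rfl (cc_ge _ _ _ _ hs1) (h0 _ ?_)
      have h1 := cc_bound q s r (k - 3) hs hr
      have h2 : k - 3 = (k - 4) + 1 := by omega
      rw [h2] at h1 ⊢
      rw [cc] at h1
      have : r ≤ s * r := Nat.le_mul_of_pos_left _ hs1
      have h3 : 5 * s * r = 5 * (s * r) := by ring
      simp only [Nat.sub_zero]
      omega
    | succ j ih =>
      intro hj
      obtain ⟨K, hK⟩ := ih (by omega)
      have h2 : k - 4 - j = (k - 4 - (j + 1)) + 1 := by omega
      rw [h2] at hK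
      exact step hs1 hr Hbad rfl (cc_ge _ _ _ _ hs1) hK
  obtain ⟨K, hK⟩ := key (k - 4) le_rfl
  exact final (cc_ge _ _ _ _ hs1) Hbad hK (by omega)

end Main

section Fin
open Classical

lemma ram_exists (N : ℕ) : ∀ s w : ℕ, s + w ≤ N → ∃ n : ℕ, ∀ (V : Type) (G : SimpleGraph V)
    (A : Finset V), n ≤ A.card →
    (∃ S ⊆ A, IsStableSet G S ∧ S.card = s) ∨ (∃ S ⊆ A, G.IsNClique w S) := by
  induction N with
  | zero =>
    intro s w h
    have : s = 0 := by omega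
    subst this
    exact ⟨0, fun V G A _ => Or.inl ⟨∅, by simp, by simp [IsStableSet], rfl⟩⟩
  | succ N ih =>
    intro s w h
    rcases s with _ | s
    · exact ⟨0, fun V G A _ => Or.inl ⟨∅, by simp, by simp [IsStableSet], rfl⟩⟩
    rcases w with _ | w
    · exact ⟨0, fun V G A _ => Or.inr ⟨∅, by simp, by simp [isNClique_iff]⟩⟩
    obtain ⟨a, ha⟩ := ih s (w + 1) (by omega)
    obtain ⟨b, hb⟩ := ih (s + 1) w (by omega)
    refine ⟨a + b + 1, fun V G A hA => ?_⟩
    obtain ⟨v, hv⟩ : A.Nonempty := Finset.card_pos.1 (by omega)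
    have h1 := Finset.card_filter_add_card_filter_not (s := A.erase v) (fun x => G.Adj v x)
    have h2 := Finset.card_erase_of_mem hv
    have hsub : ∀ (p : V → Prop) [DecidablePred p], (A.erase v).filter p ⊆ A := fun p _ x hx =>
      Finset.mem_of_mem_erase (Finset.mem_filter.1 hx).1
    by_cases hc : b ≤ ((A.erase v).filter (fun x => G.Adj v x)).card
    · rcases hb V G _ hc with ⟨S, hS, hS'⟩ | ⟨S, hS, hS'⟩
      · exact Or.inl ⟨S, hS.trans (hsub _), hS'⟩
      · refine Or.inr ⟨insert v S, Finset.insert_subset hv (hS.trans (hsub _)), ?_⟩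
        exact hS'.insert (fun x hx => (Finset.mem_filter.1 (hS hx)).2)
    · rcases ha V G ((A.erase v).filter (fun x => ¬ G.Adj v x)) (by omega) with
        ⟨S, hS, hS', hS''⟩ | ⟨S, hS, hS'⟩
      · have hn : ∀ x ∈ S, x ≠ v ∧ ¬ G.Adj v x := fun x hx =>
          ⟨Finset.ne_of_mem_erase (Finset.mem_filter.1 (hS hx)).1, (Finset.mem_filter.1 (hS hx)).2⟩
        refine Or.inl ⟨insert v S, Finset.insert_subset hv (hS.trans (hsub _)), ?_, ?_⟩
        · intro x hx y hy hxy
          by_cases hxv : x = v <;> by_cases hyv : y = v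
          · rw [hxv, hyv] at hxy; exact G.irrefl hxy
          · exact (hn y (Finset.mem_of_mem_insert_of_ne hy hyv)).2 (hxv ▸ hxy)
          · exact (hn x (Finset.mem_of_mem_insert_of_ne hx hxv)).2 (hyv ▸ hxy.symm)
          · exact hS' x (Finset.mem_of_mem_insert_of_ne hx hxv) y
              (Finset.mem_of_mem_insert_of_ne hy hyv) hxy
        · rw [Finset.card_insert_of_notMem (fun h => (hn v h).1 rfl), hS'']
      · exact Or.inr ⟨S, hS.trans (hsub _), hS'⟩

lemma ramsey_spec (s w : ℕ) : 1 ≤ ramsey s w ∧ ∀ G : SimpleGraph (Fin (ramsey s w)),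
    (∃ S : Finset (Fin (ramsey s w)), IsStableSet G S ∧ S.card = s) ∨
    (∃ S : Finset (Fin (ramsey s w)), G.IsNClique w S) := by
  refine Nat.sInf_mem (s := {n : ℕ | 1 ≤ n ∧ ∀ G : SimpleGraph (Fin n),
    (∃ S : Finset (Fin n), IsStableSet G S ∧ S.card = s) ∨
    (∃ S : Finset (Fin n), G.IsNClique w S)}) ?_
  obtain ⟨n, hn⟩ := ram_exists (s + w) s w le_rfl
  refine ⟨n + 1, by omega, fun G => ?_⟩
  rcases hn (Fin (n + 1)) G Finset.univ (by simp) with ⟨S, _, h⟩ | ⟨S, _, h⟩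
  · exact Or.inl ⟨S, h⟩
  · exact Or.inr ⟨S, h⟩

lemma ramsey_two {s w : ℕ} (hs : 2 ≤ s) (hw : 2 ≤ w) : 2 ≤ ramsey s w := by
  obtain ⟨h1, h2⟩ := ramsey_spec s w
  by_contra hcon
  have hR : ramsey s w = 1 := by omega
  rcases h2 ⊥ with ⟨S, _, h⟩ | ⟨S, h⟩
  · have := S.card_le_univ
    rw [Fintype.card_fin] at this
    omega
  · have := S.card_le_univ
    rw [Fintype.card_fin] at this
    have := h.card_eq
    omega

variable {V : Type} [Fintype V] {G : SimpleGraph V}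

lemma exists_stable {s : ℕ} {B : Finset V} (hB : ramsey s (G.cliqueNum + 1) ≤ B.card) :
    ∃ S ⊆ B, IsStableSet G S ∧ S.card = s := by
  obtain ⟨B', hB', hc⟩ := Finset.exists_subset_card_eq hB
  let e := (Finset.equivFinOfCardEq hc).symm
  let f : Fin (ramsey s (G.cliqueNum + 1)) ↪ V :=
    ⟨fun i => (e i : V), fun i j h => e.injective (Subtype.ext h)⟩
  rcases (ramsey_spec s (G.cliqueNum + 1)).2 (G.comap f) with ⟨S, h1, h2⟩ | ⟨S, h⟩
  · refine ⟨S.map f, ?_, ?_, by simpa using h2⟩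
    · intro x hx
      obtain ⟨i, _, rfl⟩ := Finset.mem_map.1 hx
      exact hB' (e i).2
    · intro x hx y hy
      obtain ⟨i, hi, rfl⟩ := Finset.mem_map.1 hx
      obtain ⟨j, hj, rfl⟩ := Finset.mem_map.1 hy
      exact h1 i hi j hj
  · exfalso
    have hcl : G.IsClique (S.map f : Finset V) := by
      intro x hx y hy hxy
      obtain ⟨i, hi, rfl⟩ := Finset.mem_map.1 hx
      obtain ⟨j, hj, rfl⟩ := Finset.mem_map.1 hy
      exact h.isClique hi hj (fun hij => hxy (by rw [hij]))
    have := hcl.card_le_cliqueNum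
    rw [Finset.card_map, h.card_eq] at this
    omega

lemma col_of_chromNum {T : Set V} {q : ℕ} (h : chromNum (G.induce T) ≤ q) {W : Finset V}
    (hW : ∀ a ∈ W, a ∈ T) : Col G W q := by
  have hcol : (G.induce T).Colorable q := by
    rw [← chromaticNumber_le_iff_colorable]
    have hne : (G.induce T).chromaticNumber ≠ ⊤ :=
      chromaticNumber_ne_top_iff_exists.2 ⟨_, colorable_of_fintype _⟩
    rw [← ENat.natCast_toNat hne]
    exact_mod_cast h
  obtain ⟨C⟩ := hcol
  refine ⟨fun v => if hv : v ∈ T then (C ⟨v, hv⟩ : ℕ) else 0, ?_, ?_⟩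
  · intro v hv
    simp [hW v hv]
  · intro u hu v hv huv
    simp only [hW u hu, hW v hv, dif_pos]
    intro h
    exact C.valid (v := ⟨u, hW u hu⟩) (w := ⟨v, hW v hv⟩) (by simpa using huv) (Fin.ext h)

lemma chromNum_le_of_col {n : ℕ} (h : Col G Finset.univ n) : chromNum G ≤ n := by
  obtain ⟨g, h1, h2⟩ := h
  have hc : G.Colorable n := ⟨Coloring.mk (fun v => (⟨g v, h1 v (by simp)⟩ : Fin n))
    (fun {u v} huv h => h2 u (by simp) v (by simp) huv (Fin.ext_iff.1 h))⟩
  exact ENat.toNat_le_of_le_natCast hc.chromaticNumber_le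

lemma col_biUnion (S : Finset V) (d : ℕ) (f : V → Finset V) (h : ∀ v ∈ S, Col G (f v) d) :
    Col G (S.biUnion f) (S.card * d) := by
  induction S using Finset.induction_on with
  | empty => simpa using col_card (G := G) (∅ : Finset V)
  | insert a S ha ih =>
    rw [Finset.biUnion_insert, Finset.card_insert_of_notMem ha, Nat.succ_mul, Nat.add_comm]
    exact (h a (by simp)).union (ih fun v hv => h v (by simp [hv]))

end Fin

end PK

/-- for integers `k ≥ 5`, `s ≥ 2`, `q ≥ 1` and every `P_k`-free
graph `G` with `χ(G) ≥ s^(k-3)·(2q + 7s·R(s,ω(G)+1) - 7s)`, `G` contains a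
stable set `S` of size `s` whose common neighbourhood induces a subgraph of
chromatic number greater than `q`. -/
theorem stmt5 (k s q : ℕ) (hk : 5 ≤ k) (hs : 2 ≤ s) (hq : 1 ≤ q)
    (V : Type) [Fintype V] (G : SimpleGraph V)
    (hP : IndFree (SimpleGraph.pathGraph k) G)
    (hchi : s ^ (k - 3) * (2 * q + 7 * s * ramsey s (G.cliqueNum + 1) - 7 * s)
      ≤ chromNum G) :
    ∃ S : Finset V, IsStableSet G S ∧ S.card = s ∧
      q < chromNum (G.induce (⋂ v ∈ S, G.neighborSet v)) := by
  classical
  by_contra hcon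
  push Not at hcon
  obtain ⟨hR1, _⟩ := PK.ramsey_spec s (G.cliqueNum + 1)
  have hsub : 2 * q + 7 * s * ramsey s (G.cliqueNum + 1) - 7 * s
      = 2 * q + 7 * s * (ramsey s (G.cliqueNum + 1) - 1) := by
    obtain ⟨m, hm⟩ := Nat.exists_eq_add_of_le hR1
    rw [hm, Nat.add_sub_cancel_left]
    have : 7 * s * (1 + m) = 7 * s + 7 * s * m := by ring
    omega
  rw [hsub] at hchi
  have hw : 1 ≤ G.cliqueNum := by
    by_contra h0
    have hV : IsEmpty V := by
      refine ⟨fun v => h0 ?_⟩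
      have hcl : G.IsClique (({v} : Finset V) : Set V) := by simp
      simpa using hcl.card_le_cliqueNum
    have h1 : chromNum G ≤ 0 :=
      PK.chromNum_le_of_col ⟨fun _ => 0, fun v => hV.elim v, fun v => hV.elim v⟩
    have h2 : 0 < s ^ (k - 3) * (2 * q + 7 * s * (ramsey s (G.cliqueNum + 1) - 1)) :=
      Nat.mul_pos (Nat.pow_pos (by omega)) (by omega)
    omega
  have hR2 := PK.ramsey_two hs (show 2 ≤ G.cliqueNum + 1 by omega)
  refine hP (PK.run (q := q) (r := ramsey s (G.cliqueNum + 1) - 1) hs (by omega) hk ?_ ?_)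
  · intro d K hK
    by_contra hc
    obtain ⟨S, hSB, hst, hcard⟩ := PK.exists_stable (G := G) (s := s) (B := PK.bad G d K) (by omega)
    apply hK
    have h1 : PK.Col G (Finset.univ.filter (fun a => ∀ v ∈ S, G.Adj v a)) q :=
      PK.col_of_chromNum (hcon S hst hcard) (by intro a ha; simpa using ha)
    have h2 := PK.col_biUnion S d (fun v => K.filter (fun a => ¬ G.Adj v a))
      (fun v hv => by
        have := PK.mem_bad.1 (hSB hv)
        convert this)
    rw [hcard] at h2
    refine (h1.union h2).mono ?_ le_rfl
    intro a ha
    rw [Finset.mem_union]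
    by_cases h : ∀ v ∈ S, G.Adj v a
    · left; simpa using h
    · right
      push Not at h
      obtain ⟨v, hv, hva⟩ := h
      rw [Finset.mem_biUnion]
      exact ⟨v, hv, by simp [ha, hva]⟩
  · intro n hn hcol
    have := PK.chromNum_le_of_col hcol
    omega
end

section
/- Let F be a tree of radius h ≥ 0, let c ∈ (0, 1/2) be real, and let t ≥ 1 be an integer. Then every (c,t)-sparse graph G with average degree at least (4/c)^(4h·|V(F)|) · t contains an induced subgraph isomorphic to F. -/
open SimpleGraph

section aux
open Classical Finset

/-- Classical filter. -/
noncomputable def cf {α : Type} (W : Finset α) (P : α → Prop) : Finset α := W.filter P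

lemma mem_cf {α : Type} {W : Finset α} {P : α → Prop} {x : α} :
    x ∈ cf W P ↔ x ∈ W ∧ P x := by simp [cf]

lemma cf_mono {α : Type} {W : Finset α} {P Q : α → Prop} (h : ∀ x, x ∈ W → P x → Q x) :
    cf W P ⊆ cf W Q := fun x hx => mem_cf.2 ⟨(mem_cf.1 hx).1, h x (mem_cf.1 hx).1 (mem_cf.1 hx).2⟩

/-- `Rich G s k Z x`: a tree of depth `k` of induced paths starting from `x`, avoiding the
closed neighbourhood of `Z`, all of whose branching sets have size at least `s`. -/
def Rich {V : Type} [Fintype V] (G : SimpleGraph V) (s : ℝ) : ℕ → Set V → V → Prop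
  | 0, _, _ => True
  | k + 1, Z, x => s ≤ ((cf univ (fun w => G.Adj x w ∧
      (∀ z ∈ Z, ¬ G.Adj z w ∧ z ≠ w) ∧ Rich G s k (insert x Z) w)).card : ℝ)

lemma Rich.mono {V : Type} [Fintype V] {G : SimpleGraph V} {s s' : ℝ} (hs : s' ≤ s) :
    ∀ (k : ℕ) (Z : Set V) (x : V), Rich G s k Z x → Rich G s' k Z x
  | 0, _, _ => fun _ => trivial
  | k + 1, Z, x => by
    intro h
    unfold Rich at h ⊢
    refine hs.trans (h.trans ?_)
    exact Nat.cast_le.2 (card_le_card (cf_mono (fun w _ hw =>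
      ⟨hw.1, hw.2.1, Rich.mono hs k _ _ hw.2.2⟩)))

lemma eCount_eq {V : Type} [Fintype V] (G : SimpleGraph V) (A B : Finset V) :
    eCount G A B = ∑ a ∈ A, (cf B (fun b => G.Adj a b)).card := by
  unfold eCount
  have : {p : V × V | p.1 ∈ A ∧ p.2 ∈ B ∧ G.Adj p.1 p.2}
      = ((cf (A ×ˢ B) (fun p => G.Adj p.1 p.2) : Finset (V × V)) : Set (V × V)) := by
    ext p; simp [cf, and_assoc]
  rw [this, Set.ncard_coe_finset, cf, card_filter, sum_product]
  simp only [cf, card_filter]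

lemma lemA {V : Type} [Fintype V] (G : SimpleGraph V) {c : ℝ} (hc0 : 0 < c)
    {t : ℕ} (ht : 1 ≤ t) (hc2 : c < 1 / 2) (hG : CTSparse G c t) (C : Finset V)
    (hC : (4 / c) * t ≤ C.card) :
    ((cf univ (fun y => ((cf C
      (fun w => ¬ G.Adj y w ∧ y ≠ w)).card : ℝ) < (c / 2) * C.card)).card : ℝ) ≤ t := by
  set A := cf univ (fun y => ((cf C
      (fun w => ¬ G.Adj y w ∧ y ≠ w)).card : ℝ) < (c / 2) * C.card) with hA
  by_contra hlt
  push Not at hlt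
  have htR : (1 : ℝ) ≤ t := by exact_mod_cast ht
  have hC' : 4 * t ≤ c * C.card := by
    rw [div_mul_eq_mul_div, div_le_iff₀ hc0] at hC
    linarith
  have htC : t ≤ C.card := by
    have : (t : ℝ) ≤ C.card := by
      have : c * (C.card : ℝ) ≤ 1 * C.card := by
        apply mul_le_mul_of_nonneg_right <;> [linarith; positivity]
      linarith
    exact_mod_cast this
  have h1 := hG A C (by exact_mod_cast hlt.le) htC
  rw [eCount_eq] at h1
  push_cast at h1
  have h2 : ∀ y ∈ A, (1 - c) * C.card < ((cf C (fun b => G.Adj y b)).card : ℝ) := by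
    intro y hy
    have hy' := (mem_cf.1 hy).2
    have h3 : C ⊆ (cf C (fun b => G.Adj y b)) ∪
      (cf C (fun w => ¬ G.Adj y w ∧ y ≠ w)) ∪ {y} := by
      intro w hw
      simp only [mem_union, mem_cf, mem_singleton]
      grind
    have h4 := (card_le_card h3).trans ((card_union_le _ _).trans
      (Nat.add_le_add_right (card_union_le _ _) _))
    rw [card_singleton] at h4
    have h5 : (C.card : ℝ) ≤ (cf C (fun b => G.Adj y b)).card +
      (cf C (fun w => ¬ G.Adj y w ∧ y ≠ w)).card + 1 := by exact_mod_cast h4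
    nlinarith
  have hne : A.Nonempty := by
    rw [← card_pos]
    have : (0 : ℝ) < A.card := by linarith
    exact_mod_cast this
  have h6 := sum_lt_sum_of_nonempty hne h2
  rw [sum_const, nsmul_eq_mul] at h6
  nlinarith

/-- Markov type double counting. -/
lemma lemMarkov {V : Type} [Fintype V] (W : Finset V) (P : V → V → Prop) (b r : ℝ)
    (hr : 0 < r) (hW : W.Nonempty)
    (hP : ∀ w ∈ W, ((cf univ (fun y => P w y)).card : ℝ) ≤ b) :
    ((cf univ (fun y => r * W.card <
      ((cf W (fun w => P w y)).card : ℝ))).card : ℝ) ≤ b / r := by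
  set Y := cf univ (fun y => r * W.card <
      ((cf W (fun w => P w y)).card : ℝ)) with hY
  have hWp : (0 : ℝ) < W.card := by exact_mod_cast card_pos.2 hW
  have h1 : (Y.card : ℝ) * (r * W.card) ≤ ∑ y : V, ((cf W (fun w => P w y)).card : ℝ) := by
    calc (Y.card : ℝ) * (r * W.card) = ∑ y ∈ Y, r * (W.card : ℝ) := by
          rw [sum_const, nsmul_eq_mul]
      _ ≤ ∑ y ∈ Y, ((cf W (fun w => P w y)).card : ℝ) :=
          sum_le_sum (fun y hy => ((mem_cf.1 hy).2).le)
      _ ≤ _ := sum_le_sum_of_subset_of_nonneg (subset_univ _) (fun _ _ _ => by positivity)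
  have h2 : ∑ y : V, ((cf W (fun w => P w y)).card : ℝ)
      = ∑ w ∈ W, ((cf univ (fun y => P w y)).card : ℝ) := by
    simp only [cf, card_filter, Nat.cast_sum]
    exact sum_comm
  have h3 := sum_le_sum hP
  rw [sum_const, nsmul_eq_mul] at h3
  rw [le_div_iff₀ hr]
  have : (Y.card * r) * (W.card : ℝ) ≤ b * W.card := by linarith
  exact le_of_mul_le_mul_right this hWp

lemma lemP {V : Type} [Fintype V] (G : SimpleGraph V) {c : ℝ} (hc0 : 0 < c)
    {t : ℕ} (ht : 1 ≤ t) (hc2 : c < 1 / 2) (hG : CTSparse G c t) (e : ℕ) :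
    ∀ (k : ℕ) (Z : Set V) (x : V), Rich G (t * (4 / c) ^ (e + 1)) k Z x →
    ((cf univ (fun y => ¬ Rich G (t * (4 / c) ^ e) k (insert y Z) x)).card : ℝ)
      ≤ t * ((4 / c) ^ k - 1) := by
  have htR : (1 : ℝ) ≤ t := by exact_mod_cast ht
  have hK : 8 < 4 / c := by rw [lt_div_iff₀ hc0]; linarith
  intro k
  induction k with
  | zero =>
    intro Z x _
    simp [Rich, cf]
  | succ k ih =>
    intro Z x hx
    unfold Rich at hx
    set W := cf univ (fun w => G.Adj x w ∧
      (∀ z ∈ Z, ¬ G.Adj z w ∧ z ≠ w) ∧ Rich G (t * (4 / c) ^ (e + 1)) k (insert x Z) w) with hW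
    have hKe : 1 ≤ (4 / c) ^ e := one_le_pow₀ (by linarith)
    have hWK : (4 / c) * t ≤ W.card := by
      refine le_trans ?_ hx
      rw [pow_succ]
      have : (0:ℝ) < t * (4 / c) := by positivity
      nlinarith
    have hWne : W.Nonempty := by
      rw [← card_pos]
      have : (0 : ℝ) < W.card := lt_of_lt_of_le (by positivity) hWK
      exact_mod_cast this
    have hA := lemA G hc0 ht hc2 hG W hWK
    have hM := lemMarkov W (fun w y => ¬ Rich G (t * (4 / c) ^ e) k (insert y (insert x Z)) w)
      (t * ((4 / c) ^ k - 1)) (c / 4) (by positivity) hWne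
      (fun w hw => ih _ _ (mem_cf.1 hw).2.2.2)
    have hsub : (cf univ
        (fun y => ¬ Rich G (t * (4 / c) ^ e) (k + 1) (insert y Z) x)) ⊆
        (cf univ (fun y => ((cf W
          (fun w => ¬ G.Adj y w ∧ y ≠ w)).card : ℝ) < (c / 2) * W.card)) ∪
        (cf univ (fun y => (c / 4) * W.card <
          ((cf W (fun w => ¬ Rich G (t * (4 / c) ^ e) k
            (insert y (insert x Z)) w)).card : ℝ))) := by
      intro y hy
      by_contra hcon
      simp only [mem_union, mem_cf, mem_univ, true_and, not_or, not_lt] at hcon hy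
      obtain ⟨h1, h2⟩ := hcon
      apply hy
      unfold Rich
      have h3 : cf W (fun w => ¬ G.Adj y w ∧ y ≠ w) ⊆
          cf univ (fun w => G.Adj x w ∧
          (∀ z ∈ insert y Z, ¬ G.Adj z w ∧ z ≠ w) ∧
            Rich G (t * (4 / c) ^ e) k (insert x (insert y Z)) w) ∪
          cf W (fun w => ¬ Rich G (t * (4 / c) ^ e) k (insert y (insert x Z)) w) := by
        intro w hw
        rw [mem_cf] at hw
        have hw1 := (mem_cf.1 hw.1).2
        rw [mem_union]
        by_cases hr : Rich G (t * (4 / c) ^ e) k (insert y (insert x Z)) w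
        · left
          rw [mem_cf]
          refine ⟨mem_univ _, hw1.1, ?_, ?_⟩
          · intro z hz
            rcases Set.mem_insert_iff.1 hz with rfl | hz
            · exact hw.2
            · exact hw1.2.1 z hz
          · rw [Set.insert_comm]; exact hr
        · right
          exact mem_cf.2 ⟨hw.1, hr⟩
      have h4 := (card_le_card h3).trans (card_union_le _ _)
      have h5 : ((cf W (fun w => ¬ G.Adj y w ∧ y ≠ w)).card : ℝ) ≤
        (cf univ (fun w => G.Adj x w ∧
          (∀ z ∈ insert y Z, ¬ G.Adj z w ∧ z ≠ w) ∧
            Rich G (t * (4 / c) ^ e) k (insert x (insert y Z)) w)).card +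
          (cf W (fun w => ¬ Rich G (t * (4 / c) ^ e) k (insert y (insert x Z)) w)).card := by
        exact_mod_cast h4
      have h6 : t * (4 / c) ^ e ≤ c / 4 * W.card := by
        have : t * (4 / c) ^ e = c / 4 * (t * (4 / c) ^ (e + 1)) := by
          rw [pow_succ]; field_simp
        rw [this]
        exact mul_le_mul_of_nonneg_left hx (by positivity)
      linarith
    have h7 := (card_le_card hsub).trans (card_union_le _ _)
    have h8 : ((cf univ
        (fun y => ¬ Rich G (t * (4 / c) ^ e) (k + 1) (insert y Z) x)).card : ℝ) ≤ _ :=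
      (Nat.cast_le.2 h7)
    push_cast at h8
    have h9 : t * ((4 / c) ^ k - 1) / (c / 4) = t * ((4 / c) ^ (k + 1) - 4 / c) := by
      rw [pow_succ]; field_simp
    rw [h9] at hM
    have h10 : (t : ℝ) * ((4 / c) ^ (k + 1) - 4 / c) + t ≤ t * ((4 / c) ^ (k + 1) - 1) := by
      nlinarith
    linarith

lemma lemR {V : Type} [Fintype V] (G : SimpleGraph V) {c : ℝ} (hc0 : 0 < c)
    {t : ℕ} (ht : 1 ≤ t) (hc2 : c < 1 / 2) (hG : CTSparse G c t) (E : ℕ) :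
    ∀ k : ℕ, k ≤ E →
    (∑ x ∈ cf univ (fun x => ¬ Rich G (t * (4 / c) ^ (E - k)) k ∅ x),
      ((cf univ (fun w => G.Adj x w)).card : ℝ)) ≤
      k * (2 * (t * (4 / c) ^ E)) * Fintype.card V := by
  have hK : 8 < 4 / c := by rw [lt_div_iff₀ hc0]; linarith
  intro k
  induction k with
  | zero => intro _; simp [Rich, cf]
  | succ k ih =>
    intro hk
    specialize ih (by omega)
    obtain ⟨e, he⟩ : ∃ e, E - k = e + 1 := ⟨E - k - 1, by omega⟩
    have he' : E - (k + 1) = e := by omega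
    rw [he']
    rw [he] at ih
    have hKe : (4 / c) ^ e ≤ (4 / c) ^ E := pow_le_pow_right₀ (by linarith) (by omega)
    have hKk : (4 / c) ^ k ≤ (4 / c) ^ E := pow_le_pow_right₀ (by linarith) (by omega)
    set B : V → V → Prop := fun x w => G.Adj x w ∧ ¬ Rich G (t * (4 / c) ^ e) k {x} w with hB
    have h1 : ∀ x ∈ cf univ (fun x => ¬ Rich G (t * (4 / c) ^ e) (k+1) ∅ x),
        ((cf univ (fun w => G.Adj x w)).card : ℝ) ≤
          t * (4 / c) ^ E + ((cf univ (fun w => B x w)).card : ℝ) := by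
      intro x hx
      have hx := (mem_cf.1 hx).2
      unfold Rich at hx
      push Not at hx
      have h3 : (cf univ (fun w => G.Adj x w)) ⊆
        cf univ (fun w => G.Adj x w ∧
          (∀ z ∈ (∅ : Set V), ¬ G.Adj z w ∧ z ≠ w) ∧
            Rich G (t * (4 / c) ^ e) k (insert x ∅) w) ∪ (cf univ (fun w => B x w)) := by
        intro w hw
        simp only [mem_union, mem_cf, mem_univ, true_and, hB, insert_empty_eq] at hw ⊢
        by_cases hr : Rich G (t * (4 / c) ^ e) k {x} w
        · left; exact ⟨hw, by simp, hr⟩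
        · right; exact ⟨hw, hr⟩
      have h4 := (card_le_card h3).trans (card_union_le _ _)
      have h5 : ((cf univ (fun w => G.Adj x w)).card : ℝ) ≤ _ := Nat.cast_le.2 h4
      push_cast at h5
      have : t * (4 / c) ^ e ≤ t * (4 / c) ^ E := by gcongr
      linarith
    have h2 : ∑ x : V, ((cf univ (fun w => B x w)).card : ℝ)
        = ∑ w : V, ((cf univ (fun x => B x w)).card : ℝ) := by
      simp only [cf, card_filter, Nat.cast_sum]
      exact sum_comm
    have h3 : ∑ w : V, ((cf univ (fun x => B x w)).card : ℝ) ≤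
        (∑ x ∈ cf univ (fun x => ¬ Rich G (t * (4 / c) ^ (e + 1)) k ∅ x),
          ((cf univ (fun w => G.Adj x w)).card : ℝ)) +
          Fintype.card V * (t * (4 / c) ^ E) := by
      have : (Fintype.card V : ℝ) * (t * (4 / c) ^ E) = ∑ w : V, (t * (4 / c) ^ E : ℝ) := by
        rw [sum_const, nsmul_eq_mul]; rfl
      rw [this, cf, sum_filter, ← sum_add_distrib]
      refine sum_le_sum (fun w _ => ?_)
      by_cases hr : Rich G (t * (4 / c) ^ (e + 1)) k ∅ w
      swap
      · rw [if_pos hr]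
        have : ((cf univ (fun x => B x w)).card : ℝ) ≤
          ((cf univ (fun x => G.Adj w x)).card : ℝ) := by
          exact Nat.cast_le.2 (card_le_card (cf_mono (fun x _ hx => hx.1.symm)))
        have : (0:ℝ) ≤ t * (4 / c) ^ E := by positivity
        linarith
      · rw [if_neg (not_not.2 hr), zero_add]
        have h5 := lemP G hc0 ht hc2 hG e k ∅ w hr
        have h6 : ((cf univ (fun x => B x w)).card : ℝ) ≤
          (cf univ (fun y => ¬ Rich G (t * (4 / c) ^ e) k (insert y ∅) w)).card := by
          refine Nat.cast_le.2 (card_le_card (cf_mono (fun x _ hx => ?_)))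
          have := hx.2
          simpa using this
        have h7 : t * ((4 / c) ^ k - 1) ≤ t * (4 / c) ^ E := by gcongr; linarith
        linarith
    have h4 := sum_le_sum h1
    rw [sum_add_distrib, sum_const, nsmul_eq_mul] at h4
    have h5 : (∑ x ∈ cf univ
        (fun x => ¬ Rich G (t * (4 / c) ^ e) (k+1) ∅ x), ((cf univ (fun w => B x w)).card : ℝ))
        ≤ ∑ x : V, ((cf univ (fun w => B x w)).card : ℝ) :=
      sum_le_sum_of_subset_of_nonneg (subset_univ _) (fun _ _ _ => by positivity)
    have h6 : ((cf univ
        (fun x => ¬ Rich G (t * (4 / c) ^ e) (k+1) ∅ x)).card : ℝ) ≤ Fintype.card V := by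
      exact_mod_cast card_le_univ _
    have h7 := mul_le_mul_of_nonneg_right h6 (show (0:ℝ) ≤ t * (4 / c) ^ E by positivity)
    push_cast
    linarith

lemma tree_parent {U : Type} {F : SimpleGraph U} (hF : F.IsTree) {r v : U} (hv : r ≠ v) :
    ∃ u, F.Adj u v ∧ F.dist r u + 1 = F.dist r v := by
  obtain ⟨p, hp⟩ := hF.connected.exists_walk_length_eq_dist r v
  have hnil : ¬ p.Nil := Walk.not_nil_of_ne hv
  refine ⟨p.penultimate, p.adj_penultimate hnil, ?_⟩
  have h1 := dist_le p.dropLast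
  have h2 := Walk.length_dropLast_add_one hnil
  have h3 := hF.dist_eq_dist_add_one_of_adj r (p.adj_penultimate hnil)
  omega

lemma tree_parent_unique {U : Type} {F : SimpleGraph U} (hF : F.IsTree) {r v u w : U}
    (hu : F.Adj u v) (hw : F.Adj w v) (hdu : F.dist r u + 1 = F.dist r v)
    (hdw : F.dist r w + 1 = F.dist r v) : u = w := by
  obtain ⟨p, hp⟩ := hF.connected.exists_walk_length_eq_dist r u
  obtain ⟨q, hq⟩ := hF.connected.exists_walk_length_eq_dist r w
  have h1 : (p.concat hu).IsPath := Walk.isPath_of_length_eq_dist _ (by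
    rw [Walk.length_concat]; omega)
  have h2 : (q.concat hw).IsPath := Walk.isPath_of_length_eq_dist _ (by
    rw [Walk.length_concat]; omega)
  have h3 := (hF.existsUnique_path r v).unique h1 h2
  have h4 := congrArg Walk.penultimate h3
  simpa using h4

lemma embed_step {U V : Type} [Fintype U] [Fintype V] {F : SimpleGraph U} (hF : F.IsTree)
    {r : U} {h : ℕ} (hr : ∀ u, F.dist r u ≤ h)
    (G : SimpleGraph V) {c : ℝ} (hc0 : 0 < c)
    {t : ℕ} (ht : 1 ≤ t) (hc2 : c < 1 / 2) (hG : CTSparse G c t) (E : ℕ)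
    (hE : Fintype.card U + h ≤ E) {x : V} (hx : Rich G (t * (4 / c) ^ (E + Fintype.card U)) h ∅ x) :
    ∀ i : ℕ, i < Fintype.card U → ∃ (S : Finset U) (φ : U → V), S.card = i + 1 ∧ r ∈ S ∧
      (∀ u ∈ S, ∀ v, v ∉ S → F.dist r u ≤ F.dist r v) ∧
      (∀ u ∈ S, ∀ v ∈ S, u ≠ v → φ u ≠ φ v) ∧
      (∀ u ∈ S, ∀ v ∈ S, (G.Adj (φ u) (φ v) ↔ F.Adj u v)) ∧
      (∀ u ∈ S, Rich G (t * (4 / c) ^ (E + Fintype.card U - i)) (h - F.dist r u)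
        (φ '' {v | v ∈ S ∧ v ≠ u}) (φ u)) := by
  have hK : 8 < 4 / c := by rw [lt_div_iff₀ hc0]; linarith
  have htR : (1 : ℝ) ≤ t := by exact_mod_cast ht
  intro i
  induction i with
  | zero =>
    intro _
    refine ⟨{r}, fun _ => x, by simp, by simp, by simp, ?_, ?_, ?_⟩
    · intro u hu v hv huv
      simp only [mem_singleton] at hu hv
      exact absurd (hu.trans hv.symm) huv
    · intro u hu v hv
      simp only [mem_singleton] at hu hv
      subst hu; subst hv; simp
    · intro u hu
      simp only [mem_singleton] at hu
      subst hu
      have : {v : U | v ∈ ({u} : Finset U) ∧ v ≠ u} = ∅ := by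
        ext v; simp
      rw [this, Set.image_empty, dist_self]
      simpa using hx
  | succ i ih =>
    intro hi
    obtain ⟨S, φ, hcard, hrS, hbfs, hinj, hadj, hrich⟩ := ih (by omega)
    obtain ⟨e, he⟩ : ∃ e, E + Fintype.card U - i = e + 1 := ⟨E + Fintype.card U - i - 1, by omega⟩
    have he' : E + Fintype.card U - (i + 1) = e := by omega
    rw [he']
    rw [he] at hrich
    have hne : (univ \ S).Nonempty := by
      rw [← card_pos, card_sdiff_of_subset (subset_univ _), card_univ]; omega
    obtain ⟨v, hvS, hvmin⟩ := exists_min_image (univ \ S) (fun v => F.dist r v) hne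
    simp only [mem_sdiff, mem_univ, true_and] at hvS hvmin
    have hrv : r ≠ v := fun hh => hvS (hh ▸ hrS)
    obtain ⟨u, huv, hud⟩ := tree_parent hF hrv
    have huS : u ∈ S := by
      by_contra hcon
      have := hvmin u hcon
      omega
    have huniq : ∀ w ∈ S, F.Adj w v → w = u := by
      intro w hw hwv
      refine tree_parent_unique (r := r) hF hwv huv ?_ hud
      have h1 := hbfs w hw v hvS
      have h2 := hF.dist_eq_dist_add_one_of_adj r hwv
      omega
    have hvh := hr v
    have hk : h - F.dist r u = (h - F.dist r v) + 1 := by omega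
    have hRu := hrich u huS
    rw [hk] at hRu
    unfold Rich at hRu
    set Z := φ '' {v | v ∈ S ∧ v ≠ u} with hZ
    set W := cf univ (fun w => G.Adj (φ u) w ∧ (∀ z ∈ Z, ¬ G.Adj z w ∧ z ≠ w) ∧
      Rich G (t * (4 / c) ^ (e + 1)) (h - F.dist r v) (insert (φ u) Z) w) with hW
    set Bad : U → Finset V := fun u' => cf univ (fun y => ¬ Rich G (t * (4 / c) ^ e)
      (h - F.dist r u') (insert y (φ '' {v | v ∈ S ∧ v ≠ u'})) (φ u')) with hBad
    have hbad : ∀ u' ∈ S, ((Bad u').card : ℝ) ≤ t * (4 / c) ^ h := by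
      intro u' hu'
      refine (lemP G hc0 ht hc2 hG e _ _ _ (hrich u' hu')).trans ?_
      have : (4 / c) ^ (h - F.dist r u') ≤ (4 / c) ^ h :=
        pow_le_pow_right₀ (by linarith) (by omega)
      gcongr
      linarith
    have hlt : (S.biUnion Bad).card < W.card := by
      have h1 : ((S.biUnion Bad).card : ℝ) ≤ ∑ u' ∈ S, ((Bad u').card : ℝ) := by
        exact_mod_cast card_biUnion_le
      have h2 := sum_le_sum hbad
      rw [sum_const, nsmul_eq_mul] at h2
      have h3 : (S.card : ℝ) < (4 / c) ^ (Fintype.card U) := by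
        have h4 : S.card < 2 ^ Fintype.card U :=
          lt_of_le_of_lt (card_le_univ S) Nat.lt_two_pow_self
        have h5 : (S.card : ℝ) < 2 ^ Fintype.card U := by exact_mod_cast h4
        refine h5.trans_le ?_
        gcongr
        linarith
      have h6 : (S.card : ℝ) * (t * (4 / c) ^ h) < t * (4 / c) ^ (e + 1) := by
        calc (S.card : ℝ) * (t * (4 / c) ^ h)
            < (4 / c) ^ (Fintype.card U) * (t * (4 / c) ^ h) := by gcongr
          _ = t * (4 / c) ^ (Fintype.card U + h) := by rw [pow_add]; ring
          _ ≤ t * (4 / c) ^ (e + 1) := by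
            have := pow_le_pow_right₀ (show (1:ℝ) ≤ 4 / c by linarith)
              (show Fintype.card U + h ≤ e + 1 by omega)
            gcongr
      have : ((S.biUnion Bad).card : ℝ) < W.card := by linarith
      exact_mod_cast this
    obtain ⟨w, hwW, hwB⟩ := exists_mem_notMem_of_card_lt_card hlt
    obtain ⟨-, hw1, hw2, hw3⟩ := mem_cf.1 hwW
    have hgood : ∀ u' ∈ S, Rich G (t * (4 / c) ^ e)
      (h - F.dist r u') (insert w (φ '' {v | v ∈ S ∧ v ≠ u'})) (φ u') := by
      intro u' hu'
      by_contra hcon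
      exact hwB (mem_biUnion.2 ⟨u', hu', mem_cf.2 ⟨mem_univ _, hcon⟩⟩)
    have hnev : ∀ z ∈ S, z ≠ v := fun z hz hh => hvS (hh ▸ hz)
    have hupd : ∀ z ∈ S, Function.update φ v w z = φ z := fun z hz =>
      Function.update_of_ne (hnev z hz) _ _
    have hwne : ∀ z ∈ S, φ z ≠ w := by
      intro z hz
      by_cases hzu : z = u
      · subst hzu; exact hw1.ne
      · exact (hw2 (φ z) ⟨z, ⟨hz, hzu⟩, rfl⟩).2
    have hwadj : ∀ z ∈ S, (G.Adj (φ z) w ↔ F.Adj z v) := by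
      intro z hz
      by_cases hzu : z = u
      · subst hzu; exact ⟨fun _ => huv, fun _ => hw1⟩
      · exact ⟨fun hh => absurd hh (hw2 (φ z) ⟨z, ⟨hz, hzu⟩, rfl⟩).1,
          fun hh => absurd (huniq z hz hh) hzu⟩
    have himg : ∀ u' ∈ S, Function.update φ v w '' {z | z ∈ insert v S ∧ z ≠ u'} =
        insert w (φ '' {z | z ∈ S ∧ z ≠ u'}) := by
      intro u' hu'
      have h1 : {z | z ∈ insert v S ∧ z ≠ u'} = insert v {z | z ∈ S ∧ z ≠ u'} := by
        ext z
        simp only [mem_insert, Set.mem_ofPred_eq, Set.mem_insert_iff]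
        constructor
        · rintro ⟨rfl | hz, hzu⟩
          · exact Or.inl rfl
          · exact Or.inr ⟨hz, hzu⟩
        · rintro (rfl | ⟨hz, hzu⟩)
          · exact ⟨Or.inl rfl, (hnev u' hu').symm⟩
          · exact ⟨Or.inr hz, hzu⟩
      rw [h1, Set.image_insert_eq, Function.update_self]
      congr 1
      exact Set.image_congr (fun z hz => hupd z hz.1)
    have himgv : Function.update φ v w '' {z | z ∈ insert v S ∧ z ≠ v} = insert (φ u) Z := by
      have h1 : {z | z ∈ insert v S ∧ z ≠ v} = insert u {z | z ∈ S ∧ z ≠ u} := by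
        ext z
        simp only [mem_insert, Set.mem_ofPred_eq, Set.mem_insert_iff]
        constructor
        · rintro ⟨hz | hz, hzv⟩
          · exact absurd hz hzv
          · by_cases hzu : z = u
            · exact Or.inl hzu
            · exact Or.inr ⟨hz, hzu⟩
        · rintro (rfl | ⟨hz, hzu⟩)
          · exact ⟨Or.inr huS, hnev _ huS⟩
          · exact ⟨Or.inr hz, hnev z hz⟩
      rw [h1, Set.image_insert_eq, hupd u huS, hZ]
      congr 1
      exact Set.image_congr (fun z hz => hupd z hz.1)
    refine ⟨insert v S, Function.update φ v w, ?_, mem_insert_of_mem hrS, ?_, ?_, ?_, ?_⟩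
    · rw [card_insert_of_notMem hvS, hcard]
    · intro a ha b hb
      rw [mem_insert, not_or] at hb
      rcases mem_insert.1 ha with rfl | ha
      · exact hvmin b hb.2
      · exact hbfs a ha b hb.2
    · intro a ha b hb hab
      rcases mem_insert.1 ha with rfl | ha' <;> rcases mem_insert.1 hb with rfl | hb'
      · exact absurd rfl hab
      · rw [Function.update_self, hupd b hb']; exact (hwne b hb').symm
      · rw [Function.update_self, hupd a ha']; exact hwne a ha'
      · rw [hupd a ha', hupd b hb']; exact hinj a ha' b hb' hab
    · intro a ha b hb
      rcases mem_insert.1 ha with rfl | ha' <;> rcases mem_insert.1 hb with rfl | hb'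
      · simp
      · rw [Function.update_self, hupd b hb', G.adj_comm, F.adj_comm]; exact hwadj b hb'
      · rw [Function.update_self, hupd a ha']; exact hwadj a ha'
      · rw [hupd a ha', hupd b hb']; exact hadj a ha' b hb'
    · intro a ha
      rcases mem_insert.1 ha with rfl | ha
      · rw [himgv, Function.update_self]
        refine Rich.mono ?_ _ _ _ hw3
        gcongr
        · linarith
        · omega
      · rw [himg a ha, hupd a ha]
        exact hgood a ha

end aux

/-- if `F` is a tree of radius `h`, `c ∈ (0,1/2)` and `t ≥ 1`,
then every `(c,t)`-sparse graph `G` with average degree at least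
`(4/c)^(4h|V(F)|)·t` contains an induced subgraph isomorphic to `F`. -/
theorem stmt6 (U : Type) [Fintype U] (F : SimpleGraph U) (hF : F.IsTree)
    (h : ℕ) (hrad : graphRadius F = h)
    (c : ℝ) (hc0 : 0 < c) (hc2 : c < 1 / 2) (t : ℕ) (ht : 1 ≤ t)
    (V : Type) [Fintype V] (G : SimpleGraph V) (hG : CTSparse G c t)
    (hdeg : (4 / c) ^ (4 * h * Fintype.card U) * t ≤ avgDeg G) :
    Nonempty (F ↪g G) := by
  classical
  have hK : 8 < 4 / c := by rw [lt_div_iff₀ hc0]; linarith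
  have htR : (1 : ℝ) ≤ t := by exact_mod_cast ht
  have hpos : 0 < avgDeg G := lt_of_lt_of_le (by positivity) hdeg
  have hV : Nonempty V := by
    by_contra hcon
    rw [not_nonempty_iff] at hcon
    simp [avgDeg] at hpos
  have hne : {h : ℕ | ∃ v : U, ∀ u : U, F.dist v u ≤ h}.Nonempty := by
    obtain ⟨v⟩ := hF.connected.nonempty
    exact ⟨Finset.univ.sup (fun u => F.dist v u), v, fun u =>
      Finset.le_sup (f := fun u => F.dist v u) (Finset.mem_univ u)⟩
  obtain ⟨r, hr⟩ : ∃ v : U, ∀ u : U, F.dist v u ≤ h := by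
    have := Nat.sInf_mem hne
    rw [← hrad]
    exact this
  rcases Nat.eq_zero_or_pos h with h0 | hpos'
  · obtain ⟨x⟩ := hV
    have hs : ∀ u : U, u = r := fun u =>
      (hF.connected.dist_eq_zero_iff.1 (by have := hr u; omega)).symm
    refine ⟨⟨⟨fun _ => x, fun a b _ => by rw [hs a, hs b]⟩, ?_⟩⟩
    intro a b
    rw [hs a, hs b]
    simp
  have hn : 2 ≤ Fintype.card U := by
    by_contra hcon
    have hsub : Subsingleton U := Fintype.card_le_one_iff_subsingleton.1 (by omega)
    have : graphRadius F ≤ 0 := Nat.sInf_le ⟨r, fun u => by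
      rw [Subsingleton.elim u r]; simp⟩
    omega
  set n := Fintype.card U with hndef
  obtain ⟨x, hx⟩ : ∃ x, Rich G (t * (4 / c) ^ ((n + h) + n)) h ∅ x := by
    by_contra hcon
    push Not at hcon
    have h1 := lemR G hc0 ht hc2 hG (2 * n + 2 * h) h (by omega)
    have h2 : 2 * n + 2 * h - h = (n + h) + n := by omega
    rw [h2] at h1
    have h3 : cf Finset.univ (fun x => ¬ Rich G (t * (4 / c) ^ ((n + h) + n)) h ∅ x)
        = Finset.univ := by
      ext x; simp [mem_cf, hcon x]
    rw [h3] at h1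
    have h4 : ∑ x : V, ((cf Finset.univ (fun w => G.Adj x w)).card : ℝ) =
        2 * (G.edgeSet.ncard : ℝ) := by
      have h5 := G.sum_degrees_eq_twice_card_edges
      have h6 : G.edgeSet.ncard = G.edgeFinset.card := by
        rw [← coe_edgeFinset, Set.ncard_coe_finset]
      rw [h6]
      have h7 : ∀ x, G.degree x = (cf Finset.univ (fun w => G.Adj x w)).card := by
        intro x
        rw [← card_neighborFinset_eq_degree]
        congr 1
        ext w; simp [mem_cf]
      simp only [h7] at h5
      exact_mod_cast h5
    rw [h4] at h1
    have hVp : (0 : ℝ) < Fintype.card V := by exact_mod_cast Fintype.card_pos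
    have h8 : avgDeg G ≤ h * (2 * (t * (4 / c) ^ (2 * n + 2 * h))) := by
      unfold avgDeg
      rw [Nat.card_eq_fintype_card, div_le_iff₀ hVp]
      exact h1
    have h9 : (4 / c) ^ (2 * n + 2 * h + h) ≤ (4 / c) ^ (4 * h * n) :=
      pow_le_pow_right₀ (by linarith) (by nlinarith)
    have h10 : (2 * h : ℝ) < (4 / c) ^ h := by
      have ha : 2 * h < 2 * 2 ^ h := by have := Nat.lt_two_pow_self (n := h); omega
      have hb : 2 * 2 ^ h ≤ 8 ^ h := by
        have h4 : 2 ≤ 4 ^ h := by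
          calc 2 ≤ 4 ^ 1 := by norm_num
            _ ≤ 4 ^ h := Nat.pow_le_pow_right (by norm_num) hpos'
        have h5 : 8 ^ h = 4 ^ h * 2 ^ h := by rw [← mul_pow]; norm_num
        rw [h5]
        exact Nat.mul_le_mul_right _ h4
      have hc : (2 * h : ℝ) < 8 ^ h := by exact_mod_cast lt_of_lt_of_le ha hb
      refine hc.trans_le ?_
      gcongr
    have h11 : (0 : ℝ) < t * (4 / c) ^ (2 * n + 2 * h) := by positivity
    have h12 := mul_lt_mul_of_pos_right h10 h11
    have h13 := mul_le_mul_of_nonneg_right h9 (show (0 : ℝ) ≤ t by positivity)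
    rw [pow_add] at h13
    linarith
  obtain ⟨S, φ, hcard, -, -, hinj, hadj, -⟩ := embed_step hF hr G hc0 ht hc2 hG (n + h) le_rfl hx
    (n - 1) (by omega)
  have hS : S = Finset.univ := by
    rw [← Finset.card_eq_iff_eq_univ]; omega
  subst hS
  refine ⟨⟨⟨φ, fun a b hab => ?_⟩, ?_⟩⟩
  · by_contra hne
    exact hinj a (Finset.mem_univ _) b (Finset.mem_univ _) hne hab
  · intro a b
    exact hadj a (Finset.mem_univ _) b (Finset.mem_univ _)
end
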